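/- Cyclotomic Mackey theorem: for every H_n^f-module M there is an isomorphism of H_n^f-modules, natural in M: res^{H_{n+1}^f}_{H_n^f} ind^{H_{n+1}^f}_{H_n^f} M ≅ (M ⊕ ΠM)^{⊕d} ⊕ ind^{H_n^f}_{H_{n−1}^f} res^{H_n^f}_{H_{n−1}^f} M. -/

import Mathlib

set_option maxHeartbeats 1000000

namespace HC

/-- Generators of the affine Hecke–Clifford superalgebra `H_n`. -/
inductive Gen (n : ℕ) : Type
  | X : Fin n → Gen n
  | Xinv : Fin n → Gen n
  | C : Fin n → Gen n
  | T : Fin (n - 1) → Gen n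

/-- The node `i` of `Fin n`, for `i : Fin (n-1)` (1-based: the node `i`). -/
def lo {n : ℕ} (i : Fin (n - 1)) : Fin n :=
  ⟨i.val, by have := i.isLt; omega⟩

/-- The node `i+1` of `Fin n`, for `i : Fin (n-1)`. -/
def hi {n : ℕ} (i : Fin (n - 1)) : Fin n :=
  ⟨i.val + 1, by have := i.isLt; omega⟩

variable (F : Type) [Field F]

/-- The free algebra on the generators. -/
abbrev FA (n : ℕ) : Type := FreeAlgebra F (Gen n)

noncomputable def fx {n : ℕ} (i : Fin n) : FA F n := FreeAlgebra.ι F (Gen.X i)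
noncomputable def fxinv {n : ℕ} (i : Fin n) : FA F n := FreeAlgebra.ι F (Gen.Xinv i)
noncomputable def fc {n : ℕ} (i : Fin n) : FA F n := FreeAlgebra.ι F (Gen.C i)
noncomputable def ft {n : ℕ} (i : Fin (n - 1)) : FA F n := FreeAlgebra.ι F (Gen.T i)

/-- The defining relations of the affine Hecke–Clifford superalgebra, with parameter
`q` and `ξ = q - q⁻¹`. -/
inductive Rel (q : F) (n : ℕ) : FA F n → FA F n → Prop
  | XXinv (i : Fin n) : Rel q n (fx F i * fxinv F i) 1
  | XinvX (i : Fin n) : Rel q n (fxinv F i * fx F i) 1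
  | XX (i j : Fin n) : Rel q n (fx F i * fx F j) (fx F j * fx F i)
  | XiXi (i j : Fin n) : Rel q n (fxinv F i * fxinv F j) (fxinv F j * fxinv F i)
  | XXi (i j : Fin n) (h : i ≠ j) : Rel q n (fx F i * fxinv F j) (fxinv F j * fx F i)
  | CC (i : Fin n) : Rel q n (fc F i * fc F i) 1
  | Canti (i j : Fin n) (h : i ≠ j) : Rel q n (fc F i * fc F j) (-(fc F j * fc F i))
  | CX (i : Fin n) : Rel q n (fc F i * fx F i) (fxinv F i * fc F i)
  | CXi (i : Fin n) : Rel q n (fc F i * fxinv F i) (fx F i * fc F i)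
  | CXo (i j : Fin n) (h : i ≠ j) : Rel q n (fc F i * fx F j) (fx F j * fc F i)
  | CXio (i j : Fin n) (h : i ≠ j) : Rel q n (fc F i * fxinv F j) (fxinv F j * fc F i)
  | Tquad (i : Fin (n - 1)) : Rel q n (ft F i * ft F i) ((q - q⁻¹) • ft F i + 1)
  | Tbraid (i j : Fin (n - 1)) (h : (j : ℕ) = (i : ℕ) + 1) :
      Rel q n (ft F i * ft F j * ft F i) (ft F j * ft F i * ft F j)
  | TTfar (i j : Fin (n - 1)) (h : (i : ℕ) + 1 < (j : ℕ)) :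
      Rel q n (ft F i * ft F j) (ft F j * ft F i)
  | TC (i : Fin (n - 1)) : Rel q n (ft F i * fc F (lo i)) (fc F (hi i) * ft F i)
  | TCo (i : Fin (n - 1)) (j : Fin n) (h1 : j ≠ lo i) (h2 : j ≠ hi i) :
      Rel q n (ft F i * fc F j) (fc F j * ft F i)
  | TXo (i : Fin (n - 1)) (j : Fin n) (h1 : j ≠ lo i) (h2 : j ≠ hi i) :
      Rel q n (ft F i * fx F j) (fx F j * ft F i)
  | TXio (i : Fin (n - 1)) (j : Fin n) (h1 : j ≠ lo i) (h2 : j ≠ hi i) :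
      Rel q n (ft F i * fxinv F j) (fxinv F j * ft F i)
  | cross (i : Fin (n - 1)) :
      Rel q n ((ft F i + (q - q⁻¹) • (fc F (lo i) * fc F (hi i))) * fx F (lo i) * ft F i)
        (fx F (hi i))

/-- The affine Hecke–Clifford superalgebra `H_n` over `F` with parameter `q`. -/
abbrev H (q : F) (n : ℕ) : Type := RingQuot (Rel F q n)

noncomputable def X (q : F) {n : ℕ} (i : Fin n) : H F q n :=
  RingQuot.mkAlgHom F (Rel F q n) (fx F i)

noncomputable def Xinv (q : F) {n : ℕ} (i : Fin n) : H F q n :=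
  RingQuot.mkAlgHom F (Rel F q n) (fxinv F i)

noncomputable def C (q : F) {n : ℕ} (i : Fin n) : H F q n :=
  RingQuot.mkAlgHom F (Rel F q n) (fc F i)

noncomputable def T (q : F) {n : ℕ} (i : Fin (n - 1)) : H F q n :=
  RingQuot.mkAlgHom F (Rel F q n) (ft F i)

/-- `q` is either a primitive root of unity of odd order (including `q = 1`)
or not a root of unity at all (and `q ≠ 0`). -/
def GoodParam (q : F) : Prop :=
  q ≠ 0 ∧ ((∃ m : ℕ, Odd m ∧ IsPrimitiveRoot q m) ∨ ∀ m : ℕ, 0 < m → q ^ m ≠ 1)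

/-- `X_i^a` for an integer exponent `a ∈ ℤ`. -/
noncomputable def XZ (q : F) {n : ℕ} (i : Fin n) (a : ℤ) : H F q n :=
  if 0 ≤ a then X F q i ^ a.toNat else Xinv F q i ^ (-a).toNat

/-- The monomial `X^α = X_1^{α_1} ⋯ X_n^{α_n}` for `α ∈ ℤ^n`. -/
noncomputable def Xmon (q : F) {n : ℕ} (α : Fin n → ℤ) : H F q n :=
  ((List.finRange n).map fun i => XZ F q i (α i)).prod

/-- The monomial `C^β = C_1^{β_1} ⋯ C_n^{β_n}` for `β ∈ {0,1}^n`. -/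
noncomputable def Cmon (q : F) {n : ℕ} (β : Fin n → Bool) : H F q n :=
  ((List.finRange n).map fun i => if β i then C F q i else 1).prod

/-- The basic transposition `s_i = (i, i+1)` of `S_n`. -/
def s {n : ℕ} (i : Fin (n - 1)) : Equiv.Perm (Fin n) := Equiv.swap (lo i) (hi i)

/-- The Coxeter length (number of inversions) of a permutation of `Fin n`. -/
def len {n : ℕ} (w : Equiv.Perm (Fin n)) : ℕ :=
  ((Finset.univ : Finset (Fin n × Fin n)).filter fun p => p.1 < p.2 ∧ w p.2 < w p.1).card

/-- `Tw` is the family of standard basis elements `T_w`, `w ∈ S_n`: it satisfies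
`T_1 = 1`, `T_{s_i} = T_i`, and `T_{s_i w} = T_i T_w` whenever `ℓ(s_i w) = ℓ(w) + 1`.
These conditions determine the family uniquely. -/
def IsTFam (q : F) {n : ℕ} (Tw : Equiv.Perm (Fin n) → H F q n) : Prop :=
  Tw 1 = 1 ∧ (∀ i : Fin (n - 1), Tw (s i) = T F q i) ∧
    ∀ (i : Fin (n - 1)) (w : Equiv.Perm (Fin n)),
      len (s i * w) = len w + 1 → Tw (s i * w) = T F q i * Tw w

/-- `h` is the quantum characteristic of `q`:  the smallest positive integer with
`q^{1-h} + q^{3-h} + ⋯ + q^{h-1} = 0`. -/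
def qcharEq (q : F) (h : ℕ) : Prop :=
  0 < h ∧ (∑ k ∈ Finset.range h, q ^ (1 - (h : ℤ) + 2 * (k : ℤ))) = 0 ∧
    ∀ h' : ℕ, 0 < h' → h' < h →
      (∑ k ∈ Finset.range h', q ^ (1 - (h' : ℤ) + 2 * (k : ℤ))) ≠ 0

/-- `i ∈ I = {0, 1, …, ℓ}` where `ℓ = (h-1)/2` (no condition if the quantum
characteristic is infinite). -/
def memI (q : F) (i : ℕ) : Prop := ∀ h : ℕ, qcharEq F q h → 2 * i + 1 ≤ h

/-- `q(i) = 2(q^{2i+1} + q^{-2i-1})/(q + q⁻¹)`. -/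
noncomputable def qres (q : F) (i : ℕ) : F :=
  2 * (q ^ (2 * i + 1) + q⁻¹ ^ (2 * i + 1)) / (q + q⁻¹)

/-- Index of the block containing position `k` (0-based), for a composition given as a
list of parts. -/
def blk : List ℕ → ℕ → ℕ
  | [], _ => 0
  | a :: rest, k => if k < a then 0 else blk rest (k - a) + 1

/-- Membership in the Young subgroup `S_μ ⊆ S_n`. -/
def InYoung {n : ℕ} (μ : List ℕ) (w : Equiv.Perm (Fin n)) : Prop :=
  ∀ k : Fin n, blk μ (w k).val = blk μ k.val

/-- `μ` is a composition of `n`. -/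
def IsComposition (μ : List ℕ) (n : ℕ) : Prop := (∀ a ∈ μ, 0 < a) ∧ μ.sum = n

/-- The parabolic subalgebra generated by all `X_i^{±1}`, `C_i`, and the `T_j` with
`j` in a set `J` of admissible indices. -/
def parabolicJ (q : F) {n : ℕ} (J : Set (Fin (n - 1))) : Subalgebra F (H F q n) :=
  Algebra.adjoin F
    ((Set.range fun i : Fin n => X F q i) ∪ (Set.range fun i : Fin n => Xinv F q i) ∪
      (Set.range fun i : Fin n => C F q i) ∪ {h | ∃ j ∈ J, h = T F q j})

/-- The parabolic subalgebra `H_μ` for a composition `μ`. -/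
def parabolicC (q : F) {n : ℕ} (μ : List ℕ) : Subalgebra F (H F q n) :=
  parabolicJ F q {j | InYoung μ (s j)}

/-- The classical parabolic subalgebra `H^cl_μ`, generated by the `T_j` with `s_j ∈ S_μ`. -/
def clparC (q : F) {n : ℕ} (μ : List ℕ) : Subalgebra F (H F q n) :=
  Algebra.adjoin F {h | ∃ j : Fin (n - 1), InYoung μ (s j) ∧ h = T F q j}

/-- The finite Hecke–Clifford subalgebra `H^fn_n`, generated by all `C_i` and `T_j`. -/
def Hfin (q : F) (n : ℕ) : Subalgebra F (H F q n) :=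
  Algebra.adjoin F
    ((Set.range fun i : Fin n => C F q i) ∪ {h | ∃ j : Fin (n - 1), h = T F q j})

/-- `x` is a minimal length `(S_μ, S_ν)`-double coset representative. -/
def IsMinDC {n : ℕ} (μ ν : List ℕ) (x : Equiv.Perm (Fin n)) : Prop :=
  ∀ u v : Equiv.Perm (Fin n), InYoung μ u → InYoung ν v → len x ≤ len (u * x * v)

/-- `w ∈ S_μ x S_ν`. -/
def InDC {n : ℕ} (μ ν : List ℕ) (x w : Equiv.Perm (Fin n)) : Prop :=
  ∃ u v : Equiv.Perm (Fin n), InYoung μ u ∧ InYoung ν v ∧ w = u * x * v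

/-- A covering step in the Bruhat order: multiplication by a reflection increasing length. -/
def BruhatStep {n : ℕ} (v w : Equiv.Perm (Fin n)) : Prop :=
  ∃ a b : Fin n, a ≠ b ∧ w = Equiv.swap a b * v ∧ len v < len w

/-- The Bruhat order on `S_n`. -/
def BruhatLE {n : ℕ} : Equiv.Perm (Fin n) → Equiv.Perm (Fin n) → Prop :=
  Relation.ReflTransGen BruhatStep

/-- The space of `A`-equivariant linear maps between two representations of the
`F`-algebra `A`. -/
def eqvHoms {A : Type} [Ring A] [Algebra F A] {M N : Type}
    [AddCommGroup M] [Module F M] [AddCommGroup N] [Module F N]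
    (ρM : A →ₐ[F] Module.End F M) (ρN : A →ₐ[F] Module.End F N) :
    Submodule F (M →ₗ[F] N) where
  carrier := {f | ∀ (x : A) (m : M), f (ρM x m) = ρN x (f m)}
  add_mem' := by
    intro f g hf hg x m
    simp only [LinearMap.add_apply, hf x m, hg x m, map_add]
  zero_mem' := by
    intro x m
    simp only [LinearMap.zero_apply, map_zero]
  smul_mem' := by
    intro c f hf x m
    simp only [LinearMap.smul_apply, hf x m, map_smul]

/-- `(E, ρE, ι)` is the module induced along the algebra morphism `φ : B →ₐ A` from
the `B`-representation `(M, ρ)`, i.e. `E = A ⊗_B M`, characterized by its universal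
property. -/
def IsInducedAlong {A B : Type} [Ring A] [Ring B] [Algebra F A] [Algebra F B]
    (φ : B →ₐ[F] A) {M : Type} [AddCommGroup M] [Module F M]
    (ρ : B →ₐ[F] Module.End F M) {E : Type} [AddCommGroup E] [Module F E]
    (ρE : A →ₐ[F] Module.End F E) (ι : M →ₗ[F] E) : Prop :=
  (∀ (b : B) (m : M), ι (ρ b m) = ρE (φ b) (ι m)) ∧
    ∀ (P : Type) [AddCommGroup P] [Module F P],
      ∀ (ρP : A →ₐ[F] Module.End F P) (f : M →ₗ[F] P),
        (∀ (b : B) (m : M), f (ρ b m) = ρP (φ b) (f m)) →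
        ∃! g : E →ₗ[F] P,
          (∀ (x : A) (e : E), g (ρE x e) = ρP x (g e)) ∧ ∀ m : M, g (ι m) = f m

/-- `δ` is the grading automorphism of the superalgebra `H_n`
(identity on even generators, `-1` on the odd generators `C_i`). -/
def IsGradingAut (q : F) {n : ℕ} (δ : H F q n →ₐ[F] H F q n) : Prop :=
  (∀ i : Fin n, δ (X F q i) = X F q i) ∧ (∀ i : Fin n, δ (Xinv F q i) = Xinv F q i) ∧
    (∀ i : Fin n, δ (C F q i) = -C F q i) ∧ ∀ i : Fin (n - 1), δ (T F q i) = T F q i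

/-- `τ` is the antiautomorphism of `H_n` with `τ(T_i) = T_i + ξ C_i C_{i+1}`,
`τ(C_j) = C_j`, `τ(X_j) = X_j`. -/
def IsTauAntiAut (q : F) {n : ℕ} (τ : H F q n →ₗ[F] H F q n) : Prop :=
  Function.Bijective τ ∧ (∀ a b : H F q n, τ (a * b) = τ b * τ a) ∧ τ 1 = 1 ∧
    (∀ i : Fin (n - 1),
      τ (T F q i) = T F q i + (q - q⁻¹) • (C F q (lo i) * C F q (hi i))) ∧
    (∀ j : Fin n, τ (C F q j) = C F q j) ∧ (∀ j : Fin n, τ (X F q j) = X F q j) ∧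
    ∀ j : Fin n, τ (Xinv F q j) = Xinv F q j

/-- `ρ'` is the representation of the subalgebra `B` obtained from the
`H_ν`-representation `ρν` by twisting with the isomorphism `φ_{x⁻¹}`
(determined by `X_i ↦ X_{x⁻¹ i}`, `C_i ↦ C_{x⁻¹ i}`, `T_w ↦ T_{x⁻¹ w x}`). -/
def IsTwistedRep (q : F) {n : ℕ} (ν : List ℕ) (x : Equiv.Perm (Fin n))
    (B : Subalgebra F (H F q n)) {M : Type} [AddCommGroup M] [Module F M]
    (ρν : ↥(parabolicC F q (n := n) ν) →ₐ[F] Module.End F M)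
    (ρ' : ↥B →ₐ[F] Module.End F M) : Prop :=
  (∀ (i : Fin n) (a : ↥B) (b : ↥(parabolicC F q (n := n) ν)),
      (a : H F q n) = X F q i → (b : H F q n) = X F q (x⁻¹ i) → ρ' a = ρν b) ∧
  (∀ (i : Fin n) (a : ↥B) (b : ↥(parabolicC F q (n := n) ν)),
      (a : H F q n) = Xinv F q i → (b : H F q n) = Xinv F q (x⁻¹ i) → ρ' a = ρν b) ∧
  (∀ (i : Fin n) (a : ↥B) (b : ↥(parabolicC F q (n := n) ν)),
      (a : H F q n) = C F q i → (b : H F q n) = C F q (x⁻¹ i) → ρ' a = ρν b) ∧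
  ∀ (j j' : Fin (n - 1)) (a : ↥B) (b : ↥(parabolicC F q (n := n) ν)),
      lo j' = x⁻¹ (lo j) → (a : H F q n) = T F q j → (b : H F q n) = T F q j' → ρ' a = ρν b

/-- The element `f = a_d X_1^d + ⋯ + a_1 X_1 + a_0` of `H_n`. -/
noncomputable def felem (q : F) (n d : ℕ) (aa : ℕ → F) : H F q n :=
  if h : 0 < n then ∑ i ∈ Finset.range (d + 1), aa i • X F q (⟨0, h⟩ : Fin n) ^ i else 0

/-- The conditions on the coefficients of `f`: degree `d ≥ 1`, monic, and
`a_i = a_0 a_{d-i}`. -/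
def GoodPoly (d : ℕ) (aa : ℕ → F) : Prop :=
  1 ≤ d ∧ aa d = 1 ∧ (∀ i ≤ d, aa i = aa 0 * aa (d - i)) ∧ ∀ i : ℕ, d < i → aa i = 0

/-- The relation generating the two-sided ideal `I_f` of `H_n`. -/
inductive CycRel (q : F) (n d : ℕ) (aa : ℕ → F) : H F q n → H F q n → Prop
  | rel : CycRel q n d aa (felem F q n d aa) 0

/-- The cyclotomic Hecke–Clifford superalgebra `H_n^f = H_n / I_f`. -/
abbrev Hf (q : F) (n d : ℕ) (aa : ℕ → F) : Type := RingQuot (CycRel F q n d aa)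

/-- The canonical quotient map `H_n → H_n^f`. -/
noncomputable def cyc (q : F) (n d : ℕ) (aa : ℕ → F) : H F q n →ₐ[F] Hf F q n d aa :=
  RingQuot.mkAlgHom F (CycRel F q n d aa)

noncomputable def Xf (q : F) (n d : ℕ) (aa : ℕ → F) (i : Fin n) : Hf F q n d aa :=
  cyc F q n d aa (X F q i)
noncomputable def Xinvf (q : F) (n d : ℕ) (aa : ℕ → F) (i : Fin n) : Hf F q n d aa :=
  cyc F q n d aa (Xinv F q i)
noncomputable def Cf (q : F) (n d : ℕ) (aa : ℕ → F) (i : Fin n) : Hf F q n d aa :=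
  cyc F q n d aa (C F q i)
noncomputable def Tf (q : F) (n d : ℕ) (aa : ℕ → F) (i : Fin (n - 1)) : Hf F q n d aa :=
  cyc F q n d aa (T F q i)

/-- `e` is the canonical embedding `H_k^f → H_N^f` (shifting all indices by `sh`;
for `sh = 0` this is the standard identification of `H_k^f` with a subalgebra of
`H_N^f`). -/
def IsCycEmb (q : F) (k N d : ℕ) (aa : ℕ → F) (sh : ℕ)
    (e : Hf F q k d aa →ₐ[F] Hf F q N d aa) : Prop :=
  (∀ (i : Fin k) (i' : Fin N), (i' : ℕ) = sh + (i : ℕ) →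
      e (Xf F q k d aa i) = Xf F q N d aa i') ∧
  (∀ (i : Fin k) (i' : Fin N), (i' : ℕ) = sh + (i : ℕ) →
      e (Xinvf F q k d aa i) = Xinvf F q N d aa i') ∧
  (∀ (i : Fin k) (i' : Fin N), (i' : ℕ) = sh + (i : ℕ) →
      e (Cf F q k d aa i) = Cf F q N d aa i') ∧
  ∀ (j : Fin (k - 1)) (j' : Fin (N - 1)), (j' : ℕ) = sh + (j : ℕ) →
      e (Tf F q k d aa j) = Tf F q N d aa j'

/-- `δ` is the grading automorphism of the superalgebra `H_n^f`. -/
def IsCycGrading (q : F) (n d : ℕ) (aa : ℕ → F)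
    (δ : Hf F q n d aa →ₐ[F] Hf F q n d aa) : Prop :=
  (∀ i : Fin n, δ (Xf F q n d aa i) = Xf F q n d aa i) ∧
  (∀ i : Fin n, δ (Xinvf F q n d aa i) = Xinvf F q n d aa i) ∧
  (∀ i : Fin n, δ (Cf F q n d aa i) = -Cf F q n d aa i) ∧
  ∀ j : Fin (n - 1), δ (Tf F q n d aa j) = Tf F q n d aa j

/-- The elements `f_1 = f`, `f_{i+1} = (T_i + ξ C_i C_{i+1}) f_i T_i` of `H_n`
(0-based indexing: `fseq k = f_{k+1}`). -/
noncomputable def fseq (q : F) (n d : ℕ) (aa : ℕ → F) : ℕ → H F q n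
  | 0 => felem F q n d aa
  | k + 1 =>
    if h : k < n - 1 then
      (T F q (⟨k, h⟩ : Fin (n - 1)) +
          (q - q⁻¹) • (C F q (lo (⟨k, h⟩ : Fin (n - 1))) *
            C F q (hi (⟨k, h⟩ : Fin (n - 1))))) *
        fseq q n d aa k * T F q (⟨k, h⟩ : Fin (n - 1))
    else 0

/-- `f_Z = f_{z_1} ⋯ f_{z_u}` for `Z = {z_1 < ⋯ < z_u} ⊆ {1,…,n}` (0-based). -/
noncomputable def fZ (q : F) (n d : ℕ) (aa : ℕ → F) (Z : Finset (Fin n)) : H F q n :=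
  ((Z.sort (· ≤ ·)).map fun z => fseq F q n d aa (z : ℕ)).prod

/-- Elements of an algebra satisfying the defining relations of the affine Hecke–Clifford
superalgebra on `N` strands, with strands numbered from `0`. -/
structure Sys {F : Type} [Field F] (ξ : F) (A : Type) [Ring A] [Algebra F A] (N : ℕ) where
  x : ℕ → A
  y : ℕ → A
  c : ℕ → A
  t : ℕ → A
  xy : ∀ i < N, x i * y i = 1
  yx : ∀ i < N, y i * x i = 1
  xx : ∀ i < N, ∀ j < N, x i * x j = x j * x i
  cc : ∀ i < N, c i * c i = 1
  canti : ∀ i < N, ∀ j < N, i ≠ j → c i * c j = -(c j * c i)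
  cx : ∀ i < N, c i * x i = y i * c i
  cxo : ∀ i < N, ∀ j < N, i ≠ j → c i * x j = x j * c i
  tt : ∀ i, i + 1 < N → t i * t i = ξ • t i + 1
  braid : ∀ i, i + 2 < N → t i * t (i + 1) * t i = t (i + 1) * t i * t (i + 1)
  far : ∀ i j, i + 1 < j → j + 1 < N → t i * t j = t j * t i
  tc : ∀ i, i + 1 < N → t i * c i = c (i + 1) * t i
  tco : ∀ i, i + 1 < N → ∀ j < N, j ≠ i → j ≠ i + 1 → t i * c j = c j * t i
  txo : ∀ i, i + 1 < N → ∀ j < N, j ≠ i → j ≠ i + 1 → t i * x j = x j * t i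
  cross : ∀ i, i + 1 < N → (t i + ξ • (c i * c (i + 1))) * x i * t i = x (i + 1)

theorem mul_comm_of_inverse {A : Type} [Ring A] {a x y : A} (h1 : x * y = 1) (h2 : y * x = 1)
    (h : a * x = x * a) : a * y = y * a := by
  calc a * y = (y * x) * a * y := by rw [h2, one_mul]
    _ = y * (a * x) * y := by rw [h]; noncomm_ring
    _ = y * a * (x * y) := by noncomm_ring
    _ = y * a := by rw [h1, mul_one]

theorem clifford_comm {F : Type} [Field F] {A : Type} [Ring A] [Algebra F A] {ξ : F}
    {t c c' : A} (ht : t * t = ξ • t + 1) (htc : t * c = c' * t) :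
    c * t = t * c' - ξ • (c' - c) := by
  have i1 : (t - ξ • 1) * t = 1 := by rw [sub_mul, ht, smul_mul_assoc, one_mul]; abel
  have i2 : t * (t - ξ • 1) = 1 := by rw [mul_sub, ht, mul_smul_comm, mul_one]; abel
  have h1 : c = (t - ξ • 1) * c' * t := by
    rw [mul_assoc, ← htc, ← mul_assoc, i1, one_mul]
  have h2 : c * (t - ξ • 1) = (t - ξ • 1) * c' := by
    conv_lhs => rw [h1, mul_assoc, i2, mul_one]
  rw [mul_sub, sub_mul, mul_smul_comm, smul_mul_assoc, mul_one, one_mul,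
    sub_eq_iff_eq_add] at h2
  rw [h2]; module

theorem clifford_twist_sq {F : Type} [Field F] {A : Type} [Ring A] [Algebra F A] {ξ : F}
    {t c c' : A} (ht : t * t = ξ • t + 1) (htc : t * c = c' * t) (hc : c * c = 1)
    (hc' : c' * c' = 1) (hcc : c * c' = -(c' * c)) :
    (t + ξ • (c * c')) * (t + ξ • (c * c')) = ξ • (t + ξ • (c * c')) + 1 := by
  have h3 : t * c' = c * t + ξ • (c' - c) := by rw [clifford_comm ht htc]; abel
  have h5 : t * (c * c') = -(c * c' * t) + ξ • (c * c') + ξ • 1 := by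
    rw [← mul_assoc, htc, mul_assoc, h3, mul_add, ← mul_assoc, mul_smul_comm, mul_sub, hc', hcc]
    simp only [smul_sub, smul_neg, neg_mul, neg_neg]
    abel
  have h4 : c * c' * (c * c') = -1 := by
    calc _ = c * c' * c * c' := by noncomm_ring
      _ = _ := by rw [hcc, neg_mul, neg_mul, mul_assoc c', hc, mul_one, hc']
  rw [mul_add, add_mul, add_mul, ht, mul_smul_comm, h5, smul_mul_assoc,
    smul_mul_assoc, mul_smul_comm, h4]
  module

namespace Sys

variable {F : Type} [Field F] {ξ : F} {A : Type} [Ring A] [Algebra F A] {N : ℕ}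

section relations

variable (S : Sys ξ A N)

theorem x_y_comm {i j : ℕ} (hi : i < N) (hj : j < N) : S.x i * S.y j = S.y j * S.x i :=
  mul_comm_of_inverse (S.xy j hj) (S.yx j hj) (S.xx i hi j hj)

theorem y_y_comm {i j : ℕ} (hi : i < N) (hj : j < N) : S.y i * S.y j = S.y j * S.y i :=
  mul_comm_of_inverse (S.xy j hj) (S.yx j hj) (S.x_y_comm hj hi).symm

theorem c_y_comm {i j : ℕ} (hi : i < N) (hj : j < N) (h : i ≠ j) :
    S.c i * S.y j = S.y j * S.c i :=
  mul_comm_of_inverse (S.xy j hj) (S.yx j hj) (S.cxo i hi j hj h)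

theorem cy {i : ℕ} (hi : i < N) : S.c i * S.y i = S.x i * S.c i := by
  have h := S.cx i hi
  calc S.c i * S.y i = (S.x i * S.y i) * S.c i * S.y i := by rw [S.xy i hi, one_mul]
    _ = S.x i * (S.y i * S.c i) * S.y i := by noncomm_ring
    _ = S.x i * S.c i * (S.x i * S.y i) := by rw [← h]; noncomm_ring
    _ = S.x i * S.c i := by rw [S.xy i hi, mul_one]

theorem t_y_comm {i j : ℕ} (hi : i + 1 < N) (hj : j < N) (h1 : j ≠ i) (h2 : j ≠ i + 1) :
    S.t i * S.y j = S.y j * S.t i :=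
  mul_comm_of_inverse (S.xy j hj) (S.yx j hj) (S.txo i hi j hj h1 h2)

/-- The inverse of `t i`. -/
def tinv (i : ℕ) : A := S.t i - algebraMap F A ξ

theorem t_tinv {i : ℕ} (hi : i + 1 < N) : S.t i * S.tinv i = 1 := by
  rw [tinv, mul_sub, S.tt i hi, ← Algebra.commutes, Algebra.smul_def]; abel

theorem tinv_t {i : ℕ} (hi : i + 1 < N) : S.tinv i * S.t i = 1 := by
  rw [tinv, sub_mul, S.tt i hi, Algebra.smul_def]; abel

/-- `t i + ξ c i c (i+1)`. -/
def t' (i : ℕ) : A := S.t i + ξ • (S.c i * S.c (i + 1))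

theorem c_t {i : ℕ} (hi : i + 1 < N) :
    S.c i * S.t i = S.t i * S.c (i + 1) - ξ • (S.c (i + 1) - S.c i) :=
  clifford_comm (S.tt i hi) (S.tc i hi)

theorem t'_sq {i : ℕ} (hi : i + 1 < N) : S.t' i * S.t' i = ξ • S.t' i + 1 :=
  clifford_twist_sq (S.tt i hi) (S.tc i hi) (S.cc i (by omega)) (S.cc (i + 1) hi)
    (S.canti i (by omega) (i + 1) hi (by omega))

theorem t'_inv {i : ℕ} (hi : i + 1 < N) : (S.t' i - algebraMap F A ξ) * S.t' i = 1 := by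
  rw [sub_mul, S.t'_sq hi, Algebra.smul_def]; abel

theorem x_t {i : ℕ} (hi : i + 1 < N) :
    S.x i * S.t i = (S.t' i - algebraMap F A ξ) * S.x (i + 1) := by
  rw [← S.cross i hi, ← mul_assoc, ← mul_assoc, ← t', S.t'_inv hi, one_mul]

theorem x_t_eq {i : ℕ} (hi : i + 1 < N) : S.x i * S.t i =
    S.t i * S.x (i + 1) - ξ • (S.x (i + 1) - S.c i * S.c (i + 1) * S.x (i + 1)) := by
  rw [S.x_t hi, t', sub_mul, add_mul, smul_mul_assoc, ← Algebra.smul_def]; module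

theorem x_succ_t {i : ℕ} (hi : i + 1 < N) : S.x (i + 1) * S.t i =
    S.t i * S.x i + ξ • (S.x (i + 1) + S.c i * S.c (i + 1) * S.x i) := by
  have h := S.cross i hi
  have h2 : S.x (i + 1) * S.tinv i = S.t' i * S.x i := by
    rw [← h, mul_assoc, S.t_tinv hi, mul_one, t']
  rw [tinv, mul_sub, ← Algebra.commutes, sub_eq_iff_eq_add, t', add_mul, ← Algebra.smul_def,
    smul_mul_assoc] at h2
  rw [h2]; module

theorem y_t {i : ℕ} (hi : i + 1 < N) : S.y i * S.t i =
    S.t i * S.y (i + 1) - ξ • (S.y i * S.c i * S.c (i + 1)) + ξ • S.y i := by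
  have h := S.x_t_eq hi
  have h2 : S.y i * (S.x i * S.t i) * S.y (i + 1) = S.t i * S.y (i + 1) := by
    rw [← mul_assoc, S.yx i (by omega), one_mul]
  rw [← h2, h]
  simp only [mul_sub, sub_mul, mul_smul_comm, smul_mul_assoc, mul_assoc, S.xy (i + 1) hi, mul_one]
  module

theorem y_succ_t {i : ℕ} (hi : i + 1 < N) : S.y (i + 1) * S.t i =
    S.t i * S.y i - ξ • (S.y i + S.y (i + 1) * (S.c i * S.c (i + 1))) := by
  have h := S.x_succ_t hi
  have h2 : S.y (i + 1) * (S.x (i + 1) * S.t i) * S.y i = S.t i * S.y i := by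
    rw [← mul_assoc, S.yx (i + 1) (by omega), one_mul]
  rw [← h2, h]
  simp only [mul_add, add_mul, mul_smul_comm, smul_mul_assoc, mul_assoc, S.xy i (by omega), mul_one]
  simp only [← mul_assoc, S.yx (i + 1) hi, one_mul]
  module

theorem x_pow_t {i : ℕ} (hi : i + 1 < N) (k : ℕ) : S.x i ^ k * S.t i =
    S.t i * S.x (i + 1) ^ k - ξ • ∑ j ∈ Finset.range k,
      S.x i ^ j * (1 - S.c i * S.c (i + 1)) * S.x (i + 1) ^ (k - j) := by
  induction k with
  | zero => simp
  | succ k ih =>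
    rw [pow_succ, mul_assoc, S.x_t_eq hi, mul_sub, ← mul_assoc, ih, Finset.sum_range_succ,
      Nat.add_sub_cancel_left, sub_mul, mul_assoc, ← pow_succ, smul_mul_assoc, Finset.sum_mul]
    have h : ∀ j ∈ Finset.range k, S.x i ^ j * (1 - S.c i * S.c (i + 1)) * S.x (i + 1) ^ (k - j)
        * S.x (i + 1) = S.x i ^ j * (1 - S.c i * S.c (i + 1)) * S.x (i + 1) ^ (k + 1 - j) := by
      intro j hj
      rw [mul_assoc _ (S.x (i+1) ^ (k - j)), ← pow_succ]
      congr 2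
      have := Finset.mem_range.1 hj
      omega
    rw [Finset.sum_congr rfl h, mul_smul_comm, smul_add, pow_one]
    simp only [mul_sub, sub_mul, mul_one, mul_assoc]
    abel

end relations

/-- Forgetting strands. -/
def restrict (S : Sys ξ A N) {M : ℕ} (h : M ≤ N) : Sys ξ A M where
  x := S.x
  y := S.y
  c := S.c
  t := S.t
  xy i hi := S.xy i (by omega)
  yx i hi := S.yx i (by omega)
  xx i hi j hj := S.xx i (by omega) j (by omega)
  cc i hi := S.cc i (by omega)
  canti i hi j hj h := S.canti i (by omega) j (by omega) h
  cx i hi := S.cx i (by omega)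
  cxo i hi j hj h := S.cxo i (by omega) j (by omega) h
  tt i hi := S.tt i (by omega)
  braid i hi := S.braid i (by omega)
  far i j h hj := S.far i j h (by omega)
  tc i hi := S.tc i (by omega)
  tco i hi j hj h1 h2 := S.tco i (by omega) j (by omega) h1 h2
  txo i hi j hj h1 h2 := S.txo i (by omega) j (by omega) h1 h2
  cross i hi := S.cross i (by omega)

end Sys

section algebra

variable (F : Type) [Field F] (q : F) (n : ℕ)

theorem mk_rel {a b : FA F n} (h : Rel F q n a b) :
    RingQuot.mkAlgHom F (Rel F q n) a = RingQuot.mkAlgHom F (Rel F q n) b :=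
  RingQuot.mkAlgHom_rel F h

/-- The generators of `H F q n` as a system. -/
noncomputable def hsys : Sys (q - q⁻¹) (H F q n) n where
  x i := if h : i < n then X F q ⟨i, h⟩ else 0
  y i := if h : i < n then Xinv F q ⟨i, h⟩ else 0
  c i := if h : i < n then C F q ⟨i, h⟩ else 0
  t i := if h : i < n - 1 then T F q ⟨i, h⟩ else 0
  xy i hi := by
    simpa [hi, X, Xinv] using mk_rel F q n (Rel.XXinv ⟨i, hi⟩)
  yx i hi := by
    simpa [hi, X, Xinv] using mk_rel F q n (Rel.XinvX ⟨i, hi⟩)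
  xx i hi j hj := by
    simpa [hi, hj, X] using mk_rel F q n (Rel.XX ⟨i, hi⟩ ⟨j, hj⟩)
  cc i hi := by
    simpa [hi, C] using mk_rel F q n (Rel.CC ⟨i, hi⟩)
  canti i hi j hj h := by
    simpa [hi, hj, C] using mk_rel F q n (Rel.Canti ⟨i, hi⟩ ⟨j, hj⟩ (by simpa using h))
  cx i hi := by
    simpa [hi, C, X, Xinv] using mk_rel F q n (Rel.CX ⟨i, hi⟩)
  cxo i hi j hj h := by
    simpa [hi, hj, C, X] using mk_rel F q n (Rel.CXo ⟨i, hi⟩ ⟨j, hj⟩ (by simpa using h))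
  tt i hi := by
    have h1 : i < n - 1 := by omega
    have := mk_rel F q n (Rel.Tquad ⟨i, h1⟩)
    simpa only [h1, dite_true, T, map_add, map_mul, map_smul, map_one] using this
  braid i hi := by
    have h1 : i < n - 1 := by omega
    have h2 : i + 1 < n - 1 := by omega
    have := mk_rel F q n (Rel.Tbraid ⟨i, h1⟩ ⟨i + 1, h2⟩ rfl)
    simpa only [h1, h2, dite_true, T, map_mul] using this
  far i j h hj := by
    have h1 : i < n - 1 := by omega
    have h2 : j < n - 1 := by omega
    have := mk_rel F q n (Rel.TTfar ⟨i, h1⟩ ⟨j, h2⟩ h)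
    simpa only [h1, h2, dite_true, T, map_mul] using this
  tc i hi := by
    have h1 : i < n - 1 := by omega
    have h2 : i < n := by omega
    have := mk_rel F q n (Rel.TC ⟨i, h1⟩)
    simpa only [h1, h2, hi, dite_true, T, C, map_mul, lo, HC.hi] using this
  tco i hi j hj h1 h2 := by
    have h3 : i < n - 1 := by omega
    have := mk_rel F q n (Rel.TCo ⟨i, h3⟩ ⟨j, hj⟩ (by simpa [lo] using h1) (by simpa [HC.hi] using h2))
    simpa only [h3, hj, dite_true, T, C, map_mul] using this
  txo i hi j hj h1 h2 := by
    have h3 : i < n - 1 := by omega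
    have := mk_rel F q n (Rel.TXo ⟨i, h3⟩ ⟨j, hj⟩ (by simpa [lo] using h1) (by simpa [HC.hi] using h2))
    simpa only [h3, hj, dite_true, T, X, map_mul] using this
  cross i hi := by
    have h1 : i < n - 1 := by omega
    have h2 : i < n := by omega
    have := mk_rel F q n (Rel.cross ⟨i, h1⟩)
    simpa only [h1, h2, hi, dite_true, T, C, X, map_mul, map_add, map_smul, lo, HC.hi] using this

variable {F q n}

theorem hsys_x (i : Fin n) : (hsys F q n).x i = X F q i := by simp [hsys]
theorem hsys_y (i : Fin n) : (hsys F q n).y i = Xinv F q i := by simp [hsys]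
theorem hsys_c (i : Fin n) : (hsys F q n).c i = C F q i := by simp [hsys]
theorem hsys_t (i : Fin (n - 1)) : (hsys F q n).t i = T F q i := by simp [hsys]

/-- The algebra morphism out of `H F q n` attached to a system. -/
noncomputable def Sys.lift {A : Type} [Ring A] [Algebra F A] (S : Sys (q - q⁻¹) A n) :
    H F q n →ₐ[F] A :=
  RingQuot.liftAlgHom F ⟨FreeAlgebra.lift F fun g => match g with
    | Gen.X i => S.x i
    | Gen.Xinv i => S.y i
    | Gen.C i => S.c i
    | Gen.T i => S.t i, by
    intro a b h
    induction h with
    | XXinv i => simpa [fx, fxinv] using S.xy i i.2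
    | XinvX i => simpa [fx, fxinv] using S.yx i i.2
    | XX i j => simpa [fx] using S.xx i i.2 j j.2
    | XiXi i j => simpa [fxinv] using S.y_y_comm i.2 j.2
    | XXi i j h => simpa [fx, fxinv] using S.x_y_comm i.2 j.2
    | CC i => simpa [fc] using S.cc i i.2
    | Canti i j h => simpa [fc] using S.canti i i.2 j j.2 (fun e => h (Fin.ext e))
    | CX i => simpa [fc, fx, fxinv] using S.cx i i.2
    | CXi i => simpa [fc, fx, fxinv] using S.cy i.2
    | CXo i j h => simpa [fc, fx] using S.cxo i i.2 j j.2 (fun e => h (Fin.ext e))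
    | CXio i j h => simpa [fc, fxinv] using S.c_y_comm i.2 j.2 (fun e => h (Fin.ext e))
    | Tquad i =>
      simpa only [ft, map_add, map_mul, map_smul, map_one, FreeAlgebra.lift_ι_apply]
        using S.tt i (by omega)
    | Tbraid i j h => simpa [ft, h] using S.braid i (by omega)
    | TTfar i j h => simpa [ft] using S.far i j h (by omega)
    | TC i => simpa [ft, fc, lo, hi] using S.tc i (by omega)
    | TCo i j h1 h2 =>
      simpa [ft, fc] using S.tco i (by omega) j j.2
          (fun e => h1 (Fin.ext e)) (fun e => h2 (Fin.ext e))
    | TXo i j h1 h2 =>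
      simpa [ft, fx] using S.txo i (by omega) j j.2
          (fun e => h1 (Fin.ext e)) (fun e => h2 (Fin.ext e))
    | TXio i j h1 h2 =>
      simpa [ft, fxinv] using S.t_y_comm (i := i) (by omega) j.2
          (fun e => h1 (Fin.ext e)) (fun e => h2 (Fin.ext e))
    | cross i =>
      simpa only [ft, fc, fx, lo, hi, map_add, map_mul, map_smul, FreeAlgebra.lift_ι_apply]
        using S.cross i (by omega)⟩

section lift

variable {A : Type} [Ring A] [Algebra F A] (S : Sys (q - q⁻¹) A n)

theorem Sys.lift_x {i : ℕ} (hi : i < n) : S.lift ((hsys F q n).x i) = S.x i := by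
  simp [hsys, hi, X, Sys.lift, fx]

theorem Sys.lift_y {i : ℕ} (hi : i < n) : S.lift ((hsys F q n).y i) = S.y i := by
  simp [hsys, hi, Xinv, Sys.lift, fxinv]

theorem Sys.lift_c {i : ℕ} (hi : i < n) : S.lift ((hsys F q n).c i) = S.c i := by
  simp [hsys, hi, C, Sys.lift, fc]

theorem Sys.lift_t {i : ℕ} (hi : i + 1 < n) : S.lift ((hsys F q n).t i) = S.t i := by
  have h : i < n - 1 := by omega
  simp [hsys, h, T, Sys.lift, ft]

end lift

variable (F q n) in
/-- The generators of `H F q n`, as a set. -/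
def gens : Set (H F q n) :=
  {a | (∃ i < n, a = (hsys F q n).x i) ∨ (∃ i < n, a = (hsys F q n).y i) ∨
    (∃ i < n, a = (hsys F q n).c i) ∨ ∃ i, i + 1 < n ∧ a = (hsys F q n).t i}

theorem adjoin_gens : Algebra.adjoin F (gens F q n) = ⊤ := by
  rw [eq_top_iff]
  rintro a -
  obtain ⟨b, rfl⟩ := RingQuot.mkAlgHom_surjective F (Rel F q n) a
  induction b using FreeAlgebra.induction with
  | grade0 r => simp
  | grade1 g =>
    apply Algebra.subset_adjoin
    rcases g with i | i | i | i
    · exact Or.inl ⟨i, i.2, (hsys_x i).symm⟩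
    · exact Or.inr (Or.inl ⟨i, i.2, (hsys_y i).symm⟩)
    · exact Or.inr (Or.inr (Or.inl ⟨i, i.2, (hsys_c i).symm⟩))
    · exact Or.inr (Or.inr (Or.inr ⟨i, by omega, (hsys_t i).symm⟩))
  | mul a b ha hb => rw [map_mul]; exact mul_mem ha hb
  | add a b ha hb => rw [map_add]; exact add_mem ha hb

theorem hom_ext {A : Type} [Ring A] [Algebra F A] {g h : H F q n →ₐ[F] A}
    (hx : ∀ i < n, g ((hsys F q n).x i) = h ((hsys F q n).x i))
    (hy : ∀ i < n, g ((hsys F q n).y i) = h ((hsys F q n).y i))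
    (hc : ∀ i < n, g ((hsys F q n).c i) = h ((hsys F q n).c i))
    (ht : ∀ i, i + 1 < n → g ((hsys F q n).t i) = h ((hsys F q n).t i)) : g = h := by
  apply AlgHom.ext_of_adjoin_eq_top adjoin_gens
  rintro a (⟨i, hi, rfl⟩ | ⟨i, hi, rfl⟩ | ⟨i, hi, rfl⟩ | ⟨i, hi, rfl⟩)
  · exact hx i hi
  · exact hy i hi
  · exact hc i hi
  · exact ht i hi

end algebra

/-- The data on a vector space `L` from which a module over the affine Hecke–Clifford
superalgebra on the space of `L`-valued functions on permutations is constructed: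
`x`, `c` are commuting, respectively Clifford, operators and `κ a b` are the diagonal
entries of the intertwined generators. -/
structure LocalSys (F K L : Type) [Field F] [Field K] [Algebra F K] [AddCommGroup L] [Module K L]
    (ξ : F) (n : ℕ) where
  x : Fin n → Module.End K L
  y : Fin n → Module.End K L
  c : Fin n → Module.End K L
  κ : Fin n → Fin n → Module.End K L
  φ : Fin n → Fin n → K
  xy : ∀ a v, x a (y a v) = v
  yx : ∀ a v, y a (x a v) = v
  xx : ∀ a b v, x a (x b v) = x b (x a v)
  cc : ∀ a v, c a (c a v) = v
  canti : ∀ a b, a ≠ b → ∀ v, c a (c b v) = -c b (c a v)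
  cx : ∀ a v, c a (x a v) = y a (c a v)
  cxo : ∀ a b, a ≠ b → ∀ v, c a (x b v) = x b (c a v)
  κ_swap : ∀ a b, a ≠ b → ∀ v, κ a b v + κ b a v = -algebraMap F K ξ • v
  κ_c : ∀ a b, a ≠ b → ∀ v, κ a b (c a v) = c b (κ a b v)
  κ_co : ∀ a b, a ≠ b → ∀ d, d ≠ a → d ≠ b → ∀ v, κ a b (c d v) = c d (κ a b v)
  κ_xo : ∀ a b, a ≠ b → ∀ d, d ≠ a → d ≠ b → ∀ v, κ a b (x d v) = x d (κ a b v)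
  κ_x : ∀ a b, a ≠ b → ∀ v, x a (κ a b v) =
    κ a b (x b v) + algebraMap F K ξ • x b v - algebraMap F K ξ • c a (c b (x b v))
  κ_far : ∀ a b d e, a ≠ b → a ≠ d → a ≠ e → b ≠ d → b ≠ e → d ≠ e → ∀ v,
    κ a b (κ d e v) = κ d e (κ a b v)
  κ_mul : ∀ a b d, a ≠ b → a ≠ d → b ≠ d → ∀ v,
    κ b a (κ a d v) + κ b d (κ a b v) = κ a d (κ b d v)
  κ_sq : ∀ a b, a ≠ b → ∀ v,
    (φ a b * φ b a) • v = v - algebraMap F K ξ • κ a b v - κ a b (κ a b v)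

namespace LocalSys

variable {F K L : Type} [Field F] [Field K] [Algebra F K] [AddCommGroup L] [Module K L]
  {ξ : F} {n : ℕ} (S : LocalSys F K L ξ n)

/-- The operator on functions on permutations acting at `g` by `o (g i)`. -/
def diagOp (o : Fin n → Module.End K L) (i : Fin n) :
    Module.End K (Equiv.Perm (Fin n) → L) where
  toFun ψ g := o (g i) (ψ g)
  map_add' _ _ := by ext; simp
  map_smul' _ _ := by ext; simp

@[simp] theorem diagOp_apply (o : Fin n → Module.End K L) (i : Fin n)
    (ψ : Equiv.Perm (Fin n) → L) (g : Equiv.Perm (Fin n)) :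
    diagOp o i ψ g = o (g i) (ψ g) := rfl

/-- The generator exchanging the strands `i` and `j`. -/
def swapOp (i j : Fin n) : Module.End K (Equiv.Perm (Fin n) → L) where
  toFun ψ g := S.φ (g j) (g i) • ψ (g * Equiv.swap i j) - S.κ (g i) (g j) (ψ g)
  map_add' _ _ := by ext; simp; abel
  map_smul' _ _ := by ext; simp [smul_sub, smul_smul, mul_comm]

@[simp] theorem swapOp_apply (i j : Fin n) (ψ : Equiv.Perm (Fin n) → L)
    (g : Equiv.Perm (Fin n)) : S.swapOp i j ψ g =
    S.φ (g j) (g i) • ψ (g * Equiv.swap i j) - S.κ (g i) (g j) (ψ g) := rfl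

theorem κ_mul' {a b d : Fin n} (h1 : a ≠ b) (h2 : a ≠ d) (h3 : b ≠ d) (v : L) :
    S.κ a d (S.κ a b v) = S.κ d b (S.κ a d v) + S.κ a b (S.κ b d v) := by
  have s1 : ∀ w, S.κ a d w = -algebraMap F K ξ • w - S.κ d a w := fun w => by
    rw [← S.κ_swap a d h2 w]; abel
  have s2 : ∀ w, S.κ a b w = -algebraMap F K ξ • w - S.κ b a w := fun w => by
    rw [← S.κ_swap a b h1 w]; abel
  have s3 : ∀ w, S.κ b d w = -algebraMap F K ξ • w - S.κ d b w := fun w => by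
    rw [← S.κ_swap b d h3 w]; abel
  have hA := S.κ_mul d b a h3.symm h2.symm h1.symm v
  simp only [s1, s2, s3, map_sub, map_smul] at hA ⊢
  linear_combination (norm := module) -hA

theorem κ_braid {a b d : Fin n} (h1 : a ≠ b) (h2 : a ≠ d) (h3 : b ≠ d) (v : L) :
    (S.φ a b * S.φ b a) • S.κ a d v + S.κ a b (S.κ b d (S.κ a b v)) =
      (S.φ b d * S.φ d b) • S.κ a d v + S.κ b d (S.κ a b (S.κ b d v)) := by
  have e1 := S.κ_sq a b h1 (S.κ a d v)
  have e2 := congrArg (S.κ a d) (S.κ_sq b d h3 v)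
  have e3 := congrArg (S.κ a b) (S.κ_swap a b h1 (S.κ a d v))
  have e4 := congrArg (S.κ a b) (S.κ_mul a b d h1 h2 h3 v)
  have e5 := S.κ_mul a b d h1 h2 h3 (S.κ b d v)
  have e6 := S.κ_swap a b h1 (S.κ a d (S.κ b d v))
  simp only [map_add, map_sub, map_smul] at e1 e2 e3 e4 e5 e6
  linear_combination (norm := module) e1 - e2 - e3 + e4 - e5 + e6

theorem swapOp_sq {i j : Fin n} (h : i ≠ j) (ψ : Equiv.Perm (Fin n) → L) :
    S.swapOp i j (S.swapOp i j ψ) = algebraMap F K ξ • S.swapOp i j ψ + ψ := by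
  ext g
  have hg : g j ≠ g i := fun e => h (g.injective e).symm
  have e1 := S.κ_sq (g i) (g j) hg.symm (ψ g)
  have e2 := S.κ_swap (g i) (g j) hg.symm
  have e4 := e2 (ψ (g * Equiv.swap i j))
  simp only [swapOp_apply, Equiv.Perm.coe_mul, Function.comp_apply, Equiv.swap_apply_left,
    Equiv.swap_apply_right, mul_assoc, Equiv.swap_mul_self, mul_one, Pi.add_apply, Pi.smul_apply,
    map_sub, map_smul]
  linear_combination (norm := module) e1 - S.φ (g j) (g i) • e4

theorem swapOp_comm_diagOp {i j : Fin n} (h : i ≠ j) (o : Fin n → Module.End K L)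
    (ho : ∀ a b, a ≠ b → ∀ d, d ≠ a → d ≠ b → ∀ v, S.κ a b (o d v) = o d (S.κ a b v))
    {k : Fin n} (h1 : k ≠ i) (h2 : k ≠ j) (ψ : Equiv.Perm (Fin n) → L) :
    S.swapOp i j (diagOp o k ψ) = diagOp o k (S.swapOp i j ψ) := by
  ext g
  have i1 := g.injective.ne h
  have i2 := g.injective.ne h1
  have i3 := g.injective.ne h2
  simp only [swapOp_apply, diagOp_apply, Equiv.Perm.coe_mul, Function.comp_apply,
    Equiv.swap_apply_of_ne_of_ne h1 h2, map_sub, map_smul, ho _ _ i1 _ i2 i3]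

theorem swapOp_c {i j : Fin n} (h : i ≠ j) (ψ : Equiv.Perm (Fin n) → L) :
    S.swapOp i j (diagOp S.c i ψ) = diagOp S.c j (S.swapOp i j ψ) := by
  ext g
  have i1 := g.injective.ne h
  simp only [swapOp_apply, diagOp_apply, Equiv.Perm.coe_mul, Function.comp_apply,
    Equiv.swap_apply_left, map_sub, map_smul, S.κ_c _ _ i1]

theorem x_swapOp {i j : Fin n} (h : i ≠ j) (ψ : Equiv.Perm (Fin n) → L) :
    diagOp S.x i (S.swapOp i j ψ) = S.swapOp i j (diagOp S.x j ψ) -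
      algebraMap F K ξ • diagOp S.x j ψ +
        algebraMap F K ξ • diagOp S.c i (diagOp S.c j (diagOp S.x j ψ)) := by
  ext g
  have i1 := g.injective.ne h
  simp only [swapOp_apply, diagOp_apply, Equiv.Perm.coe_mul, Function.comp_apply,
    Equiv.swap_apply_right, map_sub, map_smul, S.κ_x _ _ i1, Pi.add_apply, Pi.sub_apply,
    Pi.smul_apply]
  module

theorem swapOp_far {i j k l : Fin n} (h1 : i ≠ j) (h2 : i ≠ k) (h3 : i ≠ l) (h4 : j ≠ k)
    (h5 : j ≠ l) (h6 : k ≠ l) (ψ : Equiv.Perm (Fin n) → L) :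
    S.swapOp i j (S.swapOp k l ψ) = S.swapOp k l (S.swapOp i j ψ) := by
  ext g
  have hc : Equiv.swap i j * Equiv.swap k l = Equiv.swap k l * Equiv.swap i j := by
    apply (Equiv.Perm.disjoint_iff_disjoint_support.2 _).commute
    rw [Equiv.Perm.support_swap h1, Equiv.Perm.support_swap h6]
    simp [h2.symm, h3.symm, h4.symm, h5.symm]
  have inj {a b} (h : a ≠ b) : g a ≠ g b := g.injective.ne h
  simp only [swapOp_apply, Equiv.Perm.coe_mul, Function.comp_apply, mul_assoc, hc, map_sub,
    map_smul, Equiv.swap_apply_of_ne_of_ne h2 h3, Equiv.swap_apply_of_ne_of_ne h4 h5,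
    Equiv.swap_apply_of_ne_of_ne h2.symm h4.symm, Equiv.swap_apply_of_ne_of_ne h3.symm h5.symm,
    S.κ_far (g i) (g j) (g k) (g l) (inj h1) (inj h2) (inj h3) (inj h4) (inj h5) (inj h6)]
  module

theorem swapOp_braid {i j k : Fin n} (h1 : i ≠ j) (h2 : i ≠ k) (h3 : j ≠ k)
    (ψ : Equiv.Perm (Fin n) → L) :
    S.swapOp i j (S.swapOp j k (S.swapOp i j ψ)) =
      S.swapOp j k (S.swapOp i j (S.swapOp j k ψ)) := by
  ext g
  have hb : Equiv.swap i j * (Equiv.swap j k * Equiv.swap i j) =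
      Equiv.swap j k * (Equiv.swap i j * Equiv.swap j k) := by
    have e2 := Equiv.swap_mul_swap_mul_swap (x := k) (y := j) (z := i) h3.symm h2.symm
    have e3 := Equiv.swap_mul_swap_mul_swap (x := i) (y := j) (z := k) h1 h2
    rw [Equiv.swap_comm j i, Equiv.swap_comm k j] at e2
    rw [← mul_assoc, e2, ← mul_assoc, e3, Equiv.swap_comm]
  have i1 := g.injective.ne h1
  have i2 := g.injective.ne h2
  have i3 := g.injective.ne h3
  simp only [swapOp_apply, Equiv.Perm.coe_mul, Function.comp_apply, mul_assoc, hb, map_sub,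
    map_smul, Equiv.swap_apply_of_ne_of_ne h1 h2, Equiv.swap_apply_of_ne_of_ne h2.symm h3.symm,
    Equiv.swap_apply_left, Equiv.swap_apply_right, Equiv.swap_mul_self, mul_one]
  generalize g i = a at *
  generalize g j = b at *
  generalize g k = c at *
  have e1 := S.κ_braid i1 i2 i3 (ψ g)
  have e2 := S.κ_mul b a c i1.symm i3 i2 (ψ (g * Equiv.swap i j))
  have e3 := S.κ_mul' i2 i1 i3.symm (ψ (g * Equiv.swap j k))
  linear_combination (norm := module) -e1 + S.φ b a • e2 + S.φ c b • e3

/-- The operators on functions on permutations attached to a local system satisfy the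
relations of the affine Hecke–Clifford superalgebra. -/
noncomputable def toSys [Module F L] [IsScalarTower F K L] :
    Sys ξ (Module.End K (Equiv.Perm (Fin n) → L)) n where
  x i := if h : i < n then diagOp S.x ⟨i, h⟩ else 0
  y i := if h : i < n then diagOp S.y ⟨i, h⟩ else 0
  c i := if h : i < n then diagOp S.c ⟨i, h⟩ else 0
  t i := if h : i + 1 < n then S.swapOp ⟨i, by omega⟩ ⟨i + 1, h⟩ else 0
  xy i hi := by
    refine LinearMap.ext fun ψ => funext fun g => ?_
    simp [hi, S.xy]
  yx i hi := by
    refine LinearMap.ext fun ψ => funext fun g => ?_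
    simp [hi, S.yx]
  xx i hi j hj := by
    refine LinearMap.ext fun ψ => funext fun g => ?_
    simp [hi, hj]; exact S.xx _ _ _
  cc i hi := by
    refine LinearMap.ext fun ψ => funext fun g => ?_
    simp [hi, S.cc]
  canti i hi j hj h := by
    refine LinearMap.ext fun ψ => funext fun g => ?_
    have := g.injective.ne (a₁ := ⟨i, hi⟩) (a₂ := ⟨j, hj⟩) (by simpa using h)
    simp [hi, hj, S.canti _ _ this]
  cx i hi := by
    refine LinearMap.ext fun ψ => funext fun g => ?_
    simp [hi, S.cx]
  cxo i hi j hj h := by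
    refine LinearMap.ext fun ψ => funext fun g => ?_
    have := g.injective.ne (a₁ := ⟨i, hi⟩) (a₂ := ⟨j, hj⟩) (by simpa using h)
    simp [hi, hj, S.cxo _ _ this]
  tt i hi := by
    refine LinearMap.ext fun ψ => ?_
    simp only [hi, dite_true, Module.End.mul_apply, LinearMap.add_apply, LinearMap.smul_apply,
      Module.End.one_apply, ← algebraMap_smul K ξ]
    exact S.swapOp_sq (by simp) ψ
  braid i hi := by
    have h1 : i + 1 < n := by omega
    have h2 : i + 1 + 1 < n := by omega
    refine LinearMap.ext fun ψ => ?_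
    simp only [h1, h2, dite_true, Module.End.mul_apply]
    exact S.swapOp_braid (by simp) (by simp [Fin.ext_iff]; omega) (by simp) ψ
  far i j h hj := by
    have h1 : i + 1 < n := by omega
    refine LinearMap.ext fun ψ => ?_
    simp only [h1, hj, dite_true, Module.End.mul_apply]
    apply S.swapOp_far <;> simp <;> omega
  tc i hi := by
    have h1 : i < n := by omega
    refine LinearMap.ext fun ψ => ?_
    simp only [h1, hi, dite_true, Module.End.mul_apply]
    exact S.swapOp_c (by simp) ψ
  tco i hi j hj h1 h2 := by
    refine LinearMap.ext fun ψ => ?_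
    simp only [hj, hi, dite_true, Module.End.mul_apply]
    exact S.swapOp_comm_diagOp (by simp) _ S.κ_co (by simpa using h1) (by simpa using h2) ψ
  txo i hi j hj h1 h2 := by
    refine LinearMap.ext fun ψ => ?_
    simp only [hj, hi, dite_true, Module.End.mul_apply]
    exact S.swapOp_comm_diagOp (by simp) _ S.κ_xo (by simpa using h1) (by simpa using h2) ψ
  cross i hi := by
    have h1 : i < n := by omega
    simp only [h1, hi, dite_true]
    set a : Fin n := ⟨i, h1⟩
    set b : Fin n := ⟨i + 1, hi⟩
    have hab : a ≠ b := by simp [a, b]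
    have e1 : S.swapOp a b * S.swapOp a b = ξ • S.swapOp a b + 1 := by
      refine LinearMap.ext fun ψ => ?_
      simp only [Module.End.mul_apply, LinearMap.add_apply, LinearMap.smul_apply,
        Module.End.one_apply, ← algebraMap_smul K ξ]
      exact S.swapOp_sq hab ψ
    have e2 : S.swapOp a b * diagOp S.c a = diagOp S.c b * S.swapOp a b :=
      LinearMap.ext fun ψ => S.swapOp_c hab ψ
    have e3 (k : Fin n) : diagOp S.c k * diagOp S.c k = 1 := by
      refine LinearMap.ext fun ψ => funext fun g => ?_
      simp [S.cc]
    have e4 : diagOp S.c a * diagOp S.c b = -(diagOp S.c b * diagOp S.c a) := by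
      refine LinearMap.ext fun ψ => funext fun g => ?_
      simp [S.canti _ _ (g.injective.ne hab)]
    have e5 : diagOp S.x a * S.swapOp a b = (S.swapOp a b +
        ξ • (diagOp S.c a * diagOp S.c b) - ξ • 1) * diagOp S.x b := by
      refine LinearMap.ext fun ψ => ?_
      simp only [Module.End.mul_apply, LinearMap.add_apply, LinearMap.smul_apply,
        LinearMap.sub_apply, Module.End.one_apply, S.x_swapOp hab, ← algebraMap_smul K ξ]
      abel
    have e6 := clifford_twist_sq e1 e2 (e3 a) (e3 b) e4
    rw [mul_assoc, e5, ← mul_assoc, mul_sub, e6, mul_smul_comm, mul_one, add_sub_cancel_left,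
      one_mul]

end LocalSys

/-- Nonzero elements of a field extension in general position. -/
structure Generic (F K : Type) [Field F] [Field K] [Algebra F K] (n : ℕ) where
  u : Fin n → K
  ne_zero : ∀ a, u a ≠ 0
  ne : ∀ a b, a ≠ b → u a ≠ u b
  mul_ne_one : ∀ a b, a ≠ b → u a * u b ≠ 1

namespace Generic

variable {F K : Type} [Field F] [Field K] [Algebra F K] {n : ℕ}

/-- Changing the entry at `l`. -/
def flip (l : Fin n) (ε : Fin n → Bool) : Fin n → Bool := Function.update ε l (!ε l)

@[simp] theorem flip_self (l : Fin n) (ε : Fin n → Bool) : flip l ε l = !ε l := by simp [flip]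

theorem flip_of_ne {l m : Fin n} (h : m ≠ l) (ε : Fin n → Bool) : flip l ε m = ε m := by
  simp [flip, h]

@[simp] theorem flip_flip (l : Fin n) (ε : Fin n → Bool) : flip l (flip l ε) = ε := by
  simp [flip]

theorem flip_comm {l m : Fin n} (h : l ≠ m) (ε : Fin n → Bool) :
    flip l (flip m ε) = flip m (flip l ε) := by
  simp only [flip, Function.update_of_ne h, Function.update_of_ne h.symm]
  exact Function.update_comm h.symm _ _ _

variable (K) in
/-- The Jordan–Wigner sign. -/
def sgn (l : Fin n) (ε : Fin n → Bool) : K := ∏ m ∈ Finset.univ.filter (· < l),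
  if ε m then -1 else 1

theorem sgn_mul_self (l : Fin n) (ε : Fin n → Bool) : sgn K l ε * sgn K l ε = 1 := by
  rw [sgn, ← Finset.prod_mul_distrib]
  exact Finset.prod_eq_one fun m _ => by split_ifs <;> simp

theorem sgn_flip_of_le {l m : Fin n} (h : l ≤ m) (ε : Fin n → Bool) :
    sgn K l (flip m ε) = sgn K l ε :=
  Finset.prod_congr rfl fun k hk => by
    rw [flip_of_ne ((Finset.mem_filter.1 hk).2.trans_le h).ne]

theorem sgn_flip_of_lt {l m : Fin n} (h : m < l) (ε : Fin n → Bool) :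
    sgn K l (flip m ε) = -sgn K l ε := by
  have hm : m ∈ Finset.univ.filter (· < l) := by simpa using h
  rw [sgn, sgn, ← Finset.mul_prod_erase _ _ hm, ← Finset.mul_prod_erase _ _ hm, flip_self,
    Finset.prod_congr rfl fun k hk => by rw [flip_of_ne (Finset.ne_of_mem_erase hk)]]
  cases ε m <;> simp

/-- The Clifford generators. -/
def cl (l : Fin n) : Module.End K ((Fin n → Bool) → K) where
  toFun ψ ε := sgn K l ε * ψ (flip l ε)
  map_add' _ _ := by ext; simp [mul_add]
  map_smul' _ _ := by ext; simp [mul_left_comm]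

theorem cl_apply (l : Fin n) (ψ : (Fin n → Bool) → K) (ε : Fin n → Bool) :
    cl l ψ ε = sgn K l ε * ψ (flip l ε) := rfl

theorem cl_cl (l : Fin n) (ψ : (Fin n → Bool) → K) : cl l (cl l ψ) = ψ := by
  ext ε
  rw [cl_apply, cl_apply, flip_flip, sgn_flip_of_le le_rfl, ← mul_assoc, sgn_mul_self, one_mul]

theorem cl_anti {l m : Fin n} (h : l ≠ m) (ψ : (Fin n → Bool) → K) :
    cl l (cl m ψ) = -cl m (cl l ψ) := by
  ext ε
  rw [Pi.neg_apply, cl_apply, cl_apply, cl_apply, cl_apply, flip_comm h]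
  rcases lt_or_gt_of_ne h with h | h
  · rw [sgn_flip_of_lt h, sgn_flip_of_le h.le]; ring
  · rw [sgn_flip_of_lt h, sgn_flip_of_le h.le]; ring

variable (G : Generic F K n)

/-- The eigenvalue functions of the polynomial generators. -/
def xf (a : Fin n) (ε : Fin n → Bool) : K := if ε a then (G.u a)⁻¹ else G.u a

theorem xf_ne_zero (a : Fin n) (ε : Fin n → Bool) : G.xf a ε ≠ 0 := by
  unfold xf; split_ifs <;> simp [G.ne_zero]

theorem xf_sub_ne_zero {a b : Fin n} (h : a ≠ b) (ε : Fin n → Bool) :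
    G.xf b ε - G.xf a ε ≠ 0 := by
  have ha := G.ne_zero a
  have hb := G.ne_zero b
  have h1 := G.ne a b h
  have h2 := G.mul_ne_one a b h
  unfold xf
  intro e
  split_ifs at e <;> try field_simp at e
  · exact h1 (by linear_combination e)
  · exact h2 (by linear_combination -e)
  · exact h2 (by linear_combination e)
  · exact h1 (by linear_combination -e)

theorem xf_mul_sub_ne_zero {a b : Fin n} (h : a ≠ b) (ε : Fin n → Bool) :
    G.xf a ε * G.xf b ε - 1 ≠ 0 := by
  have ha := G.ne_zero a
  have hb := G.ne_zero b
  have h1 := G.ne a b h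
  have h2 := G.mul_ne_one a b h
  unfold xf
  intro e
  split_ifs at e <;> field_simp at e
  · exact h2 (by linear_combination -e)
  · exact h1 (by linear_combination -e)
  · exact h1 (by linear_combination e)
  · exact h2 (by linear_combination e)

theorem xf_flip (a : Fin n) (ε : Fin n → Bool) : G.xf a (flip a ε) = (G.xf a ε)⁻¹ := by
  rw [xf, xf, flip_self]; cases ε a <;> simp

theorem xf_flip_of_ne {a l : Fin n} (h : a ≠ l) (ε : Fin n → Bool) :
    G.xf a (flip l ε) = G.xf a ε := by
  rw [xf, xf, flip_of_ne h]

/-- The function `x_b / (x_b - x_a)`. -/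
def pf (a b : Fin n) (ε : Fin n → Bool) : K := G.xf b ε / (G.xf b ε - G.xf a ε)

/-- The function `1 / (x_a x_b - 1)`. -/
def qf (a b : Fin n) (ε : Fin n → Bool) : K := 1 / (G.xf a ε * G.xf b ε - 1)

theorem qf_symm (a b : Fin n) : G.qf b a = G.qf a b := by
  ext; simp [qf, mul_comm]

theorem pf_symm {a b : Fin n} (h : a ≠ b) (ε) : G.pf b a ε = 1 - G.pf a b ε := by
  have h1 := G.xf_sub_ne_zero h ε
  have h2 := G.xf_sub_ne_zero h.symm ε
  unfold pf
  field_simp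
  ring

theorem cl_mul_apply (l : Fin n) (φ ψ : (Fin n → Bool) → K) :
    cl l (φ * ψ) = (fun ε => φ (flip l ε)) * cl l ψ := by
  ext ε
  simp only [cl_apply, Pi.mul_apply]; ring

theorem inv_facts {a b : Fin n} (h : a ≠ b) (ε : Fin n → Bool) :
    G.pf a b (flip a ε) = 1 + G.qf a b ε ∧ G.qf a b (flip a ε) = G.pf a b ε - 1 ∧
    G.pf a b (flip b ε) = - G.qf a b ε ∧ G.qf a b (flip b ε) = - G.pf a b ε := by
  have h1 := G.xf_sub_ne_zero h ε
  have h2 := G.xf_sub_ne_zero h.symm ε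
  have h3 := G.xf_mul_sub_ne_zero h ε
  have h4 := G.xf_ne_zero a ε
  have h5 := G.xf_ne_zero b ε
  have h6 := G.xf_sub_ne_zero h (flip a ε)
  have h7 := G.xf_mul_sub_ne_zero h (flip a ε)
  have h8 := G.xf_sub_ne_zero h (flip b ε)
  have h9 := G.xf_mul_sub_ne_zero h (flip b ε)
  simp only [pf, qf]
  rw [xf_flip, xf_flip_of_ne _ h.symm] at *
  rw [xf_flip, xf_flip_of_ne _ h] at *
  generalize G.xf a ε = x at *
  generalize G.xf b ε = y at *
  have h3' : y * x - 1 ≠ 0 := by rwa [mul_comm]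
  refine ⟨?_, ?_, ?_, ?_⟩
  · rw [div_eq_iff h6]; field_simp; ring
  · rw [div_eq_iff h7]; field_simp; ring
  · rw [div_eq_iff h8]; field_simp; ring
  · rw [div_eq_iff h9]; field_simp; ring

theorem cl_pf_left {a b : Fin n} (h : a ≠ b) (v : (Fin n → Bool) → K) :
    cl a (G.pf a b * v) = (1 + G.qf a b) * cl a v := by
  rw [cl_mul_apply]; ext ε; simp [(G.inv_facts h ε).1]

theorem cl_qf_left {a b : Fin n} (h : a ≠ b) (v : (Fin n → Bool) → K) :
    cl a (G.qf a b * v) = (G.pf a b - 1) * cl a v := by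
  rw [cl_mul_apply]; ext ε; simp [(G.inv_facts h ε).2.1]

theorem cl_pf_right {a b : Fin n} (h : a ≠ b) (v : (Fin n → Bool) → K) :
    cl b (G.pf a b * v) = - G.qf a b * cl b v := by
  rw [cl_mul_apply]; ext ε; simp [(G.inv_facts h ε).2.2.1]

theorem cl_qf_right {a b : Fin n} (h : a ≠ b) (v : (Fin n → Bool) → K) :
    cl b (G.qf a b * v) = - G.pf a b * cl b v := by
  rw [cl_mul_apply]; ext ε; simp [(G.inv_facts h ε).2.2.2]

theorem cl_pf_ne {a b d : Fin n} (h1 : d ≠ a) (h2 : d ≠ b) (v : (Fin n → Bool) → K) :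
    cl d (G.pf a b * v) = G.pf a b * cl d v := by
  rw [cl_mul_apply]; ext ε; simp [pf, xf_flip_of_ne _ h1.symm, xf_flip_of_ne _ h2.symm]

theorem cl_qf_ne {a b d : Fin n} (h1 : d ≠ a) (h2 : d ≠ b) (v : (Fin n → Bool) → K) :
    cl d (G.qf a b * v) = G.qf a b * cl d v := by
  rw [cl_mul_apply]; ext ε; simp [qf, xf_flip_of_ne _ h1.symm, xf_flip_of_ne _ h2.symm]

theorem cl_xf (a : Fin n) (v : (Fin n → Bool) → K) :
    cl a (G.xf a * v) = (G.xf a)⁻¹ * cl a v := by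
  rw [cl_mul_apply]; ext ε; simp [xf_flip]

theorem cl_xf_ne {a d : Fin n} (h1 : d ≠ a) (v : (Fin n → Bool) → K) :
    cl d (G.xf a * v) = G.xf a * cl d v := by
  rw [cl_mul_apply]; ext ε; simp [xf_flip_of_ne _ h1.symm]

/-- The diagonal entries of the intertwined generators. -/
def kap (ξ : F) (a b : Fin n) : Module.End K ((Fin n → Bool) → K) :=
  -(algebraMap F K ξ) • (LinearMap.mulLeft K (G.pf a b) +
    LinearMap.mulLeft K (G.qf a b) * cl a * cl b)

theorem kap_apply (ξ : F) (a b : Fin n) (v : (Fin n → Bool) → K) : G.kap ξ a b v =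
    -(algebraMap F K ξ) • (G.pf a b * v + G.qf a b * cl a (cl b v)) := rfl

/-- The scalar `1 - ξ κ - κ²`. -/
def lam (ξ : F) (a b : Fin n) : K := 1 - algebraMap F K ξ ^ 2 *
  (G.pf a b (fun _ => false) * (G.pf a b (fun _ => false) - 1) +
    G.qf a b (fun _ => false) * (G.qf a b (fun _ => false) + 1))

theorem lam_symm (ξ : F) {a b : Fin n} (h : a ≠ b) : G.lam ξ b a = G.lam ξ a b := by
  rw [lam, lam, pf_symm G h, qf_symm]; ring

theorem lam_eq (ξ : F) {a b : Fin n} (h : a ≠ b) (ε : Fin n → Bool) : G.lam ξ a b =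
    1 - algebraMap F K ξ ^ 2 * (G.pf a b ε * (G.pf a b ε - 1) + G.qf a b ε * (G.qf a b ε + 1)) := by
  have key : ∀ a' b' : Bool, ∀ ε : Fin n → Bool, ε a = a' → ε b = b' →
      G.pf a b ε * (G.pf a b ε - 1) + G.qf a b ε * (G.qf a b ε + 1) =
      G.pf a b (fun _ => false) * (G.pf a b (fun _ => false) - 1) +
        G.qf a b (fun _ => false) * (G.qf a b (fun _ => false) + 1) := by
    have h0 : ∀ ε : Fin n → Bool, ε a = false → ε b = false →
        G.pf a b ε = G.pf a b (fun _ => false) ∧ G.qf a b ε = G.qf a b (fun _ => false) := by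
      intro ε ha hb
      simp [pf, qf, xf, ha, hb]
    have h1 : ∀ ε : Fin n → Bool, ε b = false →
        G.pf a b ε * (G.pf a b ε - 1) + G.qf a b ε * (G.qf a b ε + 1) =
        G.pf a b (fun _ => false) * (G.pf a b (fun _ => false) - 1) +
        G.qf a b (fun _ => false) * (G.qf a b (fun _ => false) + 1) := by
      intro ε hb
      cases ha : ε a
      · rw [(h0 ε ha hb).1, (h0 ε ha hb).2]
      · obtain ⟨e1, e2⟩ := h0 (flip a ε) (by simp [ha]) (by rw [flip_of_ne h.symm, hb])
        rw [← e1, ← e2, (G.inv_facts h ε).1, (G.inv_facts h ε).2.1]; ring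
    intro a' b' ε ha hb
    cases hb : ε b
    · exact h1 ε hb
    · rw [← h1 (flip b ε) (by simp [hb]), (G.inv_facts h ε).2.2.1, (G.inv_facts h ε).2.2.2]; ring
  rw [key (ε a) (ε b) ε rfl rfl, lam]

theorem kap_mul (ξ : F) {a b d : Fin n} (h1 : a ≠ b) (h2 : a ≠ d) (h3 : b ≠ d)
    (v : (Fin n → Bool) → K) : G.kap ξ b a (G.kap ξ a d v) + G.kap ξ b d (G.kap ξ a b v) =
      G.kap ξ a d (G.kap ξ b d v) := by
  simp only [kap_apply, map_add, map_smul, G.cl_pf_left h2,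
    G.cl_qf_left h2, G.cl_pf_right h1,
    G.cl_pf_right h3, G.cl_qf_right h1, G.cl_qf_right h3,
    G.cl_pf_ne h1 h2, G.cl_pf_ne h1.symm h3, G.cl_pf_ne h2.symm h3.symm,
    G.cl_qf_ne h1 h2, G.cl_qf_ne h1.symm h3, G.cl_qf_ne h2.symm h3.symm, mul_add, neg_mul,
    one_mul, add_mul, sub_mul, map_neg, map_sub]
  simp only [cl_anti h1.symm, cl_anti h2.symm, cl_anti h3.symm, cl_cl, map_neg]
  ext ε
  have e1 := G.xf_sub_ne_zero h1 ε
  have e2 := G.xf_sub_ne_zero h2 ε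
  have e3 := G.xf_sub_ne_zero h3 ε
  have e1' := G.xf_sub_ne_zero h1.symm ε
  have e2' := G.xf_sub_ne_zero h2.symm ε
  have e3' := G.xf_sub_ne_zero h3.symm ε
  have f1 := G.xf_mul_sub_ne_zero h1 ε
  have f2 := G.xf_mul_sub_ne_zero h2 ε
  have f3 := G.xf_mul_sub_ne_zero h3 ε
  simp only [Pi.add_apply, Pi.smul_apply, Pi.mul_apply, Pi.neg_apply, Pi.sub_apply, smul_eq_mul,
    G.qf_symm a b, G.pf_symm h1]
  simp only [pf, qf]
  generalize G.xf a ε = x at *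
  generalize G.xf b ε = y at *
  generalize G.xf d ε = z at *
  generalize cl a (cl b v) ε = vab
  generalize cl a (cl d v) ε = vad
  generalize cl b (cl d v) ε = vbd
  generalize v ε = w
  generalize algebraMap F K ξ = r
  have f1' : y * x - 1 ≠ 0 := by rwa [mul_comm]
  have f2' : z * x - 1 ≠ 0 := by rwa [mul_comm]
  have f3' : z * y - 1 ≠ 0 := by rwa [mul_comm]
  have i1 : (1 - y / (y - x)) * (z / (z - x)) + z / (z - y) * (y / (y - x)) =
      z / (z - x) * (z / (z - y)) := by field_simp; ring
  have i2 : -(1 / (x * y - 1)) - 1 / (x * y - 1) * (1 / (x * z - 1)) +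
      z / (z - y) * (1 / (x * y - 1)) = 1 / (x * z - 1) * (z / (z - y)) := by field_simp; ring
  have i3 : (1 - y / (y - x)) * (1 / (x * z - 1)) + 1 / (y * z - 1) * (y / (y - x)) =
      -(1 / (x * z - 1) * (1 / (y * z - 1))) := by field_simp; ring
  have i4 : 1 / (x * y - 1) * (z / (z - x) - 1) - 1 / (y * z - 1) * (1 / (x * y - 1)) =
      z / (z - x) * (1 / (y * z - 1)) := by field_simp; ring
  linear_combination r ^ 2 * (w * i1 + vab * i2 + vad * i3 + vbd * i4)

theorem kap_swap (ξ : F) {a b : Fin n} (h : a ≠ b) (v : (Fin n → Bool) → K) :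
    G.kap ξ a b v + G.kap ξ b a v = -algebraMap F K ξ • v := by
  rw [kap_apply, kap_apply, cl_anti h]
  ext ε
  simp only [Pi.add_apply, Pi.smul_apply, Pi.mul_apply, Pi.neg_apply, smul_eq_mul,
    G.qf_symm a b, G.pf_symm h]
  ring

theorem kap_c (ξ : F) {a b : Fin n} (h : a ≠ b) (v : (Fin n → Bool) → K) :
    G.kap ξ a b (cl a v) = cl b (G.kap ξ a b v) := by
  rw [kap_apply, kap_apply, map_smul, map_add, G.cl_pf_right h, G.cl_qf_right h,
    cl_anti h.symm v, cl_anti h.symm (cl b v), cl_cl, map_neg, cl_cl]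
  congr 1
  ring

theorem kap_co (ξ : F) {a b d : Fin n} (h1 : d ≠ a) (h2 : d ≠ b)
    (v : (Fin n → Bool) → K) : G.kap ξ a b (cl d v) = cl d (G.kap ξ a b v) := by
  rw [kap_apply, kap_apply, map_smul, map_add, G.cl_pf_ne h1 h2, G.cl_qf_ne h1 h2,
    cl_anti h2.symm, map_neg, cl_anti h1.symm, neg_neg]

theorem kap_xo (ξ : F) {a b d : Fin n} (h1 : d ≠ a) (h2 : d ≠ b)
    (v : (Fin n → Bool) → K) : G.kap ξ a b (G.xf d * v) = G.xf d * G.kap ξ a b v := by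
  rw [kap_apply, kap_apply, G.cl_xf_ne h2.symm, G.cl_xf_ne h1.symm, mul_smul_comm]
  congr 1
  ring

theorem kap_x (ξ : F) {a b : Fin n} (h : a ≠ b) (v : (Fin n → Bool) → K) :
    G.xf a * G.kap ξ a b v = G.kap ξ a b (G.xf b * v) + algebraMap F K ξ • (G.xf b * v) -
      algebraMap F K ξ • cl a (cl b (G.xf b * v)) := by
  have hi : cl a ((G.xf b)⁻¹ * cl b v) = (G.xf b)⁻¹ * cl a (cl b v) := by
    rw [cl_mul_apply]; ext ε; simp [xf_flip_of_ne _ h.symm]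
  rw [kap_apply, kap_apply, cl_xf, hi]
  ext ε
  simp only [Pi.add_apply, Pi.sub_apply, Pi.smul_apply, Pi.mul_apply, Pi.inv_apply,
    smul_eq_mul, pf, qf]
  have h1 := G.xf_sub_ne_zero h ε
  have h3 := G.xf_mul_sub_ne_zero h ε
  have h5 := G.xf_ne_zero b ε
  generalize G.xf a ε = x at *
  generalize G.xf b ε = y at *
  generalize cl a (cl b v) ε = vab
  have h3' : y * x - 1 ≠ 0 := by rwa [mul_comm]
  field_simp
  ring

theorem kap_far (ξ : F) {a b d e : Fin n} (h1 : a ≠ d) (h2 : a ≠ e) (h3 : b ≠ d) (h4 : b ≠ e)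
    (v : (Fin n → Bool) → K) : G.kap ξ a b (G.kap ξ d e v) = G.kap ξ d e (G.kap ξ a b v) := by
  simp only [kap_apply, map_add, map_smul, G.cl_pf_ne h1 h2, G.cl_pf_ne h3 h4, G.cl_qf_ne h1 h2,
    G.cl_qf_ne h3 h4, G.cl_pf_ne h1.symm h3.symm, G.cl_pf_ne h2.symm h4.symm,
    G.cl_qf_ne h1.symm h3.symm, G.cl_qf_ne h2.symm h4.symm]
  simp only [cl_anti h1.symm, cl_anti h2.symm, cl_anti h3.symm, cl_anti h4.symm, map_neg, neg_neg]
  ext ε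
  simp only [Pi.add_apply, Pi.smul_apply, Pi.mul_apply, smul_eq_mul]
  ring

theorem kap_sq (ξ : F) {a b : Fin n} (h : a ≠ b) (v : (Fin n → Bool) → K) :
    G.lam ξ a b • v = v - algebraMap F K ξ • G.kap ξ a b v - G.kap ξ a b (G.kap ξ a b v) := by
  simp only [kap_apply, map_add, map_smul, G.cl_pf_right h, G.cl_qf_right h, neg_mul, map_neg,
    G.cl_pf_left h, G.cl_qf_left h, cl_anti h.symm, cl_cl]
  ext ε
  simp only [Pi.add_apply, Pi.sub_apply, Pi.one_apply, Pi.smul_apply, Pi.mul_apply, Pi.neg_apply,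
    smul_eq_mul, G.lam_eq ξ h ε]
  ring

/-- The local system attached to elements in general position. -/
def localSys (ξ : F) : LocalSys F K ((Fin n → Bool) → K) ξ n where
  x a := LinearMap.mulLeft K (G.xf a)
  y a := LinearMap.mulLeft K (G.xf a)⁻¹
  c a := cl a
  κ := G.kap ξ
  φ a b := if a < b then 1 else G.lam ξ a b
  xy a v := by ext ε; simp [G.xf_ne_zero]
  yx a v := by ext ε; simp [G.xf_ne_zero]
  xx a b v := by simp [mul_left_comm]
  cc := cl_cl
  canti a b h := cl_anti h
  cx a v := G.cl_xf a v
  cxo a b h v := G.cl_xf_ne h v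
  κ_swap a b h v := G.kap_swap ξ h v
  κ_c a b h v := G.kap_c ξ h v
  κ_co a b _ d h1 h2 v := G.kap_co ξ h1 h2 v
  κ_xo a b _ d h1 h2 v := G.kap_xo ξ h1 h2 v
  κ_x a b h v := G.kap_x ξ h v
  κ_far a b d e _ h1 h2 h3 h4 _ v := G.kap_far ξ h1 h2 h3 h4 v
  κ_mul a b d h1 h2 h3 v := G.kap_mul ξ h1 h2 h3 v
  κ_sq a b h v := by
    rw [← G.kap_sq ξ h v]
    rcases lt_or_gt_of_ne h with h' | h'
    · rw [if_pos h', if_neg (not_lt.2 h'.le), one_mul, G.lam_symm ξ h]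
    · rw [if_pos h', if_neg (not_lt.2 h'.le), mul_one]

end Generic

section generic

variable (F : Type) [Field F] (n : ℕ)

/-- The field of fractions of the Laurent polynomials in `n` variables. -/
abbrev RatFun : Type := FractionRing (AddMonoidAlgebra F (Fin n → ℤ))

/-- The Laurent monomials. -/
noncomputable def laurent : Multiplicative (Fin n → ℤ) →* RatFun F n :=
  (algebraMap (AddMonoidAlgebra F (Fin n → ℤ)) (RatFun F n)).toMonoidHom.comp
    (AddMonoidAlgebra.of F (Fin n → ℤ))

theorem laurent_independent :
    LinearIndependent F fun α : Fin n → ℤ => laurent F n (Multiplicative.ofAdd α) := by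
  have h := (AddMonoidAlgebra.basis (Fin n → ℤ) F).linearIndependent.map'
    (IsScalarTower.toAlgHom F (AddMonoidAlgebra F (Fin n → ℤ)) (RatFun F n)).toLinearMap
    (LinearMap.ker_eq_bot.2 (IsFractionRing.injective _ _))
  exact h

theorem laurent_injective : Function.Injective (laurent F n) := fun a b h =>
  (laurent_independent F n).injective (a₁ := a.toAdd) (a₂ := b.toAdd) h

/-- The variables are in general position. -/
noncomputable def generic : Generic F (RatFun F n) n where
  u a := laurent F n (Multiplicative.ofAdd (Pi.single a 1))
  ne_zero a := ((Group.isUnit (Multiplicative.ofAdd (Pi.single a (1 : ℤ)))).map (laurent F n)).ne_zero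
  ne a b h e := h (by
    have := congrFun (Multiplicative.ofAdd.injective (laurent_injective F n e)) a
    by_contra h'
    simp [h'] at this)
  mul_ne_one a b h e := by
    rw [← map_mul, ← ofAdd_add, ← map_one (laurent F n), ← ofAdd_zero] at e
    have := congrFun (Multiplicative.ofAdd.injective (laurent_injective F n e)) a
    simp [h] at this

theorem prod_generic (α : Fin n → ℤ) :
    ∏ i, (generic F n).u i ^ α i = laurent F n (Multiplicative.ofAdd α) := by
  have : Multiplicative.ofAdd α = ∏ i, Multiplicative.ofAdd (Pi.single i (1 : ℤ)) ^ α i := by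
    rw [← Finset.univ_sum_single α, ofAdd_sum]
    refine Finset.prod_congr rfl fun i _ => ?_
    rw [← ofAdd_zsmul, ← Pi.single_smul]
    simp
  rw [this, map_prod]
  exact Finset.prod_congr rfl fun i _ => (map_zpow _ _ _).symm

end generic

namespace Generic

variable {F K : Type} [Field F] [Field K] [Algebra F K] {n : ℕ}

theorem cl_single (l : Fin n) (ε : Fin n → Bool) :
    cl l (Pi.single ε (1 : K)) = sgn K l ε • Pi.single (flip l ε) 1 := by
  ext η
  rw [cl_apply, Pi.smul_apply, smul_eq_mul, Pi.single_apply, Pi.single_apply]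
  by_cases h : η = flip l ε
  · subst h
    rw [flip_flip, if_pos rfl, if_pos rfl, sgn_flip_of_le le_rfl]
  · rw [if_neg h, if_neg, mul_zero, mul_zero]
    rintro rfl
    exact h (by simp)

theorem perm_eq_one_of_monotone {g : Equiv.Perm (Fin n)}
    (h : ∀ i (hi : i + 1 < n), g ⟨i, by omega⟩ < g ⟨i + 1, hi⟩) : g = 1 := by
  have hm : StrictMono g := by
    cases n with
    | zero => exact fun a => a.elim0
    | succ n => exact Fin.strictMono_iff_lt_succ.2 fun i => h i (by omega)
  have : hm.orderIsoOfSurjective g g.surjective = OrderIso.refl _ := Subsingleton.elim _ _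
  ext a
  exact congrArg Fin.val (DFunLike.congr_fun this a)

variable (G : Generic F K n) (ξ : F)

theorem swapOp_single {i j : Fin n} (g : Equiv.Perm (Fin n)) (h : g i < g j)
    (w : (Fin n → Bool) → K) : (G.localSys ξ).swapOp i j (Pi.single g w) =
      Pi.single (g * Equiv.swap i j) w - Pi.single g (G.kap ξ (g i) (g j) w) := by
  ext1 k
  rw [LocalSys.swapOp_apply, Pi.sub_apply]
  have e1 : k * Equiv.swap i j = g ↔ k = g * Equiv.swap i j := by
    constructor <;> rintro rfl <;> simp [mul_assoc]
  congr 1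
  · rw [Pi.single_apply, Pi.single_apply]
    by_cases hk : k = g * Equiv.swap i j
    · subst hk
      rw [if_pos (e1.2 rfl), if_pos rfl]
      simp [localSys, h]
    · rw [if_neg hk, if_neg (mt e1.1 hk), smul_zero]
  · rw [Pi.single_apply, Pi.single_apply]
    split_ifs with hk
    · rw [hk]; rfl
    · exact map_zero _

/-- The generating vector. -/
def vac : Equiv.Perm (Fin n) → (Fin n → Bool) → K := Pi.single 1 (Pi.single (fun _ => false) 1)

theorem vac_generates (N : Submodule K (Equiv.Perm (Fin n) → (Fin n → Bool) → K))
    (h0 : vac ∈ N) (hc : ∀ i < n, ∀ v ∈ N, (G.localSys ξ).toSys.c i v ∈ N)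
    (ht : ∀ i, i + 1 < n → ∀ v ∈ N, (G.localSys ξ).toSys.t i v ∈ N) : N = ⊤ := by
  have h1 : ∀ s : Finset (Fin n), Pi.single 1 (Pi.single (fun i => decide (i ∈ s)) 1) ∈ N := by
    intro s
    induction s using Finset.induction with
    | empty => simpa [vac] using h0
    | insert l s hl ih =>
      have e : (fun i => decide (i ∈ insert l s)) = flip l fun i => decide (i ∈ s) := by
        ext i
        by_cases h : i = l
        · subst h; simp [hl]
        · simp [flip_of_ne h, h]
      have := hc l l.2 _ ih
      have e2 : (G.localSys ξ).toSys.c l (Pi.single 1 (Pi.single (fun i => decide (i ∈ s)) 1)) =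
          Pi.single 1 (cl l (Pi.single (fun i => decide (i ∈ s)) (1 : K))) := by
        ext1 k
        simp only [LocalSys.toSys, l.2, dite_true, LocalSys.diagOp_apply, Pi.single_apply]
        split_ifs with hk
        · subst hk; rfl
        · exact map_zero _
      rw [e2, cl_single, Pi.single_smul] at this
      rw [e]
      have h3 := N.smul_mem (sgn K l fun i => decide (i ∈ s)) this
      rwa [smul_smul, sgn_mul_self, one_smul] at h3
  have h2 : ∀ w, Pi.single 1 w ∈ N := by
    intro w
    rw [pi_eq_sum_univ' w, ← LinearMap.single_apply (R := K), map_sum]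
    refine N.sum_mem fun ε _ => ?_
    rw [map_smul]
    refine N.smul_mem _ ?_
    have := h1 (Finset.univ.filter fun i => ε i = true)
    rw [show (fun i => decide (i ∈ Finset.univ.filter fun i => ε i = true)) = ε by
      ext i; simp] at this
    exact this
  have h3 : ∀ g : Equiv.Perm (Fin n), ∀ w, Pi.single g w ∈ N := by
    suffices H : ∀ (f : Lex (Fin n → Fin n)) (g : Equiv.Perm (Fin n)),
        toLex (g : Fin n → Fin n) = f → ∀ w, Pi.single g w ∈ N from fun g => H _ g rfl
    intro f
    induction f using WellFoundedLT.induction with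
    | _ f ih =>
      rintro g rfl
      by_cases hg : ∀ i (hi : i + 1 < n), g ⟨i, by omega⟩ < g ⟨i + 1, hi⟩
      · rw [perm_eq_one_of_monotone hg]; exact h2
      · push Not at hg
        obtain ⟨i, hi, hle⟩ := hg
        have hne : (⟨i, by omega⟩ : Fin n) ≠ ⟨i + 1, hi⟩ := by simp
        have hlt := lt_of_le_of_ne hle fun e => hne (g.injective e.symm)
        intro w
        have hlex : toLex (g ∘ Equiv.swap (⟨i, by omega⟩ : Fin n) ⟨i + 1, hi⟩) <
            toLex (g : Fin n → Fin n) := Pi.lex_desc (by simp [Fin.le_def]) hlt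
        have ih' := ih _ hlex (g * Equiv.swap (⟨i, by omega⟩ : Fin n) ⟨i + 1, hi⟩) rfl
        have := ht i hi _ (ih' w)
        simp only [LocalSys.toSys, hi, dite_true] at this
        rw [swapOp_single G ξ _ (by simpa using hlt), mul_assoc, Equiv.swap_mul_self,
          mul_one] at this
        exact (N.sub_mem_iff_left (ih' _)).1 this
  rw [eq_top_iff]
  intro v _
  rw [← Finset.univ_sum_single v]
  exact N.sum_mem fun g _ => h3 g _

end Generic

namespace Sys

variable {F : Type} [Field F] {ξ : F} {A : Type} [Ring A] [Algebra F A] {N : ℕ} (S : Sys ξ A N)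

/-- The unit `x i`. -/
def ux (i : ℕ) : Aˣ := if h : i < N then ⟨S.x i, S.y i, S.xy i h, S.yx i h⟩ else 1

/-- The integral powers of `x i`. -/
def xp (i : ℕ) (a : ℤ) : A := ↑(S.ux i ^ a)

@[simp] theorem xp_zero (i : ℕ) : S.xp i 0 = 1 := by simp [xp]

theorem xp_add (i : ℕ) (a b : ℤ) : S.xp i (a + b) = S.xp i a * S.xp i b := by
  simp [xp, zpow_add]

theorem xp_natCast {i : ℕ} (hi : i < N) (a : ℕ) : S.xp i a = S.x i ^ a := by
  simp [xp, ux, hi]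

theorem xp_one {i : ℕ} (hi : i < N) : S.xp i 1 = S.x i := by
  simpa using S.xp_natCast hi 1

theorem xp_neg_one {i : ℕ} (hi : i < N) : S.xp i (-1) = S.y i := by
  simp [xp, ux, hi]

theorem xp_comm_of {i : ℕ} (hi : i < N) {b : A} (h : b * S.x i = S.x i * b) (a : ℤ) :
    b * S.xp i a = S.xp i a * b := by
  have : SemiconjBy b (S.ux i : A) (S.ux i) := by simpa [SemiconjBy, ux, hi] using h
  exact (this.units_zpow_right a)

theorem c_xp {i : ℕ} (hi : i < N) (a : ℤ) : S.c i * S.xp i a = S.xp i (-a) * S.c i := by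
  have : SemiconjBy (S.c i) (S.ux i : A) ((S.ux i)⁻¹ : Aˣ) := by
    simpa [SemiconjBy, ux, hi] using S.cx i hi
  have h := this.units_zpow_right a
  rw [inv_zpow, ← zpow_neg] at h
  exact h

/-- The monomials `x (k-1) ^ α (k-1) ⋯ x 0 ^ α 0`. -/
def xm (α : ℕ → ℤ) : ℕ → A
  | 0 => 1
  | k + 1 => S.xp k (α k) * xm α k

end Sys

/-- Extension by zero of a family of exponents. -/
def ext0 {n : ℕ} (α : Fin n → ℤ) (i : ℕ) : ℤ := if h : i < n then α ⟨i, h⟩ else 0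

section independence

variable {F : Type} [Field F] {q : F} {n : ℕ}

variable (F q n) in
/-- The representation of `H F q n` on functions on permutations over the field of rational
functions. -/
noncomputable def grep : H F q n →ₐ[F]
    Module.End (RatFun F n) (Equiv.Perm (Fin n) → (Fin n → Bool) → RatFun F n) :=
  ((generic F n).localSys (q - q⁻¹)).toSys.lift

theorem grep_x_vac {i : ℕ} (hi : i < n) :
    grep F q n ((hsys F q n).x i) Generic.vac = (generic F n).u ⟨i, hi⟩ • Generic.vac := by
  rw [grep, Sys.lift_x _ hi]
  ext g ε
  simp only [LocalSys.toSys, hi, dite_true, LocalSys.diagOp_apply, Generic.localSys, Generic.vac,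
    LinearMap.mulLeft_apply, Pi.mul_apply, Pi.smul_apply, smul_eq_mul, Pi.single_apply]
  by_cases hg : g = 1
  · subst hg
    simp only [if_true, Pi.single_apply, Equiv.Perm.coe_one, id]
    by_cases hε : ε = fun _ => false
    · subst hε; simp [Generic.xf]
    · simp [hε]
  · simp [hg]

theorem grep_y_vac {i : ℕ} (hi : i < n) :
    grep F q n ((hsys F q n).y i) Generic.vac = ((generic F n).u ⟨i, hi⟩)⁻¹ • Generic.vac := by
  rw [eq_inv_smul_iff₀ ((generic F n).ne_zero _), ← map_smul, ← grep_x_vac hi,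
    ← Module.End.mul_apply, ← map_mul, (hsys F q n).yx i hi, map_one, Module.End.one_apply]

theorem grep_xp_vac {i : ℕ} (hi : i < n) (a : ℤ) :
    grep F q n ((hsys F q n).xp i a) Generic.vac =
      ((generic F n).u ⟨i, hi⟩) ^ a • Generic.vac := by
  have hne := (generic F n).ne_zero ⟨i, hi⟩
  induction a using Int.induction_on with
  | zero => simp
  | succ k ih => rw [Sys.xp_add, map_mul, Module.End.mul_apply, Sys.xp_one _ hi, grep_x_vac hi,
      map_smul, ih, smul_smul, zpow_add_one₀ hne, mul_comm]
  | pred k ih => rw [sub_eq_add_neg (-(k : ℤ)), Sys.xp_add, map_mul, Module.End.mul_apply,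
      Sys.xp_neg_one _ hi, grep_y_vac hi, map_smul, ih, smul_smul, ← sub_eq_add_neg (-(k : ℤ)),
      zpow_sub_one₀ hne, mul_comm]

theorem grep_xm_vac (α : Fin n → ℤ) :
    grep F q n ((hsys F q n).xm (ext0 α) n) Generic.vac =
      laurent F n (Multiplicative.ofAdd α) • Generic.vac := by
  have h : ∀ k ≤ n, grep F q n ((hsys F q n).xm (ext0 α) k) Generic.vac =
      (∏ i ∈ Finset.range k, if h : i < n then (generic F n).u ⟨i, h⟩ ^ α ⟨i, h⟩ else 1) •
        Generic.vac := by
    intro k hk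
    induction k with
    | zero => simp [Sys.xm]
    | succ k ih =>
      rw [Sys.xm, map_mul, Module.End.mul_apply, ih (by omega), map_smul,
        grep_xp_vac (by omega), smul_smul, Finset.prod_range_succ]
      simp [ext0, show k < n by omega]
  rw [h n le_rfl, ← prod_generic, Finset.prod_range]
  simp

theorem grep_vac_span :
    Submodule.span (RatFun F n) (Set.range fun h : H F q n => grep F q n h Generic.vac) = ⊤ := by
  have hst : ∀ a : H F q n, ∀ v ∈ Submodule.span (RatFun F n)
      (Set.range fun h : H F q n => grep F q n h Generic.vac), grep F q n a v ∈
      Submodule.span (RatFun F n) (Set.range fun h : H F q n => grep F q n h Generic.vac) := by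
    intro a v hv
    induction hv using Submodule.span_induction with
    | mem v hv =>
      obtain ⟨h, rfl⟩ := hv
      refine Submodule.subset_span ⟨a * h, ?_⟩
      simp only [map_mul, Module.End.mul_apply]
    | zero => rw [map_zero]; exact zero_mem _
    | add v w _ _ hv hw => rw [map_add]; exact add_mem hv hw
    | smul r v _ hv => rw [map_smul]; exact Submodule.smul_mem _ _ hv
  refine Generic.vac_generates (generic F n) (q - q⁻¹) _ ?_ ?_ ?_
  · exact Submodule.subset_span ⟨1, by simp⟩
  · intro i hi v hv
    rw [← Sys.lift_c _ hi]
    exact hst _ v hv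
  · intro i hi v hv
    rw [← Sys.lift_t _ hi]
    exact hst _ v hv

/-- A family of the right size spanning `H F q n` over the Laurent polynomials is a basis. -/
theorem pbw_independent {ι : Type} [Fintype ι] (hcard : Fintype.card ι = n.factorial * 2 ^ n)
    (mm : ι → H F q n) (hspan : Submodule.span F (Set.range fun p : (Fin n → ℤ) × ι =>
      mm p.2 * (hsys F q n).xm (ext0 p.1) n) = ⊤) :
    LinearIndependent F fun p : (Fin n → ℤ) × ι => mm p.2 * (hsys F q n).xm (ext0 p.1) n := by
  have key : ∀ p : (Fin n → ℤ) × ι, grep F q n (mm p.2 * (hsys F q n).xm (ext0 p.1) n)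
      Generic.vac = laurent F n (Multiplicative.ofAdd p.1) • grep F q n (mm p.2) Generic.vac := by
    intro p
    rw [map_mul, Module.End.mul_apply, grep_xm_vac, map_smul]
  have h1 : LinearIndependent (RatFun F n) fun i => grep F q n (mm i) Generic.vac := by
    apply linearIndependent_of_top_le_span_of_card_eq_finrank
    · rw [← grep_vac_span (q := q), Submodule.span_le]
      rintro _ ⟨h, rfl⟩
      have hh : h ∈ Submodule.span F (Set.range fun p : (Fin n → ℤ) × ι =>
          mm p.2 * (hsys F q n).xm (ext0 p.1) n) := hspan ▸ Submodule.mem_top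
      simp only [SetLike.mem_coe]
      induction hh using Submodule.span_induction with
      | mem a ha =>
        obtain ⟨p, rfl⟩ := ha
        rw [key]
        exact Submodule.smul_mem _ _ (Submodule.subset_span ⟨p.2, rfl⟩)
      | zero => rw [map_zero]; exact zero_mem _
      | add a b _ _ ha hb => rw [map_add]; exact add_mem ha hb
      | smul r a _ ha =>
        rw [map_smul, LinearMap.smul_apply, ← algebraMap_smul (RatFun F n) r]
        exact Submodule.smul_mem _ _ ha
    · rw [hcard]
      simp [Module.finrank_pi_fintype, Fintype.card_perm]
  have h2 := linearIndependent_smul (laurent_independent F n) h1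
  let ev : Module.End (RatFun F n) (Equiv.Perm (Fin n) → (Fin n → Bool) → RatFun F n) →ₗ[F]
      (Equiv.Perm (Fin n) → (Fin n → Bool) → RatFun F n) :=
    { toFun := fun g => g Generic.vac
      map_add' := fun _ _ => rfl
      map_smul' := fun _ _ => rfl }
  apply LinearIndependent.of_comp (ev ∘ₗ (grep F q n).toLinearMap)
  convert h2 using 1
  ext1 p
  exact key p

end independence

namespace Sys

variable {F : Type} [Field F] {ξ : F} {A : Type} [Ring A] [Algebra F A] {N : ℕ}

section words
variable (S : Sys ξ A N)

/-- The product `t j * t (j+1) * ⋯ * t (k-1)`. -/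
def tu (j : ℕ) : ℕ → A
  | 0 => 1
  | k + 1 => if j ≤ k then tu j k * S.t k else 1

theorem tu_of_le {j k : ℕ} (h : k ≤ j) : S.tu j k = 1 := by
  cases k with
  | zero => rfl
  | succ k => rw [tu, if_neg (by omega)]

theorem tu_succ {j k : ℕ} (h : j ≤ k) : S.tu j (k + 1) = S.tu j k * S.t k := by
  rw [tu, if_pos h]

theorem tu_left {j k : ℕ} (h : j < k) : S.tu j k = S.t j * S.tu (j + 1) k := by
  induction k with
  | zero => omega
  | succ k ih =>
    rw [tu_succ S (by omega)]
    rcases Nat.lt_or_ge j k with h1 | h1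
    · rw [ih h1, tu_succ S (by omega), mul_assoc]
    · obtain rfl : j = k := by omega
      rw [tu_of_le S le_rfl, tu_of_le S le_rfl, one_mul, mul_one]

theorem tu_comm {j k : ℕ} {b : A} (h : ∀ i, j ≤ i → i < k → b * S.t i = S.t i * b) :
    b * S.tu j k = S.tu j k * b := by
  induction k with
  | zero => simp [tu]
  | succ k ih =>
    rcases Nat.lt_or_ge k j with h1 | h1
    · rw [tu_of_le S (by omega), one_mul, mul_one]
    · rw [tu_succ S h1, ← mul_assoc, ih fun i hi hk => h i hi (by omega), mul_assoc,
        h k h1 (by omega), mul_assoc]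

theorem t_tu_lt {i j k : ℕ} (h : i + 1 < j) (hk : k < N) :
    S.t i * S.tu j k = S.tu j k * S.t i :=
  S.tu_comm fun l hl hlk => S.far i l (by omega) (by omega)

theorem t_succ_tu {i j k : ℕ} (h : j ≤ i) (hik : i + 1 < k) (hk : k < N) :
    S.t (i + 1) * S.tu j k = S.tu j k * S.t i := by
  induction k with
  | zero => omega
  | succ k ih =>
    rw [tu_succ S (by omega)]
    rcases Nat.lt_or_ge (i + 1) k with h1 | h1
    · rw [← mul_assoc, ih h1 (by omega), mul_assoc, mul_assoc, S.far i k h1 (by omega)]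
    · obtain rfl : k = i + 1 := by omega
      rw [tu_succ S h, ← mul_assoc, ← mul_assoc,
        S.tu_comm fun l hl hlk => (S.far l (i + 1) (by omega) (by omega)).symm, mul_assoc,
        mul_assoc, ← mul_assoc (S.t (i + 1)), ← S.braid i (by omega)]
      simp only [mul_assoc]

/-- `c i` or `1`. -/
def cp (i : ℕ) (b : Bool) : A := if b then S.c i else 1

@[simp] theorem cp_false (i : ℕ) : S.cp i false = 1 := rfl
@[simp] theorem cp_true (i : ℕ) : S.cp i true = S.c i := rfl

theorem c_cp {i : ℕ} (hi : i < N) (b : Bool) : S.c i * S.cp i b = S.cp i (!b) := by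
  cases b
  · simp
  · simp [S.cc i hi]

/-- The sign attached to a Clifford exponent. -/
def sg (b : Bool) (a : ℤ) : ℤ := if b then -a else a

theorem xp_cp {i : ℕ} (hi : i < N) (a : ℤ) (b : Bool) :
    S.xp i a * S.cp i b = S.cp i b * S.xp i (sg b a) := by
  cases b
  · simp [sg]
  · simp [sg, S.c_xp hi]

/-- The subalgebra generated by the `x i`, `y i`, `c i`. -/
def alg : Subalgebra F A :=
  Algebra.adjoin F {a | (∃ i < N, a = S.x i) ∨ (∃ i < N, a = S.y i) ∨ ∃ i < N, a = S.c i}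

theorem x_mem {i : ℕ} (hi : i < N) : S.x i ∈ S.alg := Algebra.subset_adjoin (Or.inl ⟨i, hi, rfl⟩)
theorem y_mem {i : ℕ} (hi : i < N) : S.y i ∈ S.alg :=
  Algebra.subset_adjoin (Or.inr (Or.inl ⟨i, hi, rfl⟩))
theorem c_mem {i : ℕ} (hi : i < N) : S.c i ∈ S.alg :=
  Algebra.subset_adjoin (Or.inr (Or.inr ⟨i, hi, rfl⟩))

theorem cp_mem {i : ℕ} (hi : i < N) (b : Bool) : S.cp i b ∈ S.alg := by
  cases b
  · exact one_mem _
  · exact S.c_mem hi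

theorem xp_mem {i : ℕ} (hi : i < N) (a : ℤ) : S.xp i a ∈ S.alg := by
  induction a using Int.induction_on with
  | zero => simp
  | succ k ih => rw [xp_add, xp_one S hi]; exact mul_mem ih (S.x_mem hi)
  | pred k ih => rw [sub_eq_add_neg, xp_add, xp_neg_one S hi]; exact mul_mem ih (S.y_mem hi)

theorem alg_t {i : ℕ} (hi : i + 1 < N) {a : A} (ha : a ∈ S.alg) :
    ∃ u ∈ S.alg, ∃ v ∈ S.alg, a * S.t i = S.t i * u + v := by
  have hi0 : i < N := by omega
  induction ha using Algebra.adjoin_induction with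
  | mem a ha =>
    rcases ha with ⟨j, hj, rfl⟩ | ⟨j, hj, rfl⟩ | ⟨j, hj, rfl⟩
    · by_cases h1 : j = i
      · subst h1
        exact ⟨_, S.x_mem hi, _, neg_mem (S.alg.smul_mem (sub_mem (S.x_mem hi)
          (mul_mem (mul_mem (S.c_mem hi0) (S.c_mem hi)) (S.x_mem hi))) ξ), by
          rw [S.x_t_eq hi, sub_eq_add_neg]⟩
      by_cases h2 : j = i + 1
      · subst h2
        exact ⟨_, S.x_mem hi0, _, S.alg.smul_mem (add_mem (S.x_mem hi)
          (mul_mem (mul_mem (S.c_mem hi0) (S.c_mem hi)) (S.x_mem hi0))) ξ, S.x_succ_t hi⟩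
      · exact ⟨_, S.x_mem hj, 0, zero_mem _, by rw [add_zero, S.txo i hi j hj h1 h2]⟩
    · by_cases h1 : j = i
      · subst h1
        exact ⟨_, S.y_mem hi, _, add_mem (neg_mem (S.alg.smul_mem
          (mul_mem (mul_mem (S.y_mem hi0) (S.c_mem hi0)) (S.c_mem hi)) ξ))
          (S.alg.smul_mem (S.y_mem hi0) ξ), by
          rw [S.y_t hi, sub_eq_add_neg, add_assoc]⟩
      by_cases h2 : j = i + 1
      · subst h2
        exact ⟨_, S.y_mem hi0, _, neg_mem (S.alg.smul_mem (add_mem (S.y_mem hi0)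
          (mul_mem (S.y_mem hi) (mul_mem (S.c_mem hi0) (S.c_mem hi)))) ξ), by
          rw [S.y_succ_t hi, sub_eq_add_neg]⟩
      · exact ⟨_, S.y_mem hj, 0, zero_mem _, by rw [add_zero, S.t_y_comm hi hj h1 h2]⟩
    · by_cases h1 : j = i
      · subst h1
        exact ⟨_, S.c_mem hi, _, neg_mem (S.alg.smul_mem (sub_mem (S.c_mem hi) (S.c_mem hi0)) ξ),
          by rw [S.c_t hi, sub_eq_add_neg]⟩
      by_cases h2 : j = i + 1
      · subst h2
        exact ⟨_, S.c_mem hi0, 0, zero_mem _, by rw [add_zero, S.tc i hi]⟩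
      · exact ⟨_, S.c_mem hj, 0, zero_mem _, by rw [add_zero, S.tco i hi j hj h1 h2]⟩
  | algebraMap r =>
    exact ⟨_, S.alg.algebraMap_mem r, 0, zero_mem _, by rw [add_zero, Algebra.commutes]⟩
  | add a b _ _ ha hb =>
    obtain ⟨u, hu, v, hv, h⟩ := ha
    obtain ⟨u', hu', v', hv', h'⟩ := hb
    exact ⟨_, add_mem hu hu', _, add_mem hv hv', by rw [add_mul, h, h', mul_add]; abel⟩
  | mul a b ha0 _ ha hb =>
    obtain ⟨u, hu, v, hv, h⟩ := ha
    obtain ⟨u', hu', v', hv', h'⟩ := hb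
    exact ⟨_, mul_mem hu hu', _, add_mem (mul_mem hv hu') (mul_mem ha0 hv'), by
      rw [mul_assoc, h', mul_add, ← mul_assoc, h, add_mul, mul_assoc]; abel⟩

end words

/-- Reversing the sign of the odd generators. -/
def neg (S : Sys ξ A N) : Sys ξ A N where
  x := S.x
  y := S.y
  c i := -S.c i
  t := S.t
  xy := S.xy
  yx := S.yx
  xx := S.xx
  cc i hi := by rw [neg_mul_neg, S.cc i hi]
  canti i hi j hj h := by rw [neg_mul_neg, neg_mul_neg, S.canti i hi j hj h]
  cx i hi := by rw [neg_mul, S.cx i hi, mul_neg]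
  cxo i hi j hj h := by rw [neg_mul, S.cxo i hi j hj h, mul_neg]
  tt := S.tt
  braid := S.braid
  far := S.far
  tc i hi := by rw [mul_neg, S.tc i hi, neg_mul]
  tco i hi j hj h1 h2 := by rw [mul_neg, S.tco i hi j hj h1 h2, neg_mul]
  txo := S.txo
  cross i hi := by rw [neg_mul_neg]; exact S.cross i hi

end Sys

section embed

variable {F : Type} [Field F] {q : F} {n : ℕ}

variable (F q n) in
/-- The grading automorphism of `H F q n`. -/
noncomputable def gr : H F q n →ₐ[F] H F q n := (hsys F q n).neg.lift

variable (F q n) in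
/-- The embedding of `H F q n` into `H F q (n + 1)`. -/
noncomputable def emb : H F q n →ₐ[F] H F q (n + 1) :=
  ((hsys F q (n + 1)).restrict (Nat.le_succ n)).lift

theorem emb_x {i : ℕ} (hi : i < n) : emb F q n ((hsys F q n).x i) = (hsys F q (n + 1)).x i :=
  Sys.lift_x _ hi
theorem emb_y {i : ℕ} (hi : i < n) : emb F q n ((hsys F q n).y i) = (hsys F q (n + 1)).y i :=
  Sys.lift_y _ hi
theorem emb_c {i : ℕ} (hi : i < n) : emb F q n ((hsys F q n).c i) = (hsys F q (n + 1)).c i :=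
  Sys.lift_c _ hi
theorem emb_t {i : ℕ} (hi : i + 1 < n) :
    emb F q n ((hsys F q n).t i) = (hsys F q (n + 1)).t i :=
  Sys.lift_t _ hi

theorem gr_x {i : ℕ} (hi : i < n) : gr F q n ((hsys F q n).x i) = (hsys F q n).x i :=
  Sys.lift_x _ hi
theorem gr_y {i : ℕ} (hi : i < n) : gr F q n ((hsys F q n).y i) = (hsys F q n).y i :=
  Sys.lift_y _ hi
theorem gr_c {i : ℕ} (hi : i < n) : gr F q n ((hsys F q n).c i) = -(hsys F q n).c i :=
  Sys.lift_c _ hi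
theorem gr_t {i : ℕ} (hi : i + 1 < n) : gr F q n ((hsys F q n).t i) = (hsys F q n).t i :=
  Sys.lift_t _ hi

/-- Induction on elements of `H F q n`. -/
theorem H_induction {P : H F q n → Prop} (hr : ∀ r, P (algebraMap F _ r))
    (hx : ∀ i < n, P ((hsys F q n).x i)) (hy : ∀ i < n, P ((hsys F q n).y i))
    (hc : ∀ i < n, P ((hsys F q n).c i)) (ht : ∀ i, i + 1 < n → P ((hsys F q n).t i))
    (hadd : ∀ a b, P a → P b → P (a + b)) (hmul : ∀ a b, P a → P b → P (a * b))
    (a : H F q n) : P a := by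
  have ha : a ∈ Algebra.adjoin F (gens F q n) := by rw [adjoin_gens]; exact Algebra.mem_top
  induction ha using Algebra.adjoin_induction with
  | mem a ha =>
    rcases ha with ⟨i, hi, rfl⟩ | ⟨i, hi, rfl⟩ | ⟨i, hi, rfl⟩ | ⟨i, hi, rfl⟩
    · exact hx i hi
    · exact hy i hi
    · exact hc i hi
    · exact ht i hi
  | algebraMap r => exact hr r
  | add a b _ _ ha hb => exact hadd a b ha hb
  | mul a b _ _ ha hb => exact hmul a b ha hb

theorem c_emb (h : H F q n) : (hsys F q (n + 1)).c n * emb F q n h =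
    emb F q n (gr F q n h) * (hsys F q (n + 1)).c n := by
  induction h using H_induction with
  | hr r => simp [Algebra.commutes]
  | hx i hi => rw [gr_x hi, emb_x hi, Sys.cxo _ n (by omega) i (by omega) (by omega)]
  | hy i hi => rw [gr_y hi, emb_y hi, Sys.c_y_comm _ (by omega) (by omega) (by omega)]
  | hc i hi =>
    rw [gr_c hi, map_neg, emb_c hi, Sys.canti _ n (by omega) i (by omega) (by omega)]; exact (neg_mul (α := H F q (n + 1)) _ _).symm
  | ht i hi => rw [gr_t hi, emb_t hi, Sys.tco _ i (by omega) n (by omega) (by omega) (by omega)]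
  | hadd a b ha hb => simp only [map_add, mul_add, add_mul, ha, hb]
  | hmul a b ha hb => rw [map_mul, map_mul, map_mul, ← mul_assoc, ha, mul_assoc, hb, mul_assoc]

theorem emb_x_last (h : H F q n) :
    emb F q n h * (hsys F q (n + 1)).x n = (hsys F q (n + 1)).x n * emb F q n h := by
  induction h using H_induction with
  | hr r => simp [Algebra.commutes]
  | hx i hi => rw [emb_x hi, Sys.xx _ n (by omega) i (by omega)]
  | hy i hi => rw [emb_y hi, Sys.x_y_comm _ (by omega) (by omega)]
  | hc i hi => rw [emb_c hi, Sys.cxo _ i (by omega) n (by omega) (by omega)]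
  | ht i hi => rw [emb_t hi, Sys.txo _ i (by omega) n (by omega) (by omega) (by omega)]
  | hadd a b ha hb => simp only [map_add, mul_add, add_mul, ha, hb]
  | hmul a b ha hb => rw [map_mul, mul_assoc, hb, ← mul_assoc, ha, mul_assoc]

theorem emb_xp (h : H F q n) (a : ℤ) :
    emb F q n h * (hsys F q (n + 1)).xp n a = (hsys F q (n + 1)).xp n a * emb F q n h :=
  Sys.xp_comm_of _ (by omega) (emb_x_last h) a

theorem gr_gr (h : H F q n) : gr F q n (gr F q n h) = h := by
  suffices (gr F q n).comp (gr F q n) = AlgHom.id F _ from DFunLike.congr_fun this h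
  apply hom_ext <;> intro i hi
  · simp [gr_x hi]
  · simp [gr_y hi]
  · simp [gr_c hi]
  · simp [gr_t hi]

variable (F q n) in
/-- Twisting by a power of the grading automorphism. -/
noncomputable def grp (b : Bool) : H F q n →ₐ[F] H F q n := if b then gr F q n else AlgHom.id F _

theorem grp_grp (b : Bool) (h : H F q n) : grp F q n b (grp F q n b h) = h := by
  cases b
  · rfl
  · exact gr_gr h

theorem cp_emb (b : Bool) (h : H F q n) : (hsys F q (n + 1)).cp n b * emb F q n h =
    emb F q n (grp F q n b h) * (hsys F q (n + 1)).cp n b := by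
  cases b
  · simp [grp]
  · exact c_emb h

theorem emb_cp (b : Bool) (h : H F q n) : emb F q n h * (hsys F q (n + 1)).cp n b =
    (hsys F q (n + 1)).cp n b * emb F q n (grp F q n b h) := by
  rw [cp_emb, grp_grp]

variable (F q n) in
/-- The free generators of `H F q (n + 1)` as a right `H F q n`-module. -/
noncomputable def gb (a : ℤ) (b : Bool) (j : ℕ) : H F q (n + 1) :=
  (hsys F q (n + 1)).tu j n * (hsys F q (n + 1)).cp n b * (hsys F q (n + 1)).xp n a

variable (F q n) in
/-- The span of `gb a b j * emb h`. -/
def gspan : Submodule F (H F q (n + 1)) :=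
  Submodule.span F {x | ∃ a b, ∃ j ≤ n, ∃ h, x = gb F q n a b j * emb F q n h}

theorem gb_mem_gspan (a : ℤ) (b : Bool) {j : ℕ} (hj : j ≤ n) (h : H F q n) :
    gb F q n a b j * emb F q n h ∈ gspan F q n :=
  Submodule.subset_span ⟨a, b, j, hj, h, rfl⟩

/-- A submodule stable under left multiplication by a set generating a subalgebra is stable under
that subalgebra. -/
theorem mul_mem_of_adjoin {A : Type} [Ring A] [Algebra F A] {s : Set A} {P : Submodule F A}
    (h : ∀ a ∈ s, ∀ p ∈ P, a * p ∈ P) {a : A} (ha : a ∈ Algebra.adjoin F s) {p : A} (hp : p ∈ P) :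
    a * p ∈ P := by
  induction ha using Algebra.adjoin_induction generalizing p with
  | mem a ha => exact h a ha p hp
  | algebraMap r => rw [← Algebra.smul_def]; exact P.smul_mem r hp
  | add a b _ _ ha hb => rw [add_mul]; exact add_mem (ha hp) (hb hp)
  | mul a b _ _ ha hb => rw [mul_assoc]; exact ha (hb hp)

theorem gspan_mul_emb {x : H F q (n + 1)} (hx : x ∈ gspan F q n) (h : H F q n) :
    x * emb F q n h ∈ gspan F q n := by
  induction hx using Submodule.span_induction with
  | mem x hx =>
    obtain ⟨a, b, j, hj, g, rfl⟩ := hx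
    rw [mul_assoc, ← map_mul]
    exact gb_mem_gspan a b hj _
  | zero => rw [zero_mul]; exact zero_mem _
  | add x y _ _ hx hy => rw [add_mul]; exact add_mem hx hy
  | smul r x _ hx => rw [smul_mul_assoc]; exact Submodule.smul_mem _ _ hx

variable (F q n) in
/-- The span of the `c n ^ b * x n ^ a * h` with `h` in the smaller algebra. -/
def pspan : Submodule F (H F q (n + 1)) := Submodule.span F
  {x | ∃ a b h, x = (hsys F q (n + 1)).cp n b * (hsys F q (n + 1)).xp n a * emb F q n h}

theorem alg_mem_pspan {x : H F q (n + 1)} (hx : x ∈ (hsys F q (n + 1)).alg) :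
    x ∈ pspan F q n := by
  set S := hsys F q (n + 1) with hS
  set P := pspan F q n with hPdef
  have hone : (1 : H F q (n + 1)) ∈ P := Submodule.subset_span ⟨0, false, 1, by simp⟩
  have hlow : ∀ (g : H F q n), ∀ p ∈ P, emb F q n g * p ∈ P := by
    intro g p hp
    induction hp using Submodule.span_induction with
    | mem x hx =>
      obtain ⟨a, b, h, rfl⟩ := hx
      refine Submodule.subset_span ⟨a, b, grp F q n b g * h, ?_⟩
      rw [← mul_assoc, ← mul_assoc, emb_cp, mul_assoc (S.cp n b), emb_xp, map_mul]
      simp only [mul_assoc, hS]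
    | zero => rw [mul_zero]; exact zero_mem _
    | add x y _ _ hx hy => rw [mul_add]; exact add_mem hx hy
    | smul r x _ hx => rw [mul_smul_comm]; exact Submodule.smul_mem _ _ hx
  have hxp : ∀ (k : ℤ), ∀ p ∈ P, S.xp n k * p ∈ P := by
    intro k p hp
    induction hp using Submodule.span_induction with
    | mem x hx =>
      obtain ⟨a, b, h, rfl⟩ := hx
      refine Submodule.subset_span ⟨Sys.sg b k + a, b, h, ?_⟩
      rw [← mul_assoc, ← mul_assoc, S.xp_cp (by omega), Sys.xp_add]
      simp only [mul_assoc, hS]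
    | zero => rw [mul_zero]; exact zero_mem _
    | add x y _ _ hx hy => rw [mul_add]; exact add_mem hx hy
    | smul r x _ hx => rw [mul_smul_comm]; exact Submodule.smul_mem _ _ hx
  have hcn : ∀ p ∈ P, S.c n * p ∈ P := by
    intro p hp
    induction hp using Submodule.span_induction with
    | mem x hx =>
      obtain ⟨a, b, h, rfl⟩ := hx
      refine Submodule.subset_span ⟨a, !b, h, ?_⟩
      rw [← mul_assoc, ← mul_assoc, S.c_cp (by omega)]
    | zero => rw [mul_zero]; exact zero_mem _
    | add x y _ _ hx hy => rw [mul_add]; exact add_mem hx hy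
    | smul r x _ hx => rw [mul_smul_comm]; exact Submodule.smul_mem _ _ hx
  rw [← mul_one x]
  refine mul_mem_of_adjoin ?_ hx hone
  rintro a (⟨i, hi, rfl⟩ | ⟨i, hi, rfl⟩ | ⟨i, hi, rfl⟩) p hp
  · rcases Nat.lt_succ_iff_lt_or_eq.1 hi with h | rfl
    · rw [hS, ← emb_x h]; exact hlow _ p hp
    · rw [← S.xp_one hi]; exact hxp _ p hp
  · rcases Nat.lt_succ_iff_lt_or_eq.1 hi with h | rfl
    · rw [hS, ← emb_y h]; exact hlow _ p hp
    · rw [← S.xp_neg_one hi]; exact hxp _ p hp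
  · rcases Nat.lt_succ_iff_lt_or_eq.1 hi with h | rfl
    · rw [hS, ← emb_c h]; exact hlow _ p hp
    · exact hcn p hp

theorem alg_mem_gspan {x : H F q (n + 1)} (hx : x ∈ (hsys F q (n + 1)).alg) :
    x ∈ gspan F q n := by
  have hP : pspan F q n ≤ gspan F q n := by
    refine Submodule.span_mono ?_
    rintro x ⟨a, b, h, rfl⟩
    refine ⟨a, b, n, le_rfl, h, ?_⟩
    rw [gb, Sys.tu_of_le _ le_rfl, one_mul]
  exact hP (alg_mem_pspan hx)

theorem t_mul_gspan {i : ℕ} (hi : i < n) {x : H F q (n + 1)} (hx : x ∈ gspan F q n) :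
    (hsys F q (n + 1)).t i * x ∈ gspan F q n := by
  set S := hsys F q (n + 1) with hS
  have hcomm : ∀ k, k + 1 < n → ∀ a b, S.t k * (S.cp n b * S.xp n a) =
      S.cp n b * S.xp n a * S.t k := by
    intro k hk a b
    rw [← mul_assoc, show S.t k * S.cp n b = S.cp n b * S.t k by
      cases b
      · simp
      · exact S.tco k (by omega) n (by omega) (by omega) (by omega), mul_assoc,
      S.xp_comm_of (by omega) (S.txo k (by omega) n (by omega) (by omega) (by omega)), mul_assoc]
  have key : ∀ k, k + 1 < n → ∀ a b, ∀ j ≤ n, ∀ h,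
      S.tu j n * S.t k * (S.cp n b * S.xp n a * emb F q n h) ∈ gspan F q n := by
    intro k hk a b j hj h
    rw [mul_assoc, ← mul_assoc (S.t k), hcomm k hk, mul_assoc _ (S.t k), hS, ← emb_t hk,
      ← map_mul, ← mul_assoc, ← mul_assoc]
    exact gb_mem_gspan a b hj _
  induction hx using Submodule.span_induction with
  | mem x hx =>
    obtain ⟨a, b, j, hj, h, rfl⟩ := hx
    have e : S.t i * (gb F q n a b j * emb F q n h) =
        S.t i * S.tu j n * (S.cp n b * S.xp n a * emb F q n h) := by
      simp only [gb, mul_assoc, hS]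
    rw [e]
    rcases Nat.lt_trichotomy (i + 1) j with h1 | rfl | h1
    · rw [S.t_tu_lt h1 (by omega)]
      exact key i (by omega) a b j hj h
    · rw [← S.tu_left hi, ← mul_assoc, ← mul_assoc]
      exact gb_mem_gspan a b (by omega) h
    · rcases Nat.lt_or_ge j i with h2 | h2
      · obtain ⟨k, rfl⟩ : ∃ k, i = k + 1 := ⟨i - 1, by omega⟩
        rw [S.t_succ_tu (by omega) hi (by omega)]
        exact key k hi a b j hj h
      · obtain rfl : i = j := by omega
        rw [S.tu_left hi, ← mul_assoc (S.t i), S.tt i (by omega), add_mul, one_mul, smul_mul_assoc,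
          ← S.tu_left hi, add_mul, smul_mul_assoc]
        simp only [← mul_assoc]
        exact add_mem (Submodule.smul_mem _ _ (gb_mem_gspan a b hj h))
          (gb_mem_gspan a b (by omega) h)
  | zero => rw [mul_zero]; exact zero_mem _
  | add x y _ _ hx hy => rw [mul_add]; exact add_mem hx hy
  | smul r x _ hx => rw [mul_smul_comm]; exact Submodule.smul_mem _ _ hx

theorem alg_tu_alg {j : ℕ} (hj : j ≤ n) : ∀ a ∈ (hsys F q (n + 1)).alg,
    ∀ w ∈ (hsys F q (n + 1)).alg, a * (hsys F q (n + 1)).tu j n * w ∈ gspan F q n := by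
  set S := hsys F q (n + 1) with hS
  induction hj using Nat.decreasingInduction with
  | self =>
    intro a ha w hw
    rw [S.tu_of_le le_rfl, mul_one]
    exact alg_mem_gspan (mul_mem ha hw)
  | of_succ j hj ih =>
    intro a ha w hw
    obtain ⟨u, hu, v, hv, e⟩ := S.alg_t (show j + 1 < n + 1 by omega) ha
    rw [S.tu_left hj, ← mul_assoc, e, add_mul, add_mul, mul_assoc (S.t j), mul_assoc (S.t j)]
    exact add_mem (t_mul_gspan hj (ih u hu w hw)) (ih v hv w hw)

theorem gspan_eq_top : gspan F q n = ⊤ := by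
  set S := hsys F q (n + 1) with hS
  rw [eq_top_iff]
  rintro x -
  rw [← mul_one x]
  refine mul_mem_of_adjoin (s := gens F q (n + 1)) ?_ (by rw [adjoin_gens]; exact Algebra.mem_top)
    (alg_mem_gspan (one_mem _))
  have hA : ∀ a ∈ S.alg, ∀ p ∈ gspan F q n, a * p ∈ gspan F q n := by
    intro a ha p hp
    induction hp using Submodule.span_induction with
    | mem x hx =>
      obtain ⟨k, b, j, hj, h, rfl⟩ := hx
      rw [← mul_assoc]
      apply gspan_mul_emb
      rw [gb, mul_assoc, ← mul_assoc a]
      exact alg_tu_alg hj a ha _ (mul_mem (S.cp_mem (by omega) b) (S.xp_mem (by omega) k))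
    | zero => rw [mul_zero]; exact zero_mem _
    | add x y _ _ hx hy => rw [mul_add]; exact add_mem hx hy
    | smul r x _ hx => rw [mul_smul_comm]; exact Submodule.smul_mem _ _ hx
  rintro a (⟨i, hi, rfl⟩ | ⟨i, hi, rfl⟩ | ⟨i, hi, rfl⟩ | ⟨i, hi, rfl⟩) p hp
  · exact hA _ (S.x_mem hi) p hp
  · exact hA _ (S.y_mem hi) p hp
  · exact hA _ (S.c_mem hi) p hp
  · exact t_mul_gspan (by omega) hp

end embed

section pbw

variable {F : Type} [Field F] {q : F}

theorem emb_xp_lt {n i : ℕ} (hi : i < n) (a : ℤ) :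
    emb F q n ((hsys F q n).xp i a) = (hsys F q (n + 1)).xp i a := by
  induction a using Int.induction_on with
  | zero => simp
  | succ k ih =>
    rw [Sys.xp_add, map_mul, ih, Sys.xp_one _ hi, emb_x hi, Sys.xp_add,
      Sys.xp_one _ (show i < n + 1 by omega)]
  | pred k ih =>
    rw [sub_eq_add_neg (-(k : ℤ)), Sys.xp_add, map_mul, ih, Sys.xp_neg_one _ hi, emb_y hi,
      Sys.xp_add, Sys.xp_neg_one _ (show i < n + 1 by omega)]

theorem emb_xm {n k : ℕ} (hk : k ≤ n) {α β : ℕ → ℤ} (h : ∀ i < k, α i = β i) :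
    emb F q n ((hsys F q n).xm α k) = (hsys F q (n + 1)).xm β k := by
  induction k with
  | zero => simp [Sys.xm]
  | succ k ih =>
    rw [Sys.xm, map_mul, ih (by omega) fun i hi => h i (by omega), emb_xp_lt (by omega),
      h k (by omega), Sys.xm]

/-- The spanning family at the next level. -/
noncomputable def nextFam {n : ℕ} {ι : Type} (mm : ι → H F q n) :
    (Bool × Fin (n + 1)) × ι → H F q (n + 1) := fun p =>
  (hsys F q (n + 1)).tu p.1.2 n * (hsys F q (n + 1)).cp n p.1.1 * emb F q n (mm p.2)

theorem nextFam_mul {n : ℕ} {ι : Type} (mm : ι → H F q n) (α : Fin (n + 1) → ℤ) (b : Bool)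
    (j : Fin (n + 1)) (i : ι) :
    nextFam mm ((b, j), i) * (hsys F q (n + 1)).xm (ext0 α) (n + 1) =
      gb F q n (α (Fin.last n)) b j *
        emb F q n (mm i * (hsys F q n).xm (ext0 fun k => α k.castSucc) n) := by
  rw [nextFam, Sys.xm, map_mul, emb_xm le_rfl (β := ext0 α), gb,
    show ext0 α n = α (Fin.last n) by simp [ext0, Fin.last]]
  · simp only [mul_assoc]
    congr 2
    rw [← mul_assoc, emb_xp, mul_assoc]
  · intro k hk
    simp [ext0, hk, show k < n + 1 by omega]

theorem span_nextFam {n : ℕ} {ι : Type} (mm : ι → H F q n)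
    (hs : Submodule.span F (Set.range fun p : (Fin n → ℤ) × ι =>
      mm p.2 * (hsys F q n).xm (ext0 p.1) n) = ⊤) :
    Submodule.span F (Set.range fun p : (Fin (n + 1) → ℤ) × ((Bool × Fin (n + 1)) × ι) =>
      nextFam mm p.2 * (hsys F q (n + 1)).xm (ext0 p.1) (n + 1)) = ⊤ := by
  rw [eq_top_iff, ← gspan_eq_top, gspan, Submodule.span_le]
  rintro _ ⟨a, b, j, hj, h, rfl⟩
  have hh : h ∈ Submodule.span F (Set.range fun p : (Fin n → ℤ) × ι =>
      mm p.2 * (hsys F q n).xm (ext0 p.1) n) := hs ▸ Submodule.mem_top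
  simp only [SetLike.mem_coe]
  induction hh using Submodule.span_induction with
  | mem h hh =>
    obtain ⟨⟨α, i⟩, rfl⟩ := hh
    refine Submodule.subset_span ⟨(Fin.snoc α a, ((b, ⟨j, by omega⟩), i)), ?_⟩
    simp only
    rw [nextFam_mul]
    simp
  | zero => rw [map_zero, mul_zero]; exact zero_mem _
  | add x y _ _ hx hy => rw [map_add, mul_add]; exact add_mem hx hy
  | smul r x _ hx => rw [map_smul, mul_smul_comm]; exact Submodule.smul_mem _ _ hx

variable (F q) in
theorem exists_spanning (n : ℕ) : ∃ (ι : Type) (_ : Fintype ι) (mm : ι → H F q n),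
    Fintype.card ι = n.factorial * 2 ^ n ∧
    Submodule.span F (Set.range fun p : (Fin n → ℤ) × ι =>
      mm p.2 * (hsys F q n).xm (ext0 p.1) n) = ⊤ := by
  induction n with
  | zero =>
    refine ⟨Unit, inferInstance, fun _ => 1, by simp, ?_⟩
    rw [eq_top_iff]
    rintro a -
    have ha : a ∈ (⊥ : Subalgebra F (H F q 0)) := by
      induction a using H_induction with
      | hr r => exact Subalgebra.algebraMap_mem _ r
      | hx i hi => omega
      | hy i hi => omega
      | hc i hi => omega
      | ht i hi => omega
      | hadd a b ha hb => exact add_mem ha hb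
      | hmul a b ha hb => exact mul_mem ha hb
    obtain ⟨r, rfl⟩ := Algebra.mem_bot.1 ha
    rw [Algebra.algebraMap_eq_smul_one]
    exact Submodule.smul_mem _ _ (Submodule.subset_span ⟨(0, ()), by simp [Sys.xm]⟩)
  | succ n ih =>
    obtain ⟨ι, _, mm, hcard, hs⟩ := ih
    refine ⟨_, inferInstance, nextFam mm, ?_, span_nextFam mm hs⟩
    simp only [Fintype.card_prod, Fintype.card_bool, Fintype.card_fin, hcard, Nat.factorial_succ]
    ring

variable (F q) in
/-- Coordinates with respect to the right `H F q n`-basis `gb a b j` of `H F q (n + 1)`. -/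
theorem exists_coeff (n : ℕ) : ∃ κ : H F q (n + 1) →ₗ[F] (ℤ →₀ (Bool × Fin (n + 1) → H F q n)),
    ∀ a b (j : Fin (n + 1)) h, κ (gb F q n a b j * emb F q n h) =
      Finsupp.single a (Pi.single (b, j) h) := by
  obtain ⟨ι, _, mm, hcard, hs⟩ := exists_spanning F q n
  have hs' := span_nextFam mm hs
  have hi := pbw_independent (by
    simp only [Fintype.card_prod, Fintype.card_bool, Fintype.card_fin, hcard, Nat.factorial_succ]
    ring) (nextFam mm) hs'
  let B := Module.Basis.mk hi hs'.ge
  refine ⟨B.constr F fun p => Finsupp.single (p.1 (Fin.last n)) (Pi.single p.2.1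
    (mm p.2.2 * (hsys F q n).xm (ext0 fun k => p.1 k.castSucc) n)), fun a b j h => ?_⟩
  have hh : h ∈ Submodule.span F (Set.range fun p : (Fin n → ℤ) × ι =>
      mm p.2 * (hsys F q n).xm (ext0 p.1) n) := hs ▸ Submodule.mem_top
  induction hh using Submodule.span_induction with
  | mem h hh =>
    obtain ⟨⟨α, i⟩, rfl⟩ := hh
    have e : gb F q n a b j * emb F q n (mm i * (hsys F q n).xm (ext0 α) n) =
        B (Fin.snoc α a, ((b, j), i)) := by
      rw [Module.Basis.mk_apply]
      simp only
      rw [nextFam_mul]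
      simp
    simp only
    rw [e, Module.Basis.constr_basis]
    simp
  | zero => simp
  | add x y _ _ hx hy => rw [map_add, mul_add, map_add, hx, hy, Pi.single_add, Finsupp.single_add]
  | smul r x _ hx =>
    rw [map_smul, mul_smul_comm, map_smul, hx, Pi.single_smul, Finsupp.smul_single]

end pbw

namespace Sys

variable {F : Type} [Field F] {ξ : F} {A : Type} [Ring A] [Algebra F A] {N : ℕ} (S : Sys ξ A N)

/-- The subalgebra generated by the `t i` for `i ∈ s`. -/
def tsub (s : Set ℕ) : Subalgebra F A := Algebra.adjoin F (S.t '' s)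

theorem t_mem_tsub {s : Set ℕ} {i : ℕ} (h : i ∈ s) : S.t i ∈ S.tsub s :=
  Algebra.subset_adjoin ⟨i, h, rfl⟩

theorem tinv_mem_tsub {s : Set ℕ} {i : ℕ} (h : i ∈ s) : S.tinv i ∈ S.tsub s :=
  sub_mem (S.t_mem_tsub h) (Subalgebra.algebraMap_mem _ _)

theorem tsub_mono {s s' : Set ℕ} (h : s ⊆ s') : S.tsub s ≤ S.tsub s' :=
  Algebra.adjoin_mono (Set.image_mono h)

/-- The subalgebra generated by all the `t i`. -/
abbrev tall : Subalgebra F A := S.tsub {i | i + 1 < N}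

theorem tu_mem {j k : ℕ} (hk : k < N) : S.tu j k ∈ S.tall := by
  induction k with
  | zero => exact one_mem _
  | succ k ih =>
    rcases Nat.lt_or_ge k j with h | h
    · rw [tu_of_le S (by omega)]; exact one_mem _
    · rw [tu_succ S h]; exact mul_mem (ih (by omega)) (S.t_mem_tsub hk)

/-- The subalgebra attached to the first `m` strands. -/
def low (m : ℕ) : Subalgebra F A := Algebra.adjoin F {a | (∃ i < m, a = S.x i) ∨
  (∃ i < m, a = S.y i) ∨ (∃ i < m, a = S.c i) ∨ ∃ i, i + 1 < m ∧ a = S.t i}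

theorem x_mem_low {m i : ℕ} (h : i < m) : S.x i ∈ S.low m :=
  Algebra.subset_adjoin (Or.inl ⟨i, h, rfl⟩)
theorem c_mem_low {m i : ℕ} (h : i < m) : S.c i ∈ S.low m :=
  Algebra.subset_adjoin (Or.inr (Or.inr (Or.inl ⟨i, h, rfl⟩)))

theorem low_mono {m k : ℕ} (h : m ≤ k) : S.low m ≤ S.low k := by
  apply Algebra.adjoin_mono
  rintro a (⟨i, hi, rfl⟩ | ⟨i, hi, rfl⟩ | ⟨i, hi, rfl⟩ | ⟨i, hi, rfl⟩)
  · exact Or.inl ⟨i, by omega, rfl⟩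
  · exact Or.inr (Or.inl ⟨i, by omega, rfl⟩)
  · exact Or.inr (Or.inr (Or.inl ⟨i, by omega, rfl⟩))
  · exact Or.inr (Or.inr (Or.inr ⟨i, by omega, rfl⟩))

theorem low_t {m : ℕ} (hm : m + 1 < N) {a : A} (ha : a ∈ S.low m) : a * S.t m = S.t m * a := by
  induction ha using Algebra.adjoin_induction with
  | mem a ha =>
    rcases ha with ⟨i, hi, rfl⟩ | ⟨i, hi, rfl⟩ | ⟨i, hi, rfl⟩ | ⟨i, hi, rfl⟩
    · exact (S.txo m hm i (by omega) (by omega) (by omega)).symm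
    · exact (S.t_y_comm hm (by omega) (by omega) (by omega)).symm
    · exact (S.tco m hm i (by omega) (by omega) (by omega)).symm
    · exact S.far i m hi hm
  | algebraMap r => exact Algebra.commutes r _
  | add a b _ _ ha hb => rw [add_mul, ha, hb, mul_add]
  | mul a b _ _ ha hb => rw [mul_assoc, hb, ← mul_assoc, ha, mul_assoc]

/-- The product of the subalgebra of the `t i` and of the first `m` strands. -/
def D0 (m : ℕ) : Submodule F A :=
  Subalgebra.toSubmodule S.tall * Subalgebra.toSubmodule (S.low m)

theorem tall_le_D0 {m : ℕ} {a : A} (ha : a ∈ S.tall) : a ∈ S.D0 m := by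
  rw [← mul_one a]
  exact Submodule.mul_mem_mul ha (one_mem (S.low m))

theorem D0_mono {m k : ℕ} (h : m ≤ k) : S.D0 m ≤ S.D0 k :=
  mul_le_mul' le_rfl (S.low_mono h)

theorem tall_mul_D0 {m : ℕ} {a p : A} (ha : a ∈ S.tall) (hp : p ∈ S.D0 m) : a * p ∈ S.D0 m := by
  have := Submodule.mul_mem_mul (show a ∈ Subalgebra.toSubmodule S.tall from ha) hp
  rwa [D0, ← mul_assoc, (Subalgebra.isIdempotentElem_toSubmodule S.tall).eq] at this

theorem D0_mul_low {m : ℕ} {a p : A} (ha : a ∈ S.low m) (hp : p ∈ S.D0 m) : p * a ∈ S.D0 m := by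
  have := Submodule.mul_mem_mul hp (show a ∈ Subalgebra.toSubmodule (S.low m) from ha)
  rwa [D0, mul_assoc, (Subalgebra.isIdempotentElem_toSubmodule (S.low m)).eq] at this

theorem D0_mul_t {m : ℕ} (hm : m + 1 < N) {p : A} (hp : p ∈ S.D0 m) : p * S.t m ∈ S.D0 m := by
  refine Submodule.mul_induction_on hp (fun s hs a ha => ?_) fun a b ha hb => ?_
  · rw [mul_assoc, S.low_t hm ha, ← mul_assoc]
    exact Submodule.mul_mem_mul ((S.tall).mul_mem hs (S.t_mem_tsub hm)) ha
  · rw [add_mul]; exact add_mem ha hb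

/-- `D0 m + D0 m * c m`. -/
def D (m : ℕ) : Submodule F A := S.D0 m ⊔ (S.D0 m).map (LinearMap.mulRight F (S.c m))

theorem mem_D {m : ℕ} {x : A} : x ∈ S.D m ↔ ∃ p ∈ S.D0 m, ∃ p' ∈ S.D0 m, x = p + p' * S.c m := by
  rw [D, Submodule.mem_sup]
  constructor
  · rintro ⟨p, hp, _, ⟨p', hp', rfl⟩, rfl⟩
    exact ⟨p, hp, p', hp', rfl⟩
  · rintro ⟨p, hp, p', hp', rfl⟩
    exact ⟨p, hp, _, ⟨p', hp', rfl⟩, rfl⟩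

theorem D0_le_D {m : ℕ} : S.D0 m ≤ S.D m := le_sup_left

theorem D0_mul_c_mem {m : ℕ} {p : A} (hp : p ∈ S.D0 m) : p * S.c m ∈ S.D m :=
  (S.mem_D).2 ⟨0, zero_mem _, p, hp, by rw [zero_add]⟩

theorem tall_mul_D {m : ℕ} {a p : A} (ha : a ∈ S.tall) (hx : p ∈ S.D m) : a * p ∈ S.D m := by
  obtain ⟨p, hp, p', hp', rfl⟩ := S.mem_D.1 hx
  exact S.mem_D.2 ⟨_, S.tall_mul_D0 ha hp, _, S.tall_mul_D0 ha hp', by rw [mul_add, mul_assoc]⟩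

theorem D_mul_c {m : ℕ} (hm : m < N) {p : A} (hx : p ∈ S.D m) : p * S.c m ∈ S.D m := by
  obtain ⟨p, hp, p', hp', rfl⟩ := S.mem_D.1 hx
  exact S.mem_D.2 ⟨_, hp', _, hp, by rw [add_mul, mul_assoc, S.cc m hm, mul_one, add_comm]⟩

theorem D_mul_t {m : ℕ} (hm : m + 1 < N) {p : A} (hx : p ∈ S.D m) : p * S.t m ∈ S.D (m + 1) := by
  obtain ⟨p, hp, p', hp', rfl⟩ := S.mem_D.1 hx
  have h := S.D0_mono (Nat.le_succ m)
  refine S.mem_D.2 ⟨_, add_mem (h (S.D0_mul_t hm hp)) (Submodule.smul_mem _ ξ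
    (S.D0_mul_low (S.c_mem_low (Nat.lt_succ_self m)) (h hp'))), _,
    sub_mem (h (S.D0_mul_t hm hp')) (Submodule.smul_mem _ ξ (h hp')), ?_⟩
  rw [add_mul, mul_assoc p', S.c_t hm, mul_sub, mul_smul_comm, mul_sub, sub_mul, smul_mul_assoc,
    mul_assoc p', smul_sub]
  abel

theorem D_mul_cross {m : ℕ} {p : A} (hx : p ∈ S.D m) (k : ℕ) :
    p * S.x m ^ k * (1 - S.c m * S.c (m + 1)) ∈ S.D (m + 1) := by
  obtain ⟨p, hp, p', hp', rfl⟩ := S.mem_D.1 hx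
  have h := S.D0_mono (Nat.le_succ m)
  have hc := S.c_mem_low (Nat.lt_succ_self m)
  have h1 : (p + p' * S.c m) * S.x m ^ k ∈ S.D0 (m + 1) :=
    S.D0_mul_low (pow_mem (S.x_mem_low (Nat.lt_succ_self m)) k)
      (add_mem (h hp) (S.D0_mul_low hc (h hp')))
  refine S.mem_D.2 ⟨_, h1, _, neg_mem (S.D0_mul_low hc h1), ?_⟩
  rw [mul_sub, mul_one, neg_mul, ← mul_assoc, sub_eq_add_neg]

/-- The span of `D m * x m ^ k` for exponents `k ∈ s`. -/
def V (m : ℕ) (s : Set ℤ) : Submodule F A :=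
  Submodule.span F {a | ∃ p ∈ S.D m, ∃ k ∈ s, a = p * S.xp m k}

theorem mem_V {m : ℕ} {s : Set ℤ} {p : A} (hp : p ∈ S.D m) {k : ℤ} (hk : k ∈ s) :
    p * S.xp m k ∈ S.V m s := Submodule.subset_span ⟨p, hp, k, hk, rfl⟩

theorem V_mono {m : ℕ} {s s' : Set ℤ} (h : s ⊆ s') : S.V m s ≤ S.V m s' := by
  apply Submodule.span_mono
  rintro a ⟨p, hp, k, hk, rfl⟩
  exact ⟨p, hp, k, h hk, rfl⟩

theorem D_mul_xpow_t {m : ℕ} (hm : m + 1 < N) {p : A} (hx : p ∈ S.D m) {k : ℕ} (hk : 1 ≤ k) :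
    p * S.x m ^ k * S.t m ∈ S.V (m + 1) (Set.Icc 1 k) := by
  rw [mul_assoc, S.x_pow_t hm, mul_sub, mul_smul_comm, Finset.mul_sum, ← mul_assoc,
    ← S.xp_natCast hm]
  refine sub_mem (S.mem_V (S.D_mul_t hm hx) ⟨by omega, le_rfl⟩)
    (Submodule.smul_mem _ _ (Submodule.sum_mem _ fun j hj => ?_))
  have hj' := Finset.mem_range.1 hj
  rw [← mul_assoc, ← mul_assoc, ← S.xp_natCast hm]
  exact S.mem_V (S.D_mul_cross hx j) ⟨by omega, by omega⟩

theorem V_mul_t {m : ℕ} (hm : m + 1 < N) {k l : ℕ} {a : A} (hk : k ≤ 1)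
    (ha : a ∈ S.V m (Set.Icc k l)) : a * S.t m ∈ S.V (m + 1) (Set.Icc k l) := by
  induction ha using Submodule.span_induction with
  | mem a ha =>
    obtain ⟨p, hp, i, hi, rfl⟩ := ha
    obtain ⟨i, rfl⟩ := Int.eq_ofNat_of_zero_le (show 0 ≤ i by have := hi.1; omega)
    have h1 := hi.1
    have h2 := hi.2
    rcases Nat.eq_zero_or_pos i with rfl | h
    · rw [Int.natCast_zero, xp_zero, mul_one, ← mul_one (p * S.t m), ← S.xp_zero (m + 1)]
      exact S.mem_V (S.D_mul_t hm hp) ⟨by omega, by omega⟩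
    · rw [S.xp_natCast (by omega)]
      exact S.V_mono (Set.Icc_subset_Icc (by omega) (by omega)) (S.D_mul_xpow_t hm hp h)
  | zero => rw [zero_mul]; exact zero_mem _
  | add a b _ _ ha hb => rw [add_mul]; exact add_mem ha hb
  | smul r a _ ha => rw [smul_mul_assoc]; exact Submodule.smul_mem _ _ ha

/-- The polynomial with coefficients `aa` evaluated at `x 0`. -/
def fe (d : ℕ) (aa : ℕ → F) : A := ∑ i ∈ Finset.range (d + 1), aa i • S.x 0 ^ i

/-- The lowest coefficient of `fe * tu 0 m`. -/
theorem fe_tu_bottom {d : ℕ} {aa : ℕ → F} {m : ℕ} (hm : m < N) :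
    S.fe d aa * S.tu 0 m - aa 0 • S.tu 0 m ∈ S.V m (Set.Icc 1 d) := by
  induction m with
  | zero =>
    rw [fe, S.tu_of_le le_rfl, mul_one, Finset.sum_range_succ', pow_zero, add_sub_cancel_right]
    refine Submodule.sum_mem _ fun i hi => Submodule.smul_mem _ _ ?_
    have := Finset.mem_range.1 hi
    rw [← S.xp_natCast hm, ← one_mul (S.xp _ _)]
    exact S.mem_V (S.D0_le_D (S.tall_le_D0 (one_mem _))) ⟨by omega, by omega⟩
  | succ m ih =>
    rw [S.tu_succ (Nat.zero_le m), ← mul_assoc, ← smul_mul_assoc, ← sub_mul]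
    exact S.V_mul_t hm le_rfl (ih (by omega))

/-- The product `tinv 0 * ⋯ * tinv (m-1)`. -/
def ui : ℕ → A
  | 0 => 1
  | m + 1 => ui m * S.tinv m

theorem ui_mem {m : ℕ} (hm : m < N) : S.ui m ∈ S.tall := by
  induction m with
  | zero => exact one_mem _
  | succ m ih => exact mul_mem (ih (by omega)) (S.tinv_mem_tsub hm)

theorem c_tinv {i : ℕ} (hi : i + 1 < N) : S.c i * S.tinv i = S.tinv i * S.c (i + 1) := by
  rw [tinv, mul_sub, S.c_t hi, sub_mul, ← Algebra.commutes, ← Algebra.smul_def,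
    ← Algebra.smul_def]
  module

/-- The highest coefficient of `fe * tu 0 m`. -/
theorem fe_tu_top {d : ℕ} (hd : 1 ≤ d) {aa : ℕ → F} (had : aa d = 1) {m : ℕ} (hm : m < N) :
    ∃ p ∈ S.D0 m, S.fe d aa * S.tu 0 m - (S.ui m + p * S.c m) * S.xp m d ∈
      S.V m (Set.Icc 0 (d - 1 : ℕ)) := by
  induction m with
  | zero =>
    refine ⟨0, zero_mem _, ?_⟩
    rw [fe, S.tu_of_le le_rfl, mul_one, Finset.sum_range_succ, had, one_smul, zero_mul, add_zero,
      ui, one_mul, S.xp_natCast hm, add_sub_cancel_right]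
    refine Submodule.sum_mem _ fun i hi => Submodule.smul_mem _ _ ?_
    have := Finset.mem_range.1 hi
    rw [← S.xp_natCast hm, ← one_mul (S.xp _ _)]
    exact S.mem_V (S.D0_le_D (S.tall_le_D0 (one_mem _))) ⟨by omega, by omega⟩
  | succ m ih =>
    obtain ⟨p, hp, h⟩ := ih (by omega)
    have hm0 : m < N := by omega
    have h1 := S.V_mul_t hm (Nat.zero_le 1) h
    have hu := S.ui_mem hm0
    set u := S.ui m + p * S.c m with hu'
    have huD : u ∈ S.D m := add_mem (S.D0_le_D (S.tall_le_D0 hu)) (S.D0_mul_c_mem hp)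
    have hlow := S.c_mem_low (Nat.lt_succ_self m)
    have hmono := S.D0_mono (Nat.le_succ m)
    refine ⟨ξ • (S.ui m * S.c m) + (p * S.tinv m + ξ • p), ?_, ?_⟩
    · refine add_mem (Submodule.smul_mem _ _ (S.D0_mul_low hlow (S.tall_le_D0 hu)))
        (add_mem ?_ (Submodule.smul_mem _ _ (hmono hp)))
      rw [tinv, mul_sub, ← Algebra.commutes, ← Algebra.smul_def]
      exact hmono (sub_mem (S.D0_mul_t hm hp) (Submodule.smul_mem _ _ hp))
    · have e1 : u * (S.tinv m + ξ • (S.c m * S.c (m + 1))) = S.ui (m + 1) +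
          (ξ • (S.ui m * S.c m) + (p * S.tinv m + ξ • p)) * S.c (m + 1) := by
        rw [hu', ui, mul_add, add_mul, mul_assoc p, S.c_tinv hm, add_mul, mul_smul_comm,
          mul_smul_comm, mul_assoc p (S.c m), ← mul_assoc (S.c m) (S.c m), S.cc m hm0, one_mul,
          add_mul, add_mul, smul_mul_assoc, smul_mul_assoc, mul_assoc, mul_assoc p]
        abel
      obtain ⟨e, rfl⟩ : ∃ e, d = e + 1 := ⟨d - 1, by omega⟩
      have e2 : u * S.x m ^ (e + 1) * S.t m = u * (S.tinv m + ξ • (S.c m * S.c (m + 1))) *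
          S.x (m + 1) ^ (e + 1) - ξ • ∑ j ∈ Finset.range e, u * S.x m ^ (j + 1) *
            (1 - S.c m * S.c (m + 1)) * S.x (m + 1) ^ (e - j) := by
        rw [mul_assoc, S.x_pow_t hm, Finset.sum_range_succ', mul_sub, tinv, mul_smul_comm,
          mul_add, Finset.mul_sum, pow_zero, one_mul, Nat.sub_zero]
        have e3 : ∀ j ∈ Finset.range e, u * (S.x m ^ (j + 1) * (1 - S.c m * S.c (m + 1)) *
            S.x (m + 1) ^ (e + 1 - (j + 1))) = u * S.x m ^ (j + 1) *
            (1 - S.c m * S.c (m + 1)) * S.x (m + 1) ^ (e - j) := by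
          intro j hj
          rw [Nat.add_sub_add_right]
          simp only [mul_assoc]
        rw [Finset.sum_congr rfl e3]
        simp only [mul_add, mul_sub, add_mul, sub_mul, ← Algebra.commutes ξ, ← Algebra.smul_def,
          smul_mul_assoc, mul_smul_comm, one_mul, smul_add, smul_sub, mul_assoc]
        abel
      rw [sub_mul, S.xp_natCast hm0, e2, e1] at h1
      rw [S.tu_succ (Nat.zero_le m), ← mul_assoc, S.xp_natCast hm]
      have h2 : ξ • ∑ j ∈ Finset.range e, u * S.x m ^ (j + 1) *
            (1 - S.c m * S.c (m + 1)) * S.x (m + 1) ^ (e - j) ∈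
            S.V (m + 1) (Set.Icc (0 : ℕ) (e + 1 - 1 : ℕ)) := by
        refine Submodule.smul_mem _ _ (Submodule.sum_mem _ fun j hj => ?_)
        have hj' := Finset.mem_range.1 hj
        rw [← S.xp_natCast hm]
        exact S.mem_V (S.D_mul_cross huD _) ⟨by omega, by omega⟩
      have h3 := sub_mem h1 h2
      rw [sub_sub, sub_add_cancel] at h3
      exact h3

/-- The inverse `t (m-1) * ⋯ * t 0` of `ui m`. -/
def vi : ℕ → A
  | 0 => 1
  | m + 1 => S.t m * vi m

/-- The inverse `tinv (m-1) * ⋯ * tinv 0` of `tu 0 m`. -/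
def wi : ℕ → A
  | 0 => 1
  | m + 1 => S.tinv m * wi m

theorem vi_mem {m : ℕ} (hm : m < N) : S.vi m ∈ S.tall := by
  induction m with
  | zero => exact one_mem _
  | succ m ih => exact mul_mem (S.t_mem_tsub hm) (ih (by omega))

theorem wi_mem {m : ℕ} (hm : m < N) : S.wi m ∈ S.tall := by
  induction m with
  | zero => exact one_mem _
  | succ m ih => exact mul_mem (S.tinv_mem_tsub hm) (ih (by omega))

theorem vi_ui {m : ℕ} (hm : m < N) : S.vi m * S.ui m = 1 := by
  induction m with
  | zero => exact one_mul _
  | succ m ih => rw [vi, ui, mul_assoc, ← mul_assoc (S.vi m), ih (by omega), one_mul, S.t_tinv hm]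

theorem ui_vi {m : ℕ} (hm : m < N) : S.ui m * S.vi m = 1 := by
  induction m with
  | zero => exact one_mul _
  | succ m ih => rw [vi, ui, mul_assoc, ← mul_assoc (S.tinv m), S.tinv_t hm, one_mul, ih (by omega)]

theorem wi_tu {m : ℕ} (hm : m < N) : S.wi m * S.tu 0 m = 1 := by
  induction m with
  | zero => exact one_mul _
  | succ m ih => rw [wi, S.tu_succ (Nat.zero_le m), mul_assoc, ← mul_assoc (S.wi m), ih (by omega),
      one_mul, S.tinv_t hm]

theorem tu_wi {m : ℕ} (hm : m < N) : S.tu 0 m * S.wi m = 1 := by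
  induction m with
  | zero => exact one_mul _
  | succ m ih => rw [wi, S.tu_succ (Nat.zero_le m), mul_assoc, ← mul_assoc (S.t m), S.t_tinv hm,
      one_mul, ih (by omega)]

theorem wi_t_succ {i k : ℕ} (hik : i + 1 < k) (hk : k < N) :
    S.wi k * S.t (i + 1) = S.t i * S.wi k := by
  have h := S.t_succ_tu (Nat.zero_le i) hik hk
  calc _ = S.wi k * (S.t (i + 1) * S.tu 0 k) * S.wi k := by
        rw [mul_assoc, mul_assoc (S.t (i + 1)), S.tu_wi hk, mul_one]
    _ = _ := by rw [h, ← mul_assoc, S.wi_tu hk, one_mul]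

theorem vi_comm {k : ℕ} {b : A} (h : ∀ i < k, b * S.t i = S.t i * b) :
    b * S.vi k = S.vi k * b := by
  induction k with
  | zero => simp [vi]
  | succ k ih => rw [vi, ← mul_assoc, h k (by omega), mul_assoc, ih fun i hi => h i (by omega),
      mul_assoc]

theorem vi_t_succ {i k : ℕ} (hik : i + 1 < k) (hk : k < N) :
    S.vi k * S.t (i + 1) = S.t i * S.vi k := by
  induction k with
  | zero => omega
  | succ k ih =>
    rw [vi]
    rcases Nat.lt_or_ge (i + 1) k with h1 | h1
    · rw [mul_assoc, ih h1 (by omega), ← mul_assoc, ← S.far i k h1 (by omega), mul_assoc]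
    · obtain rfl : k = i + 1 := by omega
      rw [vi, mul_assoc, mul_assoc,
        ← S.vi_comm fun l hl => (S.far l (i + 1) (by omega) (by omega)).symm, ← mul_assoc (S.t i),
        ← mul_assoc, ← mul_assoc, ← S.braid i (by omega)]
      simp only [mul_assoc]

theorem fe_comm {d : ℕ} {aa : ℕ → F} {b : A} (h : b * S.x 0 = S.x 0 * b) :
    b * S.fe d aa = S.fe d aa * b := by
  rw [fe, Finset.mul_sum, Finset.sum_mul]
  refine Finset.sum_congr rfl fun i _ => ?_
  rw [mul_smul_comm, smul_mul_assoc, (show Commute b (S.x 0) from h).pow_right i |>.eq]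

theorem tsub_comm {s : Set ℕ} {b : A} (h : ∀ i ∈ s, b * S.t i = S.t i * b) {a : A}
    (ha : a ∈ S.tsub s) : b * a = a * b := by
  induction ha using Algebra.adjoin_induction with
  | mem a ha => obtain ⟨i, hi, rfl⟩ := ha; exact h i hi
  | algebraMap r => exact (Algebra.commutes r b).symm
  | add a a' _ _ h h' => rw [mul_add, h, h', add_mul]
  | mul a a' _ _ h h' => rw [← mul_assoc, h, mul_assoc, h', mul_assoc]

/-- Elements intertwining `tu 0 n` back make `fe * tu 0 n` commute with the lower `t i`. -/
theorem comm_lower {d : ℕ} {aa : ℕ → F} {n : ℕ} (hn : n < N) {g : A}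
    (hg : ∀ i, i + 1 < n → g * S.t (i + 1) = S.t i * g) {a : A}
    (ha : a ∈ S.tsub {i | i + 1 < n}) :
    g * (S.fe d aa * S.tu 0 n) * a = a * (g * (S.fe d aa * S.tu 0 n)) := by
  refine S.tsub_comm (fun i hi => ?_) ha
  have hi' : i + 1 < n := hi
  have h := S.t_succ_tu (Nat.zero_le i) hi' hn
  rw [mul_assoc, mul_assoc, ← h, ← mul_assoc (S.fe d aa), ← S.fe_comm
    (S.txo (i + 1) (by omega) 0 (by omega) (by omega) (by omega)), ← mul_assoc, ← mul_assoc, hg i hi']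
  simp only [mul_assoc]

end Sys

section triangular

variable {F : Type} [Field F] {W : Type} [AddCommGroup W] [Module F W]

/-- A family `θ m` of maps into Laurent-type sequences, with extreme coefficients invertible: the
top one for `0 ≤ m`, the bottom one for `m < 0`. -/
structure IsLaurentTriangular (d : ℕ) (θ : ℤ → W →ₗ[F] (ℤ →₀ W)) : Prop where
  supp : ∀ m w a, θ m w a ≠ 0 → m ≤ a ∧ a ≤ m + d
  top : ∀ m, 0 ≤ m → Function.Bijective fun w => θ m w (m + d)
  bot : ∀ m, m < 0 → Function.Bijective fun w => θ m w m

theorem IsLaurentTriangular.eq_zero {d : ℕ} {θ : ℤ → W →ₗ[F] (ℤ →₀ W)}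
    (h : IsLaurentTriangular d θ) {y : ℤ →₀ W} (hy : y ∈ ⨆ m, LinearMap.range (θ m))
    (hs : ∀ a, y a ≠ 0 → 0 ≤ a ∧ a < d) : y = 0 := by
  obtain ⟨v, hv⟩ : ∃ v : ℤ →₀ W, v.sum (fun m w => θ m w) = y := by
    have : (⨆ m, LinearMap.range (θ m)) ≤ LinearMap.range (Finsupp.lsum F θ) := by
      refine iSup_le fun m => ?_
      rintro _ ⟨w, rfl⟩
      exact ⟨Finsupp.single m w, by simp⟩
    exact this hy
  have hval : ∀ a, y a = ∑ m ∈ v.support, θ m (v m) a := by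
    intro a
    rw [← hv, Finsupp.sum, Finsupp.finsetSum_apply]
  have key : ∀ m ∈ v.support, ∀ a, (∀ m' ∈ v.support, m' ≠ m → θ m' (v m') a = 0) →
      y a = θ m (v m) a := by
    intro m hm a hz
    rw [hval, Finset.sum_eq_single_of_mem m hm hz]
  have hempty : v.support = ∅ := by
    by_contra hne
    have hne' := Finset.nonempty_iff_ne_empty.2 hne
    by_cases hpos : 0 ≤ v.support.max' hne'
    · set m := v.support.max' hne' with hm
      have hmem : m ∈ v.support := Finset.max'_mem _ _
      have e := key m hmem (m + d) fun m' hm' hne => by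
        by_contra hc
        have h1 := (h.supp _ _ _ hc).2
        have h2 : m' ≤ m := Finset.le_max' _ _ hm'
        omega
      have h0 : y (m + d) = 0 := by
        by_contra hc
        have := hs _ hc
        omega
      refine (Finsupp.mem_support_iff.1 hmem) ((h.top m hpos).1 ?_)
      simp only [map_zero, Finsupp.coe_zero, Pi.zero_apply]
      rw [← e, h0]
    · set m := v.support.min' hne' with hm
      have hmem : m ∈ v.support := Finset.min'_mem _ _
      have hlt : m < 0 := lt_of_le_of_lt (Finset.min'_le_max' _ _) (not_le.1 hpos)
      have e := key m hmem m fun m' hm' hne => by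
        by_contra hc
        have h1 := (h.supp _ _ _ hc).1
        have h2 : m ≤ m' := Finset.min'_le _ _ hm'
        omega
      have h0 : y m = 0 := by
        by_contra hc
        have := hs _ hc
        omega
      refine (Finsupp.mem_support_iff.1 hmem) ((h.bot m hlt).1 ?_)
      simp only [map_zero, Finsupp.coe_zero, Pi.zero_apply]
      rw [← e, h0]
  rw [← hv, Finsupp.sum, hempty, Finset.sum_empty]

theorem IsLaurentTriangular.sup_eq_top {d : ℕ} {θ : ℤ → W →ₗ[F] (ℤ →₀ W)}
    (h : IsLaurentTriangular d θ) :
    (⨆ m, LinearMap.range (θ m)) ⊔ Finsupp.supported W F (Set.Ico (0 : ℤ) d) = ⊤ := by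
  set Z := (⨆ m, LinearMap.range (θ m)) ⊔ Finsupp.supported W F (Set.Ico (0 : ℤ) d) with hZ
  have hrange : ∀ m w, θ m w ∈ Z := fun m w =>
    Submodule.mem_sup_left (Submodule.mem_iSup_of_mem m ⟨w, rfl⟩)
  have hsplit : ∀ (φ : ℤ →₀ W) (l : ℤ), φ ∈ Z →
      (∀ a ≠ l, φ a ≠ 0 → ∀ w, Finsupp.single a w ∈ Z) → Finsupp.single l (φ l) ∈ Z := by
    intro φ l hφ hr
    have e : Finsupp.single l (φ l) = φ - φ.erase l := by
      rw [eq_sub_iff_add_eq, add_comm, Finsupp.erase_add_single]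
    rw [e]
    refine sub_mem hφ ?_
    rw [← Finsupp.sum_single (φ.erase l)]
    refine Submodule.sum_mem _ fun a ha => ?_
    rw [Finsupp.support_erase, Finset.mem_erase] at ha
    exact hr a ha.1 (Finsupp.mem_support_iff.1 ha.2) _
  have hmid : ∀ a : ℤ, 0 ≤ a → a < d → ∀ w, Finsupp.single a w ∈ Z := fun a h0 h1 w =>
    Submodule.mem_sup_right (Finsupp.single_mem_supported F w ⟨h0, h1⟩)
  have hup : ∀ k : ℕ, ∀ a : ℤ, 0 ≤ a → a < d + k → ∀ w, Finsupp.single a w ∈ Z := by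
    intro k
    induction k with
    | zero => intro a h0 h1; exact hmid a h0 (by simpa using h1)
    | succ k ih =>
      intro a h0 h1 w
      rcases lt_or_eq_of_le (show a ≤ d + k by push_cast at h1; omega) with hlt | rfl
      · exact ih a h0 hlt w
      · obtain ⟨v, hv⟩ := (h.top k (by omega)).2 w
        simp only at hv
        rw [add_comm] at hv
        rw [← hv]
        refine hsplit _ _ (hrange _ _) fun a ha hne => ?_
        have := h.supp _ _ _ hne
        exact ih a (by omega) (by omega)
  have hdown : ∀ k : ℕ, ∀ a : ℤ, -k ≤ a → ∀ w, Finsupp.single a w ∈ Z := by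
    intro k
    induction k with
    | zero => intro a h0; exact hup (a.toNat + 1) a (by omega) (by omega)
    | succ k ih =>
      intro a h0 w
      rcases lt_or_eq_of_le (show -((k : ℤ) + 1) ≤ a by push_cast at h0; omega) with hlt | rfl
      · exact ih a (by omega) w
      · obtain ⟨v, hv⟩ := (h.bot (-((k : ℤ) + 1)) (by omega)).2 w
        simp only at hv
        rw [← hv]
        refine hsplit _ _ (hrange _ _) fun a ha hne => ?_
        have := h.supp _ _ _ hne
        exact ih a (by omega)
  rw [eq_top_iff]
  rintro φ -
  rw [← Finsupp.sum_single φ]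
  exact Submodule.sum_mem _ fun a _ => hdown a.natAbs a (by omega) _

end triangular

section adjoinRight

variable {F : Type} [Field F]

/-- A subspace stable under right multiplication by generators is stable under the algebra. -/
theorem mul_mem_of_adjoin_right {A : Type} [Ring A] [Algebra F A] {s : Set A} {P : Submodule F A}
    (h : ∀ a ∈ s, ∀ p ∈ P, p * a ∈ P) {a : A} (ha : a ∈ Algebra.adjoin F s) {p : A} (hp : p ∈ P) :
    p * a ∈ P := by
  induction ha using Algebra.adjoin_induction generalizing p with
  | mem a ha => exact h a ha p hp
  | algebraMap r => rw [← Algebra.commutes, ← Algebra.smul_def]; exact Submodule.smul_mem _ _ hp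
  | add a b _ _ iha ihb => rw [mul_add]; exact add_mem (iha hp) (ihb hp)
  | mul a b _ _ iha ihb => rw [← mul_assoc]; exact ihb (iha hp)

end adjoinRight

namespace Sys

variable {F : Type} [Field F] {ξ : F} {A : Type} [Ring A] [Algebra F A] {n : ℕ}
  (S : Sys ξ A (n + 1))

/-- Right coset decomposition of the finite Hecke algebra along `tu 0 j`. -/
theorem tall_le_span_tu_zero {a : A} (ha : a ∈ S.tall) :
    a ∈ Submodule.span F {x | ∃ s ∈ S.tsub {i | 0 < i ∧ i < n}, ∃ j ≤ n, x = s * S.tu 0 j} := by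
  rw [← one_mul a]
  refine mul_mem_of_adjoin_right ?_ ha
    (Submodule.subset_span ⟨1, one_mem _, 0, Nat.zero_le n, by rw [S.tu_of_le le_rfl, one_mul]⟩)
  rintro _ ⟨i, hi, rfl⟩ p hp
  replace hi : i + 1 < n + 1 := hi
  induction hp using Submodule.span_induction with
  | mem x hx =>
    obtain ⟨s, hs, j, hj, rfl⟩ := hx
    rw [mul_assoc]
    rcases lt_trichotomy i j with h | rfl | h
    · rcases Nat.lt_or_ge (i + 1) j with h' | h'
      · rw [← S.t_succ_tu (Nat.zero_le i) h' (by omega), ← mul_assoc]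
        exact Submodule.subset_span ⟨_, mul_mem hs (S.t_mem_tsub ⟨by omega, by omega⟩), j, hj, rfl⟩
      · obtain rfl : j = i + 1 := by omega
        rw [S.tu_succ (Nat.zero_le i), mul_assoc (S.tu 0 i), S.tt i hi, mul_add, mul_one,
          mul_smul_comm, mul_add, mul_smul_comm, ← S.tu_succ (Nat.zero_le i)]
        exact add_mem (Submodule.smul_mem _ _ (Submodule.subset_span ⟨s, hs, _, hj, rfl⟩))
          (Submodule.subset_span ⟨s, hs, _, by omega, rfl⟩)
    · rw [← S.tu_succ (Nat.zero_le i)]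
      exact Submodule.subset_span ⟨s, hs, _, by omega, rfl⟩
    · rw [← S.tu_comm fun l _ hl => (S.far l i (by omega) hi).symm, ← mul_assoc]
      exact Submodule.subset_span ⟨_, mul_mem hs (S.t_mem_tsub ⟨by omega, by omega⟩), j, hj, rfl⟩
  | zero => rw [zero_mul]; exact zero_mem _
  | add x y _ _ hx hy => rw [add_mul]; exact add_mem hx hy
  | smul r x _ hx => rw [smul_mul_assoc]; exact Submodule.smul_mem _ _ hx

/-- Left coset decomposition of the finite Hecke algebra along `tu j n`. -/
theorem tall_le_span_tu {a : A} (ha : a ∈ S.tall) :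
    a ∈ Submodule.span F {x | ∃ j ≤ n, ∃ s ∈ S.tsub {i | i + 1 < n}, x = S.tu j n * s} := by
  rw [← mul_one a]
  refine mul_mem_of_adjoin ?_ ha
    (Submodule.subset_span ⟨n, le_rfl, 1, one_mem _, by rw [S.tu_of_le le_rfl, one_mul]⟩)
  rintro _ ⟨i, hi, rfl⟩ p hp
  replace hi : i + 1 < n + 1 := hi
  induction hp using Submodule.span_induction with
  | mem x hx =>
    obtain ⟨j, hj, s, hs, rfl⟩ := hx
    rw [← mul_assoc]
    rcases lt_trichotomy i j with h | rfl | h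
    · rcases Nat.lt_or_ge (i + 1) j with h' | h'
      · rw [S.t_tu_lt h' (by omega), mul_assoc]
        exact Submodule.subset_span ⟨j, hj, _, mul_mem (S.t_mem_tsub (by simp; omega)) hs, rfl⟩
      · obtain rfl : j = i + 1 := by omega
        rw [← S.tu_left (by omega)]
        exact Submodule.subset_span ⟨i, by omega, s, hs, rfl⟩
    · rw [S.tu_left (by omega), ← mul_assoc, S.tt i hi, add_mul, one_mul, smul_mul_assoc,
        ← S.tu_left (by omega), add_mul, smul_mul_assoc]
      exact add_mem (Submodule.smul_mem _ _ (Submodule.subset_span ⟨_, hj, s, hs, rfl⟩))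
          (Submodule.subset_span ⟨_, by omega, s, hs, rfl⟩)
    · obtain ⟨i, rfl⟩ : ∃ k, i = k + 1 := ⟨i - 1, by omega⟩
      rw [S.t_succ_tu (by omega) (by omega) (by omega), mul_assoc]
      exact Submodule.subset_span ⟨j, hj, _, mul_mem (S.t_mem_tsub (by simp; omega)) hs, rfl⟩
  | zero => rw [mul_zero]; exact zero_mem _
  | add x y _ _ hx hy => rw [mul_add]; exact add_mem hx hy
  | smul r x _ hx => rw [mul_smul_comm]; exact Submodule.smul_mem _ _ hx

end Sys

section structureLemmas

variable {F : Type} [Field F] {q : F} {n : ℕ}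

/-- Every element is a combination of products of a Hecke element and a Clifford–Laurent one. -/
theorem tall_mul_alg (x : H F q (n + 1)) :
    x ∈ Submodule.span F {x | ∃ s ∈ (hsys F q (n + 1)).tall, ∃ u ∈ (hsys F q (n + 1)).alg,
      x = s * u} := by
  set S := hsys F q (n + 1) with hS
  rw [← one_mul x]
  refine mul_mem_of_adjoin_right (s := gens F q (n + 1)) ?_
    (by rw [adjoin_gens]; exact Algebra.mem_top)
    (Submodule.subset_span ⟨1, one_mem _, 1, one_mem _, (mul_one _).symm⟩)
  have hA : ∀ a ∈ S.alg, ∀ p ∈ Submodule.span F {x | ∃ s ∈ S.tall, ∃ u ∈ S.alg, x = s * u},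
      p * a ∈ Submodule.span F {x | ∃ s ∈ S.tall, ∃ u ∈ S.alg, x = s * u} := by
    intro a ha p hp
    induction hp using Submodule.span_induction with
    | mem x hx =>
      obtain ⟨s, hs, u, hu, rfl⟩ := hx
      rw [mul_assoc]
      exact Submodule.subset_span ⟨s, hs, _, mul_mem hu ha, rfl⟩
    | zero => rw [zero_mul]; exact zero_mem _
    | add x y _ _ hx hy => rw [add_mul]; exact add_mem hx hy
    | smul r x _ hx => rw [smul_mul_assoc]; exact Submodule.smul_mem _ _ hx
  rintro a (⟨i, hi, rfl⟩ | ⟨i, hi, rfl⟩ | ⟨i, hi, rfl⟩ | ⟨i, hi, rfl⟩) p hp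
  · exact hA _ (S.x_mem hi) p hp
  · exact hA _ (S.y_mem hi) p hp
  · exact hA _ (S.c_mem hi) p hp
  · induction hp using Submodule.span_induction with
    | mem x hx =>
      obtain ⟨s, hs, u, hu, rfl⟩ := hx
      obtain ⟨u', hu', v, hv, e⟩ := S.alg_t hi hu
      rw [mul_assoc, e, mul_add, ← mul_assoc]
      exact add_mem (Submodule.subset_span ⟨_, mul_mem hs (S.t_mem_tsub hi), _, hu', rfl⟩)
        (Submodule.subset_span ⟨s, hs, v, hv, rfl⟩)
    | zero => rw [zero_mul]; exact zero_mem _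
    | add x y _ _ hx hy => rw [add_mul]; exact add_mem hx hy
    | smul r x _ hx => rw [smul_mul_assoc]; exact Submodule.smul_mem _ _ hx

theorem low_le_range {a : H F q (n + 1)} (ha : a ∈ (hsys F q (n + 1)).low n) :
    ∃ h, a = emb F q n h := by
  suffices (hsys F q (n + 1)).low n ≤ (emb F q n).range by
    obtain ⟨h, hh⟩ := this ha
    exact ⟨h, hh.symm⟩
  rw [Sys.low, Algebra.adjoin_le_iff]
  rintro a (⟨i, hi, rfl⟩ | ⟨i, hi, rfl⟩ | ⟨i, hi, rfl⟩ | ⟨i, hi, rfl⟩)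
  · exact ⟨_, emb_x hi⟩
  · exact ⟨_, emb_y hi⟩
  · exact ⟨_, emb_c hi⟩
  · exact ⟨_, emb_t hi⟩

theorem tsub_le_range {a : H F q (n + 1)} (ha : a ∈ (hsys F q (n + 1)).tsub {i | i + 1 < n}) :
    ∃ h, a = emb F q n h := by
  suffices (hsys F q (n + 1)).tsub {i | i + 1 < n} ≤ (emb F q n).range by
    obtain ⟨h, hh⟩ := this ha
    exact ⟨h, hh.symm⟩
  rw [Sys.tsub, Algebra.adjoin_le_iff]
  rintro _ ⟨i, hi, rfl⟩
  exact ⟨_, emb_t hi⟩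

/-- The subspace `D0 n` is spanned by the `tu j n * h` with `h` in the smaller algebra. -/
theorem D0_le_span {a : H F q (n + 1)} (ha : a ∈ (hsys F q (n + 1)).D0 n) :
    a ∈ Submodule.span F {x | ∃ j ≤ n, ∃ h, x = (hsys F q (n + 1)).tu j n * emb F q n h} := by
  refine Submodule.mul_induction_on ha (fun s hs u hu => ?_) fun x y hx hy => add_mem hx hy
  obtain ⟨h, rfl⟩ := low_le_range hu
  have hs' := (hsys F q (n + 1)).tall_le_span_tu hs
  clear hs
  induction hs' using Submodule.span_induction with
  | mem x hx =>
    obtain ⟨j, hj, s, hs, rfl⟩ := hx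
    obtain ⟨g, rfl⟩ := tsub_le_range hs
    rw [mul_assoc, ← map_mul]
    exact Submodule.subset_span ⟨j, hj, _, rfl⟩
  | zero => rw [zero_mul]; exact zero_mem _
  | add x y _ _ hx hy => rw [add_mul]; exact add_mem hx hy
  | smul r x _ hx => rw [smul_mul_assoc]; exact Submodule.smul_mem _ _ hx

end structureLemmas

section cyclotomic

variable {F : Type} [Field F] {q : F} {n d : ℕ} {aa : ℕ → F}

theorem cyc_felem : cyc F q n d aa (felem F q n d aa) = 0 := by
  rw [cyc, RingQuot.mkAlgHom_rel F (CycRel.rel (F := F) (q := q) (n := n) (d := d) (aa := aa)),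
    map_zero]

theorem cyc_surjective : Function.Surjective (cyc F q n d aa) :=
  RingQuot.mkAlgHom_surjective F _

/-- The kernel of the quotient map is spanned by the products `a * f * b`. -/
theorem ker_cyc {x : H F q n} (hx : cyc F q n d aa x = 0) :
    x ∈ Submodule.span F {y | ∃ a b, y = a * felem F q n d aa * b} := by
  set K := Submodule.span F {y | ∃ a b, y = a * felem F q n d aa * b} with hK
  have hleft : ∀ {u v : H F q n}, v ∈ K → u * v ∈ K := by
    intro u v hv
    induction hv using Submodule.span_induction with
    | mem x hx =>
      obtain ⟨a, b, rfl⟩ := hx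
      exact Submodule.subset_span ⟨u * a, b, by simp only [mul_assoc]⟩
    | zero => rw [mul_zero]; exact zero_mem _
    | add x y _ _ hx hy => rw [mul_add]; exact add_mem hx hy
    | smul r x _ hx => rw [mul_smul_comm]; exact Submodule.smul_mem _ _ hx
  have hright : ∀ {u v : H F q n}, u ∈ K → u * v ∈ K := by
    intro u v hv
    induction hv using Submodule.span_induction with
    | mem x hx =>
      obtain ⟨a, b, rfl⟩ := hx
      exact Submodule.subset_span ⟨a, b * v, by simp only [mul_assoc]⟩
    | zero => rw [zero_mul]; exact zero_mem _
    | add x y _ _ hx hy => rw [add_mul]; exact add_mem hx hy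
    | smul r x _ hx => rw [smul_mul_assoc]; exact Submodule.smul_mem _ _ hx
  let I : TwoSidedIdeal (H F q n) := TwoSidedIdeal.mk' (K : Set (H F q n)) (zero_mem K)
    (fun h h' => add_mem h h') (fun h => neg_mem h) hleft hright
  have hI : ∀ y, y ∈ I ↔ y ∈ K := fun y => TwoSidedIdeal.mem_mk' _ _ _ _ _ _ _
  have hrel : ∀ ⦃a b : H F q n⦄, CycRel F q n d aa a b → I.ringCon.mk' a = I.ringCon.mk' b := by
    rintro _ _ ⟨⟩
    refine (RingCon.eq _).2 ?_
    rw [TwoSidedIdeal.rel_iff, sub_zero, hI]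
    exact Submodule.subset_span ⟨1, 1, by simp⟩
  have h1 : RingQuot.mkRingHom (CycRel F q n d aa) x = 0 := by
    rw [← hx, cyc, ← RingQuot.mkAlgHom_coe F]
    rfl
  have h2 := congrArg (RingQuot.lift ⟨I.ringCon.mk', hrel⟩) h1
  rw [RingQuot.lift_mkRingHom_apply, map_zero, ← map_zero I.ringCon.mk'] at h2
  have h3 := (RingCon.eq _).1 h2
  rw [TwoSidedIdeal.rel_iff, sub_zero, hI] at h3
  exact h3

theorem felem_eq (hn : 0 < n) : felem F q n d aa = (hsys F q n).fe d aa := by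
  rw [felem, dif_pos hn, Sys.fe]
  exact Finset.sum_congr rfl fun i _ => by rw [← hsys_x]

theorem gr_fe (hn : 0 < n) : gr F q n ((hsys F q n).fe d aa) = (hsys F q n).fe d aa := by
  rw [Sys.fe, map_sum]
  exact Finset.sum_congr rfl fun i _ => by rw [map_smul, map_pow, gr_x hn]

theorem emb_fe (hn : 0 < n) :
    emb F q n ((hsys F q n).fe d aa) = (hsys F q (n + 1)).fe d aa := by
  rw [Sys.fe, map_sum, Sys.fe]
  exact Finset.sum_congr rfl fun i _ => by rw [map_smul, map_pow, emb_x hn]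

/-- `p` presents `R` as the quotient of `H F q n` by the ideal generated by `f`. -/
structure IsCycQuot (d : ℕ) (aa : ℕ → F) {R : Type} [Ring R] [Algebra F R]
    (p : H F q n →ₐ[F] R) : Prop where
  surj : Function.Surjective p
  felem : p (felem F q n d aa) = 0
  ker : ∀ x, p x = 0 → x ∈ Submodule.span F {y | ∃ a b, y = a * HC.felem F q n d aa * b}

theorem isCycQuot_cyc : IsCycQuot d aa (R := Hf F q n d aa) (cyc F q n d aa) where
  surj := cyc_surjective
  felem := cyc_felem
  ker _ hx := ker_cyc hx

section quot

variable {R : Type} [Ring R] [Algebra F R] {p : H F q n →ₐ[F] R}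

theorem IsCycQuot.fe (hp : IsCycQuot d aa p) (hn : 0 < n) : p ((hsys F q n).fe d aa) = 0 := by
  rw [← felem_eq hn, hp.felem]

theorem IsCycQuot.gr (hp : IsCycQuot d aa p) {h : H F q n} (hh : p h = 0) : p (gr F q n h) = 0 := by
  have := hp.ker h hh
  clear hh
  induction this using Submodule.span_induction with
  | mem x hx =>
    obtain ⟨a, b, rfl⟩ := hx
    rcases Nat.eq_zero_or_pos n with rfl | hn
    · simp [HC.felem]
    · rw [felem_eq hn, map_mul (HC.gr F q n), map_mul (HC.gr F q n), gr_fe hn, map_mul, map_mul,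
        hp.fe hn, mul_zero, zero_mul]
  | zero => simp
  | add x y _ _ hx hy => rw [map_add, map_add, hx, hy, add_zero]
  | smul r x _ hx => rw [map_smul, map_smul, hx, smul_zero]

theorem IsCycQuot.grp (hp : IsCycQuot d aa p) {h : H F q n} (b : Bool) (hh : p h = 0) : p (grp F q n b h) = 0 := by
  cases b
  · exact hh
  · exact hp.gr hh

end quot

/-- The embedding of cyclotomic quotients is induced by that of the affine algebras. -/
theorem IsCycEmb.apply_cyc {en : Hf F q n d aa →ₐ[F] Hf F q (n + 1) d aa}
    (h : IsCycEmb F q n (n + 1) d aa 0 en) (a : H F q n) :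
    en (cyc F q n d aa a) = cyc F q (n + 1) d aa (emb F q n a) := by
  suffices en.comp (cyc F q n d aa) = (cyc F q (n + 1) d aa).comp (emb F q n) from
    DFunLike.congr_fun this a
  obtain ⟨h1, h2, h3, h4⟩ := h
  refine hom_ext (A := Hf F q (n + 1) d aa) ?_ ?_ ?_ ?_ <;> intro i hi
  · rw [AlgHom.comp_apply, AlgHom.comp_apply, emb_x hi]
    rw [hsys_x ⟨i, hi⟩, hsys_x ⟨i, by omega⟩]
    exact h1 ⟨i, hi⟩ ⟨i, by omega⟩ (by simp)
  · rw [AlgHom.comp_apply, AlgHom.comp_apply, emb_y hi]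
    rw [hsys_y ⟨i, hi⟩, hsys_y ⟨i, by omega⟩]
    exact h2 ⟨i, hi⟩ ⟨i, by omega⟩ (by simp)
  · rw [AlgHom.comp_apply, AlgHom.comp_apply, emb_c hi]
    rw [hsys_c ⟨i, hi⟩, hsys_c ⟨i, by omega⟩]
    exact h3 ⟨i, hi⟩ ⟨i, by omega⟩ (by simp)
  · rw [AlgHom.comp_apply, AlgHom.comp_apply, emb_t hi]
    rw [hsys_t ⟨i, by omega⟩, hsys_t ⟨i, by omega⟩]
    exact h4 ⟨i, by omega⟩ ⟨i, by omega⟩ (by simp)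

theorem IsCycGrading.apply_cyc {δ : Hf F q n d aa →ₐ[F] Hf F q n d aa}
    (h : IsCycGrading F q n d aa δ) (a : H F q n) :
    δ (cyc F q n d aa a) = cyc F q n d aa (gr F q n a) := by
  suffices δ.comp (cyc F q n d aa) = (cyc F q n d aa).comp (gr F q n) from
    DFunLike.congr_fun this a
  obtain ⟨h1, h2, h3, h4⟩ := h
  refine hom_ext (A := Hf F q n d aa) ?_ ?_ ?_ ?_ <;> intro i hi
  · rw [AlgHom.comp_apply, AlgHom.comp_apply, gr_x hi, hsys_x ⟨i, hi⟩]
    exact h1 ⟨i, hi⟩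
  · rw [AlgHom.comp_apply, AlgHom.comp_apply, gr_y hi, hsys_y ⟨i, hi⟩]
    exact h2 ⟨i, hi⟩
  · rw [AlgHom.comp_apply, AlgHom.comp_apply, gr_c hi, hsys_c ⟨i, hi⟩, map_neg]
    exact h3 ⟨i, hi⟩
  · rw [AlgHom.comp_apply, AlgHom.comp_apply, gr_t hi, hsys_t ⟨i, by omega⟩]
    exact h4 ⟨i, by omega⟩

end cyclotomic

namespace Sys

variable {F : Type} [Field F] {ξ : F} {A : Type} [Ring A] [Algebra F A] {N : ℕ} (S : Sys ξ A N)

theorem tall_mul_V {m : ℕ} {s : Set ℤ} {a x : A} (ha : a ∈ S.tall) (hx : x ∈ S.V m s) :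
    a * x ∈ S.V m s := by
  induction hx using Submodule.span_induction with
  | mem x hx =>
    obtain ⟨p, hp, k, hk, rfl⟩ := hx
    rw [← mul_assoc]
    exact S.mem_V (S.tall_mul_D ha hp) hk
  | zero => rw [mul_zero]; exact zero_mem _
  | add x y _ _ hx hy => rw [mul_add]; exact add_mem hx hy
  | smul r x _ hx => rw [mul_smul_comm]; exact Submodule.smul_mem _ _ hx

theorem V_mul_cp_xp {m : ℕ} (hm : m < N) {s s' : Set ℤ} (b : Bool) (k : ℤ)
    (h : ∀ a ∈ s, sg b a + k ∈ s') {x : A} (hx : x ∈ S.V m s) :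
    x * S.cp m b * S.xp m k ∈ S.V m s' := by
  induction hx using Submodule.span_induction with
  | mem x hx =>
    obtain ⟨p, hp, a, ha, rfl⟩ := hx
    rw [mul_assoc p, S.xp_cp hm, ← mul_assoc, mul_assoc (p * _), ← S.xp_add]
    refine S.mem_V ?_ (h a ha)
    cases b
    · rwa [cp_false, mul_one]
    · exact S.D_mul_c hm hp
  | zero => rw [zero_mul, zero_mul]; exact zero_mem _
  | add x y _ _ hx hy => rw [add_mul, add_mul]; exact add_mem hx hy
  | smul r x _ hx => rw [smul_mul_assoc, smul_mul_assoc]; exact Submodule.smul_mem _ _ hx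

theorem vi_fe_tu {d : ℕ} (hd : 1 ≤ d) {aa : ℕ → F} (had : aa d = 1) {m : ℕ} (hm : m < N) :
    ∃ p ∈ S.D0 m, S.vi m * (S.fe d aa * S.tu 0 m) - (1 + p * S.c m) * S.xp m d ∈
      S.V m (Set.Icc 0 (d - 1 : ℕ)) := by
  obtain ⟨p, hp, h⟩ := S.fe_tu_top hd had hm
  refine ⟨_, S.tall_mul_D0 (S.vi_mem hm) hp, ?_⟩
  have := S.tall_mul_V (S.vi_mem hm) h
  rwa [mul_sub, ← mul_assoc (S.vi m) (_ + _), mul_add, S.vi_ui hm, ← mul_assoc (S.vi m) p] at this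

theorem wi_fe_tu {d : ℕ} {aa : ℕ → F} {m : ℕ} (hm : m < N) :
    S.wi m * (S.fe d aa * S.tu 0 m) - aa 0 • 1 ∈ S.V m (Set.Icc 1 d) := by
  have := S.tall_mul_V (S.wi_mem hm) (S.fe_tu_bottom (d := d) (aa := aa) hm)
  rwa [mul_sub, mul_smul_comm, S.wi_tu hm] at this

/-- The sign component that carries the leading coefficient. -/
def lside (m : ℤ) : Bool := decide (m < 0)

/-- The degree of the leading coefficient. -/
def ldeg (d : ℕ) (m : ℤ) : ℤ := if m < 0 then m else m + d

/-- The unit used to normalise `f * tu 0 n` before extracting leading coefficients. -/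
def lunit (n : ℕ) (m : ℤ) (b : Bool) : A := if b = lside m then S.vi n else S.wi n

/-- Right multiples of `fe * tu 0 n` with controlled leading coefficients. -/
def lel (n d : ℕ) (aa : ℕ → F) (m : ℤ) (b : Bool) (j : ℕ) : A :=
  S.tu j n * (S.lunit n m b * (S.fe d aa * S.tu 0 n)) * S.cp n b *
    S.xp n (m + (if b then d else 0 : ℕ))

theorem lel_lside {n d : ℕ} (hd : 1 ≤ d) {aa : ℕ → F} (had : aa d = 1) (hn : n < N) (m : ℤ)
    (j : ℕ) : ∃ p ∈ S.D0 n, S.lel n d aa m (lside m) j -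
      (S.tu j n * S.cp n (lside m) * S.xp n (ldeg d m) +
        p * S.cp n (!lside m) * S.xp n (ldeg d m)) ∈ S.V n (Set.Icc m (m + d) \ {ldeg d m}) := by
  obtain ⟨p, hp, h⟩ := S.vi_fe_tu hd had hn
  refine ⟨_, S.tall_mul_D0 (S.tu_mem (j := j) hn) hp, ?_⟩
  have h1 := S.V_mul_cp_xp hn (s' := Set.Icc m (m + d) \ {ldeg d m}) (lside m)
    (m + if lside m then d else 0) (fun a ha => by
      have h1 := ha.1
      have h2 := ha.2
      simp only [lside, ldeg, sg, decide_eq_true_eq, Set.mem_sdiff, Set.mem_Icc,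
        Set.mem_singleton_iff]
      split_ifs <;> omega) (S.tall_mul_V (S.tu_mem (j := j) hn) h)
  have hdeg : sg (lside m) d + (m + (if lside m then d else 0 : ℕ)) = ldeg d m := by
    simp only [lside, ldeg, sg, decide_eq_true_eq]
    split_ifs <;> omega
  rw [mul_sub, sub_mul, sub_mul, mul_assoc (S.tu j n) (_ * S.xp n _) (S.cp _ _),
    mul_assoc _ (S.xp n d) (S.cp _ _), S.xp_cp hn, mul_assoc (S.tu j n) _ (S.xp _ _),
    mul_assoc (1 + _) _ (S.xp n _), mul_assoc (S.cp n _) (S.xp n _) (S.xp n _), ← S.xp_add,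
    hdeg, add_mul, one_mul, mul_assoc p, ← mul_assoc (S.c n), S.c_cp hn, mul_add] at h1
  rw [lel, lunit, if_pos rfl]
  simpa only [mul_assoc] using h1

theorem lel_not_lside {n d : ℕ} {aa : ℕ → F} (hn : n < N) (m : ℤ)
    (j : ℕ) : S.lel n d aa m (!lside m) j -
      aa 0 • (S.tu j n * S.cp n (!lside m) * S.xp n (ldeg d m)) ∈
        S.V n (Set.Icc m (m + d) \ {ldeg d m}) := by
  have h1 := S.V_mul_cp_xp hn (s' := Set.Icc m (m + d) \ {ldeg d m}) (!lside m)
    (m + if !lside m then d else 0) (fun a ha => by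
      have h1 := ha.1
      have h2 := ha.2
      simp only [lside, ldeg, sg, Set.mem_sdiff, Set.mem_Icc,
        Set.mem_singleton_iff, Bool.not_eq_true', decide_eq_false_iff_not, not_lt]
      split_ifs <;> omega)
    (S.tall_mul_V (S.tu_mem (j := j) hn) (S.wi_fe_tu (d := d) (aa := aa) hn))
  have hdeg : m + ((if !lside m then d else 0 : ℕ) : ℤ) = ldeg d m := by
    simp only [lside, ldeg, Bool.not_eq_true', decide_eq_false_iff_not, not_lt]
    split_ifs <;> omega
  rw [mul_sub, sub_mul, sub_mul, mul_smul_comm, mul_one, smul_mul_assoc, smul_mul_assoc] at h1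
  rw [lel, lunit, if_neg (by simp)]
  rwa [hdeg] at h1 ⊢

end Sys

section free

variable {F : Type} [Field F] {q : F} {n d : ℕ} {aa : ℕ → F} {R : Type} [Ring R] [Algebra F R]
  {p : H F q n →ₐ[F] R}

/-- `π` computes coefficients with respect to the elements `gb a b j`, reduced along `p`. -/
def IsCoeff (p : H F q n →ₐ[F] R)
    (π : H F q (n + 1) →ₗ[F] (ℤ →₀ (Bool × Fin (n + 1) → R))) : Prop :=
  ∀ a b (j : Fin (n + 1)) h,
    π (gb F q n a b j * emb F q n h) = Finsupp.single a (Pi.single (b, j) (p h))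

theorem exists_isCoeff (p : H F q n →ₐ[F] R) : ∃ π, IsCoeff p π := by
  obtain ⟨κ, hκ⟩ := exists_coeff F q n
  refine ⟨(Finsupp.mapRange.linearMap (p.toLinearMap.compLeft (Bool × Fin (n + 1)))).comp κ,
    fun a b j h => ?_⟩
  rw [LinearMap.comp_apply, hκ, Finsupp.mapRange.linearMap_apply, Finsupp.mapRange_single]
  congr 1
  ext i
  rw [LinearMap.compLeft_apply, Function.comp_apply]
  by_cases hi : i = (b, j)
  · subst hi; simp
  · simp [Pi.single_eq_of_ne hi]

variable {π : H F q (n + 1) →ₗ[F] (ℤ →₀ (Bool × Fin (n + 1) → R))}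

theorem IsCoeff.mul_emb (hπ : IsCoeff p π) (x : H F q (n + 1)) (h : H F q n) (a : ℤ)
    (i : Bool × Fin (n + 1)) : π (x * emb F q n h) a i = π x a i * p h := by
  have hx : x ∈ gspan F q n := by rw [gspan_eq_top]; exact Submodule.mem_top
  induction hx using Submodule.span_induction with
  | mem x hx =>
    obtain ⟨a', b, j, hj, g, rfl⟩ := hx
    have e1 := hπ a' b ⟨j, by omega⟩ g
    have e2 := hπ a' b ⟨j, by omega⟩ (g * h)
    simp only at e1 e2
    rw [mul_assoc, ← map_mul, e1, e2, map_mul]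
    by_cases ha : a' = a
    · subst ha
      rw [Finsupp.single_eq_same, Finsupp.single_eq_same]
      by_cases hi : i = (b, ⟨j, by omega⟩)
      · subst hi; simp
      · rw [Pi.single_eq_of_ne hi, Pi.single_eq_of_ne hi, zero_mul]
    · simp [ha]
  | zero => simp
  | add x y _ _ hx hy => simp only [add_mul, map_add, Finsupp.add_apply, Pi.add_apply, hx, hy]
  | smul r x _ hx =>
    simp only [smul_mul_assoc, map_smul, Finsupp.smul_apply, Pi.smul_apply, hx]

theorem IsCoeff.mul_emb_eq_zero (hπ : IsCoeff p π) (x : H F q (n + 1)) {h : H F q n}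
    (hh : p h = 0) : π (x * emb F q n h) = 0 := by
  ext a i
  rw [hπ.mul_emb, hh, mul_zero, Finsupp.zero_apply, Pi.zero_apply]

theorem IsCoeff.mul_emb_congr (hπ : IsCoeff p π) (x : H F q (n + 1)) {h h' : H F q n}
    (hh : p h = p h') : π (x * emb F q n h) = π (x * emb F q n h') := by
  ext a i
  rw [hπ.mul_emb, hh, hπ.mul_emb]

theorem IsCoeff.D0_apply (hπ : IsCoeff p π) {x : H F q (n + 1)} (hx : x ∈ (hsys F q (n + 1)).D0 n)
    (b : Bool) (k a : ℤ) (i : Bool × Fin (n + 1)) (hi : ¬(a = k ∧ i.1 = b)) :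
    π (x * (hsys F q (n + 1)).cp n b * (hsys F q (n + 1)).xp n k) a i = 0 := by
  have := D0_le_span hx
  clear hx
  induction this using Submodule.span_induction with
  | mem x hx =>
    obtain ⟨j, hj, h, rfl⟩ := hx
    have e := hπ k b ⟨j, by omega⟩ (grp F q n b h)
    simp only [gb] at e
    rw [mul_assoc (Sys.tu _ _ _) (emb F q n h), emb_cp, ← mul_assoc, mul_assoc, emb_xp,
      ← mul_assoc, e]
    by_cases ha : k = a
    · subst ha
      rw [Finsupp.single_eq_same, Pi.single_eq_of_ne]
      rintro rfl
      exact hi ⟨rfl, rfl⟩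
    · simp [ha]
  | zero => simp
  | add x y _ _ hx hy => simp only [add_mul, map_add, Finsupp.add_apply, Pi.add_apply, hx, hy,
      add_zero]
  | smul r x _ hx => simp only [smul_mul_assoc, map_smul, Finsupp.smul_apply, Pi.smul_apply, hx,
      smul_zero]

theorem IsCoeff.V_apply (hπ : IsCoeff p π) {s : Set ℤ} {x : H F q (n + 1)}
    (hx : x ∈ (hsys F q (n + 1)).V n s) {a : ℤ} (ha : a ∉ s) : π x a = 0 := by
  induction hx using Submodule.span_induction with
  | mem x hx =>
    obtain ⟨z, hz, k, hk, rfl⟩ := hx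
    obtain ⟨y, hy, y', hy', rfl⟩ := (Sys.mem_D _).1 hz
    have hne : a ≠ k := fun h => ha (h ▸ hk)
    ext i
    have e1 := hπ.D0_apply hy false k a i fun h => hne h.1
    have e2 := hπ.D0_apply hy' true k a i fun h => hne h.1
    rw [Sys.cp_false, mul_one] at e1
    rw [Sys.cp_true] at e2
    rw [add_mul, map_add, Finsupp.add_apply, Pi.add_apply, e1, e2, add_zero, Pi.zero_apply]
  | zero => simp
  | add x y _ _ hx hy => rw [map_add, Finsupp.add_apply, hx, hy, add_zero]
  | smul r x _ hx => rw [map_smul, Finsupp.smul_apply, hx, smul_zero]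

theorem IsCoeff.tu_cp_xp (hπ : IsCoeff p π) (b : Bool) (k : ℤ) (j : Fin (n + 1)) :
    π ((hsys F q (n + 1)).tu j n * (hsys F q (n + 1)).cp n b * (hsys F q (n + 1)).xp n k) =
      Finsupp.single k (Pi.single (b, j) 1) := by
  have := hπ k b j 1
  rwa [map_one, map_one, mul_one, gb] at this

theorem IsCoeff.lel_lside (hπ : IsCoeff p π) (hd : 1 ≤ d) (had : aa d = 1) (m : ℤ)
    (j j' : Fin (n + 1)) :
    π ((hsys F q (n + 1)).lel n d aa m (Sys.lside m) j) (Sys.ldeg d m) (Sys.lside m, j') =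
      if j' = j then 1 else 0 := by
  obtain ⟨y, hy, h⟩ := (hsys F q (n + 1)).lel_lside hd had (show n < n + 1 by omega) m j
  have e1 := hπ.V_apply h (a := Sys.ldeg d m) (by simp)
  have e2 := hπ.D0_apply hy (!Sys.lside m) (Sys.ldeg d m) (Sys.ldeg d m) (Sys.lside m, j')
    (by simp)
  rw [map_sub, map_add, hπ.tu_cp_xp, Finsupp.sub_apply, sub_eq_zero] at e1
  rw [e1, Finsupp.add_apply, Pi.add_apply, e2, add_zero, Finsupp.single_eq_same, Pi.single_apply]
  simp

theorem IsCoeff.lel_not_lside (hπ : IsCoeff p π) (m : ℤ) (j : Fin (n + 1)) :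
    π ((hsys F q (n + 1)).lel n d aa m (!Sys.lside m) j) (Sys.ldeg d m) =
      Pi.single (!Sys.lside m, j) (aa 0 • 1) := by
  have h := (hsys F q (n + 1)).lel_not_lside (d := d) (aa := aa) (show n < n + 1 by omega) m j
  have e1 := hπ.V_apply h (a := Sys.ldeg d m) (by simp)
  rw [map_sub, map_smul, hπ.tu_cp_xp, Finsupp.sub_apply, sub_eq_zero] at e1
  rw [e1, Finsupp.smul_apply, Finsupp.single_eq_same, Pi.single_smul]

theorem IsCoeff.lel_supp (hπ : IsCoeff p π) (hd : 1 ≤ d) (had : aa d = 1) (m : ℤ) (b : Bool)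
    (j : Fin (n + 1)) {a : ℤ} (ha : ¬(m ≤ a ∧ a ≤ m + d)) :
    π ((hsys F q (n + 1)).lel n d aa m b j) a = 0 := by
  have hl : a ≠ Sys.ldeg d m := by
    rw [Sys.ldeg]
    split_ifs <;> omega
  have hV : a ∉ Set.Icc m (m + d) \ {Sys.ldeg d m} := fun h => ha h.1
  by_cases hb : b = Sys.lside m
  · subst hb
    obtain ⟨y, hy, h⟩ := (hsys F q (n + 1)).lel_lside hd had (show n < n + 1 by omega) m j
    have e1 := hπ.V_apply h hV
    rw [map_sub, map_add, hπ.tu_cp_xp, Finsupp.sub_apply, sub_eq_zero] at e1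
    rw [e1, Finsupp.add_apply, Finsupp.single_eq_of_ne hl, zero_add]
    ext i
    exact hπ.D0_apply hy _ _ _ i fun h => hl h.1
  · obtain rfl : b = !Sys.lside m := by
      cases b <;> cases h : Sys.lside m <;> simp_all
    have h := (hsys F q (n + 1)).lel_not_lside (d := d) (aa := aa) (show n < n + 1 by omega) m j
    have e1 := hπ.V_apply h hV
    rw [map_sub, map_smul, hπ.tu_cp_xp, Finsupp.sub_apply, sub_eq_zero] at e1
    rw [e1, Finsupp.smul_apply, Finsupp.single_eq_of_ne hl, smul_zero]

/-- The map assembling the multiples `lel m b j * h`. -/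
noncomputable def theta (d : ℕ) (aa : ℕ → F)
    (π : H F q (n + 1) →ₗ[F] (ℤ →₀ (Bool × Fin (n + 1) → R))) (σ : R →ₗ[F] H F q n) (m : ℤ) :
    (Bool × Fin (n + 1) → R) →ₗ[F] (ℤ →₀ (Bool × Fin (n + 1) → R)) :=
  ∑ i, π.comp ((LinearMap.mulLeft F ((hsys F q (n + 1)).lel n d aa m i.1 i.2)).comp
    ((emb F q n).toLinearMap.comp (σ.comp (LinearMap.proj i))))

theorem theta_eq (σ : R →ₗ[F] H F q n) (m : ℤ) (w : Bool × Fin (n + 1) → R) :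
    theta d aa π σ m w = ∑ i : Bool × Fin (n + 1),
      π ((hsys F q (n + 1)).lel n d aa m i.1 i.2 * emb F q n (σ (w i))) := by
  simp [theta]

theorem theta_apply (hπ : IsCoeff p π) {σ : R →ₗ[F] H F q n} (hσ : ∀ r, p (σ r) = r) (m : ℤ)
    (w : Bool × Fin (n + 1) → R) (a : ℤ) (k : Bool × Fin (n + 1)) :
    theta d aa π σ m w a k = ∑ i : Bool × Fin (n + 1),
      π ((hsys F q (n + 1)).lel n d aa m i.1 i.2) a k * w i := by
  rw [theta_eq, Finsupp.finsetSum_apply, Finset.sum_apply]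
  exact Finset.sum_congr rfl fun i _ => by rw [hπ.mul_emb, hσ]

theorem theta_ldeg_lside (hπ : IsCoeff p π) {σ : R →ₗ[F] H F q n} (hσ : ∀ r, p (σ r) = r)
    (hd : 1 ≤ d) (had : aa d = 1) (m : ℤ) (w : Bool × Fin (n + 1) → R) (j : Fin (n + 1)) :
    theta d aa π σ m w (Sys.ldeg d m) (Sys.lside m, j) = w (Sys.lside m, j) := by
  rw [theta_apply hπ hσ, Finset.sum_eq_single (Sys.lside m, j)]
  · rw [hπ.lel_lside hd had, if_pos rfl, one_mul]
  · rintro ⟨b, j'⟩ - hne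
    by_cases hb : b = Sys.lside m
    · subst hb
      rw [hπ.lel_lside hd had, if_neg, zero_mul]
      rintro rfl
      exact hne rfl
    · obtain rfl : b = !Sys.lside m := by
        cases b <;> cases h : Sys.lside m <;> simp_all
      rw [hπ.lel_not_lside, Pi.single_eq_of_ne, zero_mul]
      simp
  · simp

theorem theta_ldeg_not_lside (hπ : IsCoeff p π) {σ : R →ₗ[F] H F q n} (hσ : ∀ r, p (σ r) = r)
    (m : ℤ) (w : Bool × Fin (n + 1) → R) (j : Fin (n + 1)) :
    theta d aa π σ m w (Sys.ldeg d m) (!Sys.lside m, j) =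
      (∑ j', π ((hsys F q (n + 1)).lel n d aa m (Sys.lside m) (j' : Fin (n + 1))) (Sys.ldeg d m)
        (!Sys.lside m, j) * w (Sys.lside m, j')) + aa 0 • w (!Sys.lside m, j) := by
  rw [theta_apply hπ hσ, Fintype.sum_prod_type, Fintype.sum_bool]
  have key : ∑ j' : Fin (n + 1), π ((hsys F q (n + 1)).lel n d aa m (!Sys.lside m) j')
      (Sys.ldeg d m) (!Sys.lside m, j) * w (!Sys.lside m, j') = aa 0 • w (!Sys.lside m, j) := by
    rw [Finset.sum_eq_single j]
    · rw [hπ.lel_not_lside, Pi.single_eq_same, smul_mul_assoc, one_mul]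
    · intro j' _ hne
      rw [hπ.lel_not_lside, Pi.single_eq_of_ne, zero_mul]
      simpa using hne.symm
    · simp
  generalize Sys.lside m = b at *
  cases b
  · rw [add_comm]; exact congrArg _ key
  · exact congrArg _ key

theorem isLaurentTriangular_theta (hπ : IsCoeff p π) {σ : R →ₗ[F] H F q n}
    (hσ : ∀ r, p (σ r) = r) (hd : 1 ≤ d) (had : aa d = 1) (ha0 : aa 0 ≠ 0) :
    IsLaurentTriangular d (theta d aa π σ) := by
  have hbij : ∀ m, Function.Bijective fun w => theta d aa π σ m w (Sys.ldeg d m) := by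
    intro m
    constructor
    · intro w w' h
      simp only at h
      have h1 : ∀ j, w (Sys.lside m, j) = w' (Sys.lside m, j) := fun j => by
        have e := congrFun h (Sys.lside m, j)
        rwa [theta_ldeg_lside hπ hσ hd had, theta_ldeg_lside hπ hσ hd had] at e
      have h2 : ∀ j, w (!Sys.lside m, j) = w' (!Sys.lside m, j) := fun j => by
        have e := congrFun h (!Sys.lside m, j)
        simp only [theta_ldeg_not_lside hπ hσ, h1] at e
        exact smul_right_injective _ ha0 (add_left_cancel e)
      ext ⟨b, j⟩
      by_cases hb : b = Sys.lside m
      · rw [hb, h1]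
      · obtain rfl : b = !Sys.lside m := by
          cases b <;> cases h : Sys.lside m <;> simp_all
        exact h2 j
    · intro v
      let w : Bool × Fin (n + 1) → R := fun i => if i.1 = Sys.lside m then v i else
        (aa 0)⁻¹ • (v i - ∑ j', π ((hsys F q (n + 1)).lel n d aa m (Sys.lside m)
          (j' : Fin (n + 1))) (Sys.ldeg d m) i * v (Sys.lside m, j'))
      have hw : ∀ j, w (Sys.lside m, j) = v (Sys.lside m, j) := fun j => by simp [w]
      refine ⟨w, ?_⟩
      ext ⟨b, j⟩
      by_cases hb : b = Sys.lside m
      · subst hb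
        simp only
        rw [theta_ldeg_lside hπ hσ hd had, hw]
      · obtain rfl : b = !Sys.lside m := by
          cases b <;> cases h : Sys.lside m <;> simp_all
        simp only [theta_ldeg_not_lside hπ hσ, hw]
        have : w (!Sys.lside m, j) = (aa 0)⁻¹ • (v (!Sys.lside m, j) -
          ∑ j', π ((hsys F q (n + 1)).lel n d aa m (Sys.lside m)
          (j' : Fin (n + 1))) (Sys.ldeg d m) (!Sys.lside m, j) * v (Sys.lside m, j')) := by
          simp [w]
        rw [this, smul_inv_smul₀ ha0, add_sub_cancel]
  refine ⟨fun m w a hne => ?_, fun m hm => ?_, fun m hm => ?_⟩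
  · by_contra hc
    apply hne
    ext k
    rw [theta_apply hπ hσ, Pi.zero_apply]
    exact Finset.sum_eq_zero fun i _ => by
      rw [hπ.lel_supp hd had m i.1 i.2 hc, Pi.zero_apply, zero_mul]
  · have := hbij m
    rwa [Sys.ldeg, if_neg (by omega)] at this
  · have := hbij m
    rwa [Sys.ldeg, if_pos hm] at this

end free

theorem apply_mem_of_span {F : Type} [Field F] {A B : Type} [AddCommGroup A] [Module F A]
    [AddCommGroup B] [Module F B] {s : Set A} {P : Submodule F B} (g : A →ₗ[F] B)
    (h : ∀ x ∈ s, g x ∈ P) {x : A} (hx : x ∈ Submodule.span F s) : g x ∈ P :=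
  (Submodule.span_le (p := P.comap g)).2 h hx

namespace Sys

variable {F : Type} [Field F] {ξ : F} {A : Type} [Ring A] [Algebra F A] {N : ℕ} (S : Sys ξ A N)

theorem c_x_pow {i : ℕ} (hi : i < N) (k : ℕ) : S.c i * S.x i ^ k = S.y i ^ k * S.c i := by
  induction k with
  | zero => simp
  | succ k ih => rw [pow_succ, ← mul_assoc, ih, mul_assoc, S.cx i hi, ← mul_assoc, ← pow_succ]

theorem c_fe {d : ℕ} {aa : ℕ → F} (haa : ∀ i ≤ d, aa i = aa 0 * aa (d - i)) (hN : 0 < N) :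
    S.c 0 * S.fe d aa = S.fe d aa * (aa 0 • (S.y 0 ^ d * S.c 0)) := by
  have h : S.fe d aa * (aa 0 • S.y 0 ^ d) =
      ∑ i ∈ Finset.range (d + 1), aa i • S.y 0 ^ i := by
    rw [fe, Finset.sum_mul, ← Finset.sum_range_reflect]
    refine Finset.sum_congr rfl fun i hi => ?_
    have hi' : i ≤ d := by simpa [Nat.lt_succ_iff] using hi
    have hpow : ∀ k, S.x 0 ^ k * S.y 0 ^ k = 1 := fun k => by
      rw [← (show Commute (S.x 0) (S.y 0) from S.x_y_comm hN hN).mul_pow, S.xy 0 hN, one_pow]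
    rw [show d + 1 - 1 - i = d - i by omega, smul_mul_smul_comm, mul_comm (aa (d - i)),
      ← haa i hi', show S.y 0 ^ d = S.y 0 ^ (d - i) * S.y 0 ^ i by
        rw [← pow_add]; congr 1; omega, ← mul_assoc, hpow, one_mul]
  rw [← smul_mul_assoc, ← mul_assoc, h, fe, Finset.mul_sum, Finset.sum_mul]
  exact Finset.sum_congr rfl fun i _ => by rw [mul_smul_comm, S.c_x_pow hN, smul_mul_assoc]

theorem alg_fe {d : ℕ} {aa : ℕ → F} (haa : ∀ i ≤ d, aa i = aa 0 * aa (d - i)) (hN : 0 < N)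
    {u : A} (hu : u ∈ S.alg) : ∃ u' ∈ S.alg, u * S.fe d aa = S.fe d aa * u' := by
  induction hu using Algebra.adjoin_induction with
  | mem a ha =>
    rcases ha with ⟨i, hi, rfl⟩ | ⟨i, hi, rfl⟩ | ⟨i, hi, rfl⟩
    · exact ⟨_, S.x_mem hi, S.fe_comm (S.xx i hi 0 hN)⟩
    · exact ⟨_, S.y_mem hi, S.fe_comm (S.x_y_comm hN hi).symm⟩
    · rcases Nat.eq_zero_or_pos i with rfl | h0
      · exact ⟨_, S.alg.smul_mem (mul_mem (pow_mem (S.y_mem hN) d) (S.c_mem hN)) _,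
          S.c_fe haa hN⟩
      · exact ⟨_, S.c_mem hi, S.fe_comm (S.cxo i hi 0 hN (by omega))⟩
  | algebraMap r => exact ⟨_, S.alg.algebraMap_mem r, Algebra.commutes _ _⟩
  | add a b _ _ iha ihb =>
    obtain ⟨u, hu, e⟩ := iha
    obtain ⟨v, hv, e'⟩ := ihb
    exact ⟨_, add_mem hu hv, by rw [add_mul, e, e', mul_add]⟩
  | mul a b _ _ iha ihb =>
    obtain ⟨u, hu, e⟩ := iha
    obtain ⟨v, hv, e'⟩ := ihb
    exact ⟨_, mul_mem hu hv, by rw [mul_assoc, e', ← mul_assoc, e, mul_assoc]⟩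

end Sys

section ker

variable {F : Type} [Field F] {q : F} {n d : ℕ} {aa : ℕ → F}

/-- The two-sided ideal generated by `fe` is spanned by the elements `s * (fe * tu 0 j) * u`. -/
theorem mul_fe_mul_mem (haa : ∀ i ≤ d, aa i = aa 0 * aa (d - i)) {P : Submodule F (H F q (n + 1))}
    (hP : ∀ s ∈ (hsys F q (n + 1)).tall, ∀ j ≤ n, ∀ u ∈ (hsys F q (n + 1)).alg,
      s * ((hsys F q (n + 1)).fe d aa * (hsys F q (n + 1)).tu 0 j) * u ∈ P)
    (a b : H F q (n + 1)) : a * (hsys F q (n + 1)).fe d aa * b ∈ P := by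
  set S := hsys F q (n + 1) with hS
  refine apply_mem_of_span (LinearMap.mulRight F b ∘ₗ LinearMap.mulRight F (S.fe d aa)) ?_
    (tall_mul_alg a)
  rintro _ ⟨s, hs, u, hu, rfl⟩
  obtain ⟨u', hu', e⟩ := S.alg_fe haa (Nat.succ_pos n) hu
  have e1 : s * u * S.fe d aa * b = s * S.fe d aa * (u' * b) := by
    rw [mul_assoc s, e]; simp only [mul_assoc]
  change s * u * S.fe d aa * b ∈ P
  rw [e1]
  refine apply_mem_of_span (LinearMap.mulLeft F (s * S.fe d aa)) ?_ (tall_mul_alg (u' * b))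
  rintro _ ⟨s', hs', v, hv, rfl⟩
  change s * S.fe d aa * (s' * v) ∈ P
  rw [← mul_assoc]
  refine apply_mem_of_span (LinearMap.mulRight F v ∘ₗ LinearMap.mulLeft F (s * S.fe d aa)) ?_
    (S.tall_le_span_tu_zero hs')
  rintro _ ⟨r, hr, j, hj, rfl⟩
  have hr' : S.fe d aa * r = r * S.fe d aa := S.tsub_comm (fun i hi => by
    refine (S.fe_comm ?_).symm
    exact S.txo i (by have := hi.2; omega) 0 (by omega) (by have := hi.1; omega) (by omega)) hr
  have e2 : s * S.fe d aa * (r * S.tu 0 j) * v = s * r * (S.fe d aa * S.tu 0 j) * v := by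
    rw [mul_assoc s, ← mul_assoc (S.fe d aa), hr']; simp only [mul_assoc]
  change s * S.fe d aa * (r * S.tu 0 j) * v ∈ P
  rw [e2]
  exact hP _ (mul_mem hs (S.tsub_mono (fun i hi => by have := hi.2; simp; omega) hr)) j hj v hv

theorem emb_tu {j k : ℕ} (hk : k < n) :
    emb F q n ((hsys F q n).tu j k) = (hsys F q (n + 1)).tu j k := by
  induction k with
  | zero => rw [Sys.tu, Sys.tu, map_one]
  | succ k ih =>
    rw [Sys.tu, Sys.tu]
    split_ifs
    · rw [map_mul, ih (by omega), emb_t hk]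
    · rw [map_one]

variable {R : Type} [Ring R] [Algebra F R] {p : H F q n →ₐ[F] R}
  {π : H F q (n + 1) →ₗ[F] (ℤ →₀ (Bool × Fin (n + 1) → R))}

theorem IsCoeff.fe_tu_lt (hπ : IsCoeff p π) (hp : IsCycQuot d aa p) (s : H F q (n + 1)) {j : ℕ}
    (hj : j < n) {u : H F q (n + 1)} (hu : u ∈ (hsys F q (n + 1)).alg) :
    π (s * ((hsys F q (n + 1)).fe d aa * (hsys F q (n + 1)).tu 0 j) * u) = 0 := by
  have hn : 0 < n := by omega
  rw [← emb_fe hn, ← emb_tu hj, ← map_mul]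
  have hz : p ((hsys F q n).fe d aa * (hsys F q n).tu 0 j) = 0 := by
    rw [map_mul, hp.fe hn, zero_mul]
  generalize (hsys F q n).fe d aa * (hsys F q n).tu 0 j = z at *
  refine (Submodule.mem_bot F).1 (apply_mem_of_span (π ∘ₗ LinearMap.mulLeft F (s * emb F q n z)) ?_
    (alg_mem_pspan hu))
  rintro _ ⟨a, b, h, rfl⟩
  rw [Submodule.mem_bot, LinearMap.comp_apply, LinearMap.mulLeft_apply]
  have e : s * emb F q n z * ((hsys F q (n + 1)).cp n b * (hsys F q (n + 1)).xp n a * emb F q n h)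
      = s * (hsys F q (n + 1)).cp n b * (hsys F q (n + 1)).xp n a *
        emb F q n (grp F q n b z * h) := by
    rw [map_mul, ← mul_assoc, ← mul_assoc, mul_assoc s, emb_cp, ← mul_assoc s, mul_assoc _ _
      (Sys.xp _ _ _), emb_xp]
    simp only [mul_assoc]
  rw [e]
  exact hπ.mul_emb_eq_zero _ (by rw [map_mul, hp.grp b hz, zero_mul])

theorem IsCoeff.lel_mem_range_theta (hπ : IsCoeff p π) {σ : R →ₗ[F] H F q n}
    (hσ : ∀ r, p (σ r) = r) (m : ℤ) (b : Bool) (j : Fin (n + 1)) (h : H F q n) :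
    π ((hsys F q (n + 1)).lel n d aa m b j * emb F q n h) ∈
      LinearMap.range (theta d aa π σ m) := by
  refine ⟨Pi.single (b, j) (p h), ?_⟩
  rw [theta_eq, Finset.sum_eq_single (b, j)]
  · rw [Pi.single_eq_same]
    exact hπ.mul_emb_congr _ (hσ _)
  · intro i _ hi
    rw [Pi.single_eq_of_ne hi, map_zero, map_zero, mul_zero, map_zero]
  · simp

theorem IsCoeff.fe_tu_top_mem (hπ : IsCoeff p π) {σ : R →ₗ[F] H F q n} (hσ : ∀ r, p (σ r) = r)
    {s u : H F q (n + 1)} (hs : s ∈ (hsys F q (n + 1)).tall)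
    (hu : u ∈ (hsys F q (n + 1)).alg) :
    π (s * ((hsys F q (n + 1)).fe d aa * (hsys F q (n + 1)).tu 0 n) * u) ∈
      ⨆ m, LinearMap.range (theta d aa π σ m) := by
  set S := hsys F q (n + 1) with hS
  have hn : n < n + 1 := Nat.lt_succ_self n
  refine apply_mem_of_span (π ∘ₗ LinearMap.mulLeft F (s * (S.fe d aa * S.tu 0 n))) ?_
    (alg_mem_pspan hu)
  rintro _ ⟨k, b, h, rfl⟩
  rw [LinearMap.comp_apply, LinearMap.mulLeft_apply, ← hS]
  obtain ⟨m, hm⟩ : ∃ m : ℤ, m + (if b then d else 0 : ℕ) = k := ⟨k - (if b then d else 0 : ℕ), by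
    ring⟩
  obtain ⟨g', hg', hg⟩ : ∃ g' ∈ S.tall, g' * S.lunit n m b = 1 := by
    rw [Sys.lunit]
    split_ifs
    · exact ⟨_, S.ui_mem hn, S.ui_vi hn⟩
    · exact ⟨_, S.tu_mem hn, S.tu_wi hn⟩
  have hcomm : ∀ i, i + 1 < n → S.lunit n m b * S.t (i + 1) = S.t i * S.lunit n m b := by
    intro i hi
    rw [Sys.lunit]
    split_ifs
    · exact S.vi_t_succ hi hn
    · exact S.wi_t_succ hi hn
  have e : s * (S.fe d aa * S.tu 0 n) * (S.cp n b * S.xp n k * emb F q n h) =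
      s * g' * ((S.lunit n m b * (S.fe d aa * S.tu 0 n)) * (S.cp n b * S.xp n k * emb F q n h)) := by
    rw [mul_assoc, mul_assoc s, ← mul_assoc g', ← mul_assoc g', hg, one_mul]
  rw [e]
  refine apply_mem_of_span (π ∘ₗ LinearMap.mulRight F _) ?_
    (S.tall_le_span_tu (mul_mem hs hg'))
  rintro _ ⟨j, hj, a, ha, rfl⟩
  rw [LinearMap.comp_apply, LinearMap.mulRight_apply]
  have hc := S.comm_lower (d := d) (aa := aa) hn hcomm ha
  obtain ⟨a', rfl⟩ := tsub_le_range ha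
  have e2 : S.tu j n * emb F q n a' * (S.lunit n m b * (S.fe d aa * S.tu 0 n) *
      (S.cp n b * S.xp n k * emb F q n h)) =
      S.lel n d aa m b j * emb F q n (grp F q n b a' * h) := by
    rw [Sys.lel, hm, mul_assoc (S.tu j n), ← mul_assoc (emb F q n a'), ← hc, map_mul,
      ← mul_assoc _ (emb F q n (grp F q n b a')), mul_assoc _ (S.xp n k) (emb F q n (grp _ _ _ _ _)),
      ← emb_xp, ← mul_assoc _ _ (S.xp n k), mul_assoc _ (S.cp n b), ← emb_cp]
    simp only [mul_assoc, hS]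
  rw [e2]
  exact Submodule.mem_iSup_of_mem m (hπ.lel_mem_range_theta hσ m b ⟨j, by omega⟩ _)

variable {R' : Type} [Ring R'] [Algebra F R'] {p' : H F q (n + 1) →ₐ[F] R'}

theorem IsCoeff.mem_of_eq_zero (hπ : IsCoeff p π) {σ : R →ₗ[F] H F q n} (hσ : ∀ r, p (σ r) = r)
    (hp : IsCycQuot d aa p) (hp' : IsCycQuot d aa p') (haa : ∀ i ≤ d, aa i = aa 0 * aa (d - i))
    {x : H F q (n + 1)} (hx : p' x = 0) : π x ∈ ⨆ m, LinearMap.range (theta d aa π σ m) := by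
  refine apply_mem_of_span π ?_ (hp'.ker x hx)
  rintro _ ⟨a, b, rfl⟩
  rw [felem_eq (Nat.succ_pos n)]
  refine mul_fe_mul_mem haa (P := (⨆ m, LinearMap.range (theta d aa π σ m)).comap π)
    (fun s hs j hj u hu => ?_) a b
  rw [Submodule.mem_comap]
  rcases Nat.lt_or_ge j n with h | h
  · rw [hπ.fe_tu_lt hp s h hu]; exact zero_mem _
  · obtain rfl : j = n := by omega
    exact hπ.fe_tu_top_mem hσ hs hu

end ker

section basis

variable {F : Type} [Field F] {q : F} {n d : ℕ} {aa : ℕ → F} {R : Type} [Ring R] [Algebra F R]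
  {p : H F q n →ₐ[F] R} {R' : Type} [Ring R'] [Algebra F R'] {p' : H F q (n + 1) →ₐ[F] R'}
  {π : H F q (n + 1) →ₗ[F] (ℤ →₀ (Bool × Fin (n + 1) → R))}

theorem IsCoeff.surjective (hπ : IsCoeff p π) (hp : Function.Surjective p) :
    Function.Surjective π := by
  intro φ
  suffices φ ∈ LinearMap.range π from this
  rw [← Finsupp.sum_single φ]
  refine Submodule.sum_mem _ fun a _ => ?_
  rw [← Finset.univ_sum_single (φ a), Finsupp.single_finsetSum]
  refine Submodule.sum_mem _ fun i _ => ?_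
  obtain ⟨h, hh⟩ := hp (φ a i)
  exact ⟨gb F q n a i.1 i.2 * emb F q n h, by rw [hπ, hh]⟩

/-- Reassembling an element of the quotient from its coefficients. -/
noncomputable def assemble (p' : H F q (n + 1) →ₐ[F] R') (en : R →ₐ[F] R') :
    (ℤ →₀ (Bool × Fin (n + 1) → R)) →ₗ[F] R' :=
  Finsupp.lsum F fun a => ∑ i : Bool × Fin (n + 1),
    LinearMap.mulLeft F (p' (gb F q n a i.1 i.2)) ∘ₗ en.toLinearMap ∘ₗ LinearMap.proj i

theorem assemble_single (en : R →ₐ[F] R') (a : ℤ) (w : Bool × Fin (n + 1) → R) :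
    assemble p' en (Finsupp.single a w) =
      ∑ i : Bool × Fin (n + 1), p' (gb F q n a i.1 i.2) * en (w i) := by
  simp [assemble]

theorem IsCoeff.assemble_apply (hπ : IsCoeff p π) {en : R →ₐ[F] R'}
    (hen : ∀ h, en (p h) = p' (emb F q n h)) (x : H F q (n + 1)) :
    assemble p' en (π x) = p' x := by
  have hx : x ∈ gspan F q n := by rw [gspan_eq_top]; exact Submodule.mem_top
  induction hx using Submodule.span_induction with
  | mem x hx =>
    obtain ⟨a, b, j, hj, g, rfl⟩ := hx
    have e := hπ a b ⟨j, by omega⟩ g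
    simp only at e
    rw [e, assemble_single, Finset.sum_eq_single (b, ⟨j, by omega⟩)]
    · rw [Pi.single_eq_same, hen, map_mul]
    · intro i _ hi
      rw [Pi.single_eq_of_ne hi, map_zero, mul_zero]
    · simp
  | zero => simp
  | add x y _ _ hx hy => rw [map_add, map_add, map_add, hx, hy]
  | smul r x _ hx => rw [map_smul, map_smul, map_smul, hx]

theorem IsCoeff.assemble_theta (hπ : IsCoeff p π) {en : R →ₐ[F] R'}
    (hen : ∀ h, en (p h) = p' (emb F q n h)) (hp' : IsCycQuot d aa p') (σ : R →ₗ[F] H F q n)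
    (m : ℤ) (w : Bool × Fin (n + 1) → R) : assemble p' en (theta d aa π σ m w) = 0 := by
  rw [theta_eq, map_sum]
  refine Finset.sum_eq_zero fun i _ => ?_
  rw [hπ.assemble_apply hen, Sys.lel]
  simp only [map_mul, hp'.fe (Nat.succ_pos n), zero_mul, mul_zero]

/-- The quotient of `H F q (n + 1)` is a free right module over the quotient of `H F q n`, with
basis the images of the `gb k b j` with `0 ≤ k < d`. -/
theorem bijective_sum_gb (hp : IsCycQuot d aa p) (hp' : IsCycQuot d aa p') {en : R →ₐ[F] R'}
    (hen : ∀ h, en (p h) = p' (emb F q n h)) (hf : GoodPoly F d aa) :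
    Function.Bijective fun r : Fin d × Bool × Fin (n + 1) → R =>
      ∑ i, p' (gb F q n (i.1 : ℕ) i.2.1 i.2.2) * en (r i) := by
  obtain ⟨hd, had, haa, -⟩ := hf
  have ha0 : aa 0 ≠ 0 := by
    intro h
    have := haa d le_rfl
    rw [h, zero_mul, had] at this
    exact one_ne_zero this
  obtain ⟨π, hπ⟩ := exists_isCoeff p
  obtain ⟨σ, hσ'⟩ := LinearMap.exists_rightInverse_of_surjective p.toLinearMap
    (LinearMap.range_eq_top.2 hp.surj)
  have hσ : ∀ r, p (σ r) = r := fun r => LinearMap.congr_fun hσ' r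
  have htri := isLaurentTriangular_theta hπ hσ hd had ha0
  let emt : (Fin d × Bool × Fin (n + 1) → R) →ₗ[F] (ℤ →₀ (Bool × Fin (n + 1) → R)) :=
    ∑ k : Fin d, Finsupp.lsingle ((k : ℕ) : ℤ) ∘ₗ
      (LinearMap.pi fun i => LinearMap.proj (k, i))
  have hemt : ∀ r, emt r = ∑ k : Fin d, Finsupp.single ((k : ℕ) : ℤ) fun i => r (k, i) := by
    intro r
    simp only [emt, LinearMap.sum_apply]
    rfl
  have hasm : ∀ r, assemble p' en (emt r) =
      ∑ i : Fin d × Bool × Fin (n + 1), p' (gb F q n (i.1 : ℕ) i.2.1 i.2.2) * en (r i) := by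
    intro r
    rw [hemt, map_sum, Fintype.sum_prod_type]
    exact Finset.sum_congr rfl fun k _ => assemble_single en _ _
  have hcoe : ∀ r (k : Fin d) i, emt r ((k : ℕ) : ℤ) i = r (k, i) := by
    intro r k i
    rw [hemt, Finsupp.finsetSum_apply, Finset.sum_eq_single k]
    · rw [Finsupp.single_eq_same]
    · intro k' _ hk
      exact Finsupp.single_eq_of_ne fun h => hk (Fin.ext (by exact_mod_cast h.symm))
    · simp
  have hsup : ∀ r a, emt r a ≠ 0 → 0 ≤ a ∧ a < d := by
    intro r a ha
    by_contra hc
    apply ha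
    rw [hemt, Finsupp.finsetSum_apply]
    refine Finset.sum_eq_zero fun k _ => Finsupp.single_eq_of_ne ?_
    rintro rfl
    exact hc ⟨by omega, by have := k.2; omega⟩
  simp only [← hasm]
  change Function.Bijective (assemble p' en ∘ₗ emt)
  constructor
  · rw [← LinearMap.ker_eq_bot, LinearMap.ker_eq_bot']
    intro r hr
    rw [LinearMap.comp_apply] at hr
    obtain ⟨x, hx⟩ := hπ.surjective hp.surj (emt r)
    rw [← hx, hπ.assemble_apply hen] at hr
    have h0 := htri.eq_zero (hx ▸ hπ.mem_of_eq_zero hσ hp hp' haa hr) (hsup r)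
    ext ⟨k, i⟩
    rw [← hcoe r k i, h0]
    rfl
  · intro y
    obtain ⟨x, rfl⟩ := hp'.surj y
    have hx : π x ∈ (⨆ m, LinearMap.range (theta d aa π σ m)) ⊔
        Finsupp.supported (Bool × Fin (n + 1) → R) F (Set.Ico (0 : ℤ) d) := by
      rw [htri.sup_eq_top]; exact Submodule.mem_top
    obtain ⟨u, hu, v, hv, huv⟩ := Submodule.mem_sup.1 hx
    have hu0 : assemble p' en u = 0 := by
      have : (⨆ m, LinearMap.range (theta d aa π σ m)) ≤ LinearMap.ker (assemble p' en) := by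
        refine iSup_le fun m => ?_
        rintro _ ⟨w, rfl⟩
        exact hπ.assemble_theta hen hp' σ m w
      exact this hu
    have hv' : emt (fun i => v ((i.1 : ℕ) : ℤ) i.2) = v := by
      ext a i
      by_cases ha : 0 ≤ a ∧ a < d
      · obtain ⟨k, rfl⟩ := Int.eq_ofNat_of_zero_le ha.1
        exact hcoe _ ⟨k, by omega⟩ i
      · have e1 : emt (fun i => v ((i.1 : ℕ) : ℤ) i.2) a = 0 := by
          by_contra hc
          exact ha (hsup _ _ hc)
        have e2 : v a = 0 := by
          by_contra hc
          exact ha (hv (Finsupp.mem_support_iff.2 hc))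
        rw [e1, e2]
    refine ⟨fun i => v ((i.1 : ℕ) : ℤ) i.2, ?_⟩
    rw [LinearMap.comp_apply, hv', ← hπ.assemble_apply hen x, ← huv, map_add, hu0, zero_add]

end basis

section induced

variable {F : Type} [Field F] {A B : Type} [Ring A] [Ring B] [Algebra F A] [Algebra F B]
  {φ : B →ₐ[F] A} {M : Type} [AddCommGroup M] [Module F M] {ρ : B →ₐ[F] Module.End F M}
  {E : Type} [AddCommGroup E] [Module F E] {ρE : A →ₐ[F] Module.End F E} {ι : M →ₗ[F] E}

/-- If `A` is free as a right `B`-module on the finite family `a`, the induced module is the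
direct sum of the translates of `M` by the elements of the family. -/
theorem IsInducedAlong.bijective_sum (hE : IsInducedAlong F φ ρ ρE ι) {I : Type} [Fintype I]
    (a : I → A) (ha : Function.Bijective fun r : I → B => ∑ i, a i * φ (r i)) :
    Function.Bijective fun m : I → M => ∑ i, ρE (a i) (ι (m i)) := by
  classical
  let Γ : (I → B) →ₗ[F] A := ∑ i, LinearMap.mulLeft F (a i) ∘ₗ φ.toLinearMap ∘ₗ LinearMap.proj i
  have hΓ : ∀ r, Γ r = ∑ i, a i * φ (r i) := fun r => by simp [Γ]
  have hbij : Function.Bijective Γ := by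
    have : (Γ : (I → B) → A) = fun r : I → B => ∑ i, a i * φ (r i) := funext hΓ
    rwa [this]
  let β : A ≃ₗ[F] (I → B) := (LinearEquiv.ofBijective Γ hbij).symm
  have hΓβ : ∀ x, Γ (β x) = x := fun x => (LinearEquiv.ofBijective Γ hbij).apply_symm_apply x
  have hβΓ : ∀ r, β (Γ r) = r := fun r => (LinearEquiv.ofBijective Γ hbij).symm_apply_apply r
  have hsum : ∀ x, ∑ i, a i * φ (β x i) = x := fun x => by rw [← hΓ, hΓβ]
  have hβmul : ∀ x b j, β (x * φ b) j = β x j * b := by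
    intro x b j
    have : x * φ b = Γ fun i => β x i * b := by
      rw [hΓ]
      conv_lhs => rw [← hsum x, Finset.sum_mul]
      exact Finset.sum_congr rfl fun i _ => by rw [map_mul, mul_assoc]
    rw [this, hβΓ]
  have hβprod : ∀ x y j, ∑ i, β (x * a i) j * β y i = β (x * y) j := by
    intro x y j
    conv_rhs => rw [← hsum y, Finset.mul_sum, map_sum, Finset.sum_apply]
    exact Finset.sum_congr rfl fun i _ => by rw [← mul_assoc, hβmul]
  have hβa : ∀ i j, β (a i) j = if j = i then 1 else 0 := by
    intro i j
    have : a i = Γ (Pi.single i 1) := by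
      rw [hΓ, Finset.sum_eq_single i]
      · rw [Pi.single_eq_same, map_one, mul_one]
      · intro k _ hk
        rw [Pi.single_eq_of_ne hk, map_zero, mul_zero]
      · simp
    rw [this, hβΓ, Pi.single_apply]
  let act : A →ₗ[F] Module.End F (I → M) :=
    { toFun := fun x => LinearMap.pi fun j => ∑ i, ρ (β (x * a i) j) ∘ₗ LinearMap.proj i
      map_add' := fun x y => by
        ext1 m; ext j
        simp [add_mul, Finset.sum_add_distrib]
      map_smul' := fun r x => by
        ext1 m; ext j
        simp [Finset.smul_sum] }
  have hact : ∀ x m j, act x m j = ∑ i, ρ (β (x * a i) j) (m i) := by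
    intro x m j
    simp [act]
  let ρP : A →ₐ[F] Module.End F (I → M) := AlgHom.ofLinearMap act
    (by
      refine LinearMap.ext fun m => funext fun j => ?_
      rw [hact, Finset.sum_eq_single j]
      · rw [one_mul, hβa, if_pos rfl, map_one]; rfl
      · intro i _ hi
        rw [one_mul, hβa, if_neg hi.symm, map_zero]; rfl
      · simp)
    (by
      intro x y
      refine LinearMap.ext fun m => funext fun j => ?_
      rw [Module.End.mul_apply, hact, hact]
      simp only [hact, map_sum]
      rw [Finset.sum_comm]
      refine Finset.sum_congr rfl fun i _ => ?_
      rw [mul_assoc, ← hβprod, map_sum, LinearMap.sum_apply]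
      exact Finset.sum_congr rfl fun k _ => by rw [map_mul, Module.End.mul_apply])
  have hρP : ∀ x m j, ρP x m j = ∑ i, ρ (β (x * a i) j) (m i) := hact
  let f : M →ₗ[F] (I → M) := LinearMap.pi fun j => ρ (β 1 j)
  have hf : ∀ x m j, ρP x (f m) j = ρ (β x j) m := by
    intro x m j
    rw [hρP]
    conv_rhs => rw [← mul_one x, ← hβprod, map_sum, LinearMap.sum_apply]
    exact Finset.sum_congr rfl fun i _ => by rw [map_mul ρ, Module.End.mul_apply]; rfl
  obtain ⟨hι, huniv⟩ := hE
  obtain ⟨g, ⟨hg, hgι⟩, -⟩ := huniv (I → M) ρP f fun b m => funext fun j => by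
    rw [hf]
    change ρ (β 1 j) (ρ b m) = _
    rw [← Module.End.mul_apply, ← map_mul, ← hβmul, one_mul]
  let h : (I → M) →ₗ[F] E := ∑ i, ρE (a i) ∘ₗ ι ∘ₗ LinearMap.proj i
  have hh : ∀ m, h m = ∑ i, ρE (a i) (ι (m i)) := fun m => by simp [h]
  have hterm : ∀ x (m : M), ∑ j, ρE (a j) (ι (ρ (β x j) m)) = ρE x (ι m) := by
    intro x m
    conv_rhs => rw [← hsum x, map_sum, LinearMap.sum_apply]
    exact Finset.sum_congr rfl fun j _ => by rw [hι, map_mul, Module.End.mul_apply]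
  have hhf : ∀ m, h (f m) = ι m := by
    intro m
    have := hterm 1 m
    rwa [map_one ρE, Module.End.one_apply, ← hh fun j => ρ (β 1 j) m] at this
  have hhact : ∀ x m, h (ρP x m) = ρE x (h m) := by
    intro x m
    rw [hh, hh, map_sum]
    simp only [hρP, map_sum]
    rw [Finset.sum_comm]
    exact Finset.sum_congr rfl fun i _ => by rw [hterm, map_mul, Module.End.mul_apply]
  have hhg : ∀ e, h (g e) = e := by
    obtain ⟨k, -, hk⟩ := huniv E ρE ι hι
    have e1 := hk (h ∘ₗ g) ⟨fun x e => by
      rw [LinearMap.comp_apply, hg, hhact]; rfl, fun m => by rw [LinearMap.comp_apply, hgι, hhf]⟩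
    have e2 := hk LinearMap.id ⟨fun _ _ => rfl, fun _ => rfl⟩
    exact fun e => LinearMap.congr_fun (e1.trans e2.symm) e
  have hgh : ∀ m, g (h m) = m := by
    intro m
    ext j
    rw [hh, map_sum, Finset.sum_apply, Finset.sum_eq_single j]
    · rw [hg, hgι, hf, hβa, if_pos rfl, map_one]; rfl
    · intro i _ hi
      rw [hg, hgι, hf, hβa, if_neg hi.symm, map_zero]; rfl
    · simp
  simp only [← hh]
  exact ⟨Function.LeftInverse.injective hgh, Function.RightInverse.surjective hhg⟩

end induced

section mackey

variable {F : Type} [Field F] {q : F} {n m d : ℕ}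

variable (F q n d) in
/-- The right span of the elements `cp n b * xp n k` with `0 ≤ k < d`. -/
def zspan : Submodule F (H F q (n + 1)) := Submodule.span F
  {x | ∃ (k : Fin d) (b : Bool) (h : H F q n), x = (hsys F q (n + 1)).cp n b *
    (hsys F q (n + 1)).xp n (k : ℕ) * emb F q n h}

theorem mem_zspan (h : H F q n) (b : Bool) {k : ℕ} (hk : k < d) :
    emb F q n h * ((hsys F q (n + 1)).cp n b * (hsys F q (n + 1)).x n ^ k) ∈ zspan F q n d := by
  refine Submodule.subset_span ⟨⟨k, hk⟩, b, grp F q n b h, ?_⟩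
  rw [← mul_assoc, emb_cp, Sys.xp_natCast _ (Nat.lt_succ_self n), mul_assoc,
    ← Sys.xp_natCast _ (Nat.lt_succ_self n), emb_xp, ← mul_assoc]

theorem emb_mul_zspan (h : H F q n) {x : H F q (n + 1)} (hx : x ∈ zspan F q n d) :
    emb F q n h * x ∈ zspan F q n d := by
  refine apply_mem_of_span (LinearMap.mulLeft F (emb F q n h)) ?_ hx
  rintro _ ⟨k, b, g, rfl⟩
  refine Submodule.subset_span ⟨k, b, grp F q n b h * g, ?_⟩
  rw [LinearMap.mulLeft_apply, ← mul_assoc, ← mul_assoc, emb_cp, mul_assoc _ _ (Sys.xp _ _ _),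
    emb_xp, map_mul]
  simp only [mul_assoc]

theorem emb_gb_mul_t {k : ℕ} (hk : k < d) (b : Bool) {j : ℕ} (hj : j ≤ m) :
    emb F q (m + 1) (gb F q m (k : ℕ) b j) * (hsys F q (m + 2)).t m -
      gb F q (m + 1) (k : ℕ) b j ∈ zspan F q (m + 1) d := by
  set S := hsys F q (m + 2) with hS
  set S1 := hsys F q (m + 1) with hS1
  have hm1 : m < m + 1 := by omega
  have hm2 : m < m + 2 := by omega
  have ht : m + 1 < m + 2 := by omega
  have hx : ∀ i, emb F q (m + 1) (S1.x m ^ i) = S.x m ^ i := fun i => by rw [map_pow, emb_x hm1]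
  have hcp : emb F q (m + 1) (S1.cp m b) = S.cp m b := by
    cases b
    · simp
    · exact emb_c hm1
  have e1 : emb F q (m + 1) (gb F q m (k : ℕ) b j) = S.tu j m * (S.cp m b * S.x m ^ k) := by
    rw [gb, ← hS1, S1.xp_natCast hm1, map_mul, map_mul, hx, hcp, emb_tu hm1, mul_assoc]
  have e2 : gb F q (m + 1) (k : ℕ) b j =
      S.tu j m * (S.t m * S.cp (m + 1) b * S.x (m + 1) ^ k) := by
    rw [gb, ← hS, S.xp_natCast ht, S.tu_succ hj]
    simp only [mul_assoc]
  rw [e1, e2, mul_assoc, ← mul_sub, ← emb_tu hm1]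
  refine emb_mul_zspan _ ?_
  have hc : S.cp m b * S.t m * S.x (m + 1) ^ k - S.t m * S.cp (m + 1) b * S.x (m + 1) ^ k ∈
      zspan F q (m + 1) d := by
    cases b
    · rw [Sys.cp_false, Sys.cp_false, one_mul, mul_one, sub_self]
      exact zero_mem _
    · rw [Sys.cp_true, Sys.cp_true, S.c_t ht, ← sub_mul, sub_sub_cancel_left,
        neg_mul (α := H F q (m + 2)), smul_mul_assoc, sub_mul]
      refine neg_mem (Submodule.smul_mem _ _ (sub_mem ?_ ?_))
      · have := mem_zspan (F := F) (q := q) (n := m + 1) 1 true hk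
        rwa [map_one, one_mul] at this
      · have := mem_zspan (F := F) (q := q) (n := m + 1) (S1.c m) false hk
        rwa [emb_c hm1, Sys.cp_false, one_mul] at this
  rw [mul_assoc, S.x_pow_t ht, mul_sub, sub_right_comm, ← mul_assoc]
  refine sub_mem hc ?_
  rw [mul_smul_comm, Finset.mul_sum]
  refine Submodule.smul_mem _ _ (Submodule.sum_mem _ fun i hi => ?_)
  have hi' : i < k := Finset.mem_range.1 hi
  have hki : k - i < d := by omega
  have h1 := mem_zspan (F := F) (q := q) (n := m + 1) (S1.cp m b * S1.x m ^ i) false hki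
  have h2 := mem_zspan (F := F) (q := q) (n := m + 1) (S1.cp m b * S1.x m ^ i * S1.c m) true hki
  have h3 := sub_mem h1 h2
  rw [map_mul, map_mul, map_mul, hx, hcp, emb_c hm1, Sys.cp_false, Sys.cp_true, one_mul] at h3
  rw [← mul_assoc, mul_sub, mul_one, mul_sub, sub_mul]
  rw [← hS] at h3
  simp only [mul_assoc] at h3 ⊢
  exact h3

theorem t_emb_emb (h : H F q m) : (hsys F q (m + 2)).t m * emb F q (m + 1) (emb F q m h) =
    emb F q (m + 1) (emb F q m h) * (hsys F q (m + 2)).t m := by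
  induction h using H_induction with
  | hr r => simp [Algebra.commutes]
  | hx i hi =>
    rw [emb_x hi, emb_x (by omega), Sys.txo _ m (by omega) i (by omega) (by omega) (by omega)]
  | hy i hi =>
    rw [emb_y hi, emb_y (by omega), Sys.t_y_comm _ (by omega) (by omega) (by omega) (by omega)]
  | hc i hi =>
    rw [emb_c hi, emb_c (by omega), Sys.tco _ m (by omega) i (by omega) (by omega) (by omega)]
  | ht i hi => rw [emb_t hi, emb_t (by omega), Sys.far _ i m (by omega) (by omega)]
  | hadd a b ha hb => rw [map_add, map_add, mul_add, ha, hb, add_mul]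
  | hmul a b ha hb => rw [map_mul, map_mul, ← mul_assoc, ha, mul_assoc, hb, mul_assoc]

end mackey

section mackey

variable {F : Type} [Field F] {q : F} {m d : ℕ} {aa : ℕ → F}
  {R₀ : Type} [Ring R₀] [Algebra F R₀] {p₀ : H F q m →ₐ[F] R₀}
  {R : Type} [Ring R] [Algebra F R] {p : H F q (m + 1) →ₐ[F] R}
  {R' : Type} [Ring R'] [Algebra F R'] {p' : H F q (m + 2) →ₐ[F] R'}
  {en : R →ₐ[F] R'} {en₀ : R₀ →ₐ[F] R} {δ : R →ₐ[F] R}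
  {M : Type} [AddCommGroup M] [Module F M] {ρ : R →ₐ[F] Module.End F M}
  {E : Type} [AddCommGroup E] [Module F E] {ρE : R' →ₐ[F] Module.End F E} {ι : M →ₗ[F] E}
  {E₂ : Type} [AddCommGroup E₂] [Module F E₂] {ρE₂ : R →ₐ[F] Module.End F E₂} {ι₂ : M →ₗ[F] E₂}

/-- The translates of `M` by the elements `cp (m + 1) b * xp (m + 1) k`. -/
noncomputable def topPart (p' : H F q (m + 2) →ₐ[F] R') (ρE : R' →ₐ[F] Module.End F E)
    (ι : M →ₗ[F] E) : (Fin d × Bool → M) →ₗ[F] E :=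
  ∑ i, ρE (p' ((hsys F q (m + 2)).cp (m + 1) i.2 * (hsys F q (m + 2)).xp (m + 1) (i.1 : ℕ))) ∘ₗ
    ι ∘ₗ LinearMap.proj i

theorem topPart_apply (ν : Fin d × Bool → M) : topPart p' ρE ι ν = ∑ i : Fin d × Bool,
    ρE (p' ((hsys F q (m + 2)).cp (m + 1) i.2 * (hsys F q (m + 2)).xp (m + 1) (i.1 : ℕ)))
      (ι (ν i)) := by
  simp [topPart]

theorem topPart_emb (hen : ∀ h, en (p h) = p' (emb F q (m + 1) h))
    (hδ : ∀ h, δ (p h) = p (gr F q (m + 1) h))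
    (hι : ∀ b x, ι (ρ b x) = ρE (en b) (ι x)) (hp : Function.Surjective p) (b : R)
    (ν : Fin d × Bool → M) : ρE (en b) (topPart p' ρE ι ν) =
      topPart p' ρE ι fun i => ρ (if i.2 then δ b else b) (ν i) := by
  obtain ⟨h, rfl⟩ := hp b
  rw [topPart_apply, topPart_apply, map_sum]
  refine Finset.sum_congr rfl fun i _ => ?_
  have e : (if i.2 then δ (p h) else p h) = p (grp F q (m + 1) i.2 h) := by
    rcases i with ⟨k, _ | _⟩
    · rfl
    · exact hδ h
  rw [e, hι, hen, hen, ← Module.End.mul_apply, ← map_mul, ← map_mul, ← mul_assoc, emb_cp, mul_assoc,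
    emb_xp, ← mul_assoc, map_mul p', map_mul ρE, Module.End.mul_apply]

theorem zspan_apply_mem (hen : ∀ h, en (p h) = p' (emb F q (m + 1) h))
    (hι : ∀ b x, ι (ρ b x) = ρE (en b) (ι x)) {z : H F q (m + 2)} (hz : z ∈ zspan F q (m + 1) d)
    (x : M) : ρE (p' z) (ι x) ∈ LinearMap.range (topPart (d := d) p' ρE ι) := by
  classical
  refine apply_mem_of_span
    (LinearMap.applyₗ (ι x) ∘ₗ ρE.toLinearMap ∘ₗ p'.toLinearMap) ?_ hz
  rintro _ ⟨k, b, h, rfl⟩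
  refine ⟨Pi.single (k, b) (ρ (p h) x), ?_⟩
  rw [topPart_apply, Finset.sum_eq_single (k, b)]
  · rw [Pi.single_eq_same, hι, hen, ← Module.End.mul_apply, ← map_mul, ← map_mul]
    rfl
  · intro i _ hi
    rw [Pi.single_eq_of_ne hi, map_zero, map_zero]
  · simp

theorem exists_mackey (hf : GoodPoly F d aa)
    (hp₀ : IsCycQuot d aa p₀) (hp : IsCycQuot d aa p) (hp' : IsCycQuot d aa p')
    (hen : ∀ h, en (p h) = p' (emb F q (m + 1) h)) (hen₀ : ∀ h, en₀ (p₀ h) = p (emb F q m h))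
    (hδ : ∀ h, δ (p h) = p (gr F q (m + 1) h))
    (hE : IsInducedAlong F en ρ ρE ι) (hE₂ : IsInducedAlong F en₀ (ρ.comp en₀) ρE₂ ι₂) :
    ∃ Φ : E ≃ₗ[F] ((Fin d → M × M) × E₂), ∀ (b : R) (e : E),
      (Φ (ρE (en b) e)).1 = (fun k => (ρ b ((Φ e).1 k).1, ρ (δ b) ((Φ e).1 k).2)) ∧
        (Φ (ρE (en b) e)).2 = ρE₂ b ((Φ e).2) := by
  have hι := hE.1
  -- the map from the second induced module
  obtain ⟨Θ, ⟨hΘ, hΘι⟩, -⟩ := hE₂.2 E (ρE.comp en) (ρE (p' ((hsys F q (m + 2)).t m)) ∘ₗ ι)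
    fun b x => by
      obtain ⟨h, rfl⟩ := hp₀.surj b
      rw [LinearMap.comp_apply, LinearMap.comp_apply, AlgHom.comp_apply, AlgHom.comp_apply, hι,
        hen₀, hen, ← Module.End.mul_apply, ← Module.End.mul_apply, ← map_mul, ← map_mul, ← map_mul,
        ← map_mul, t_emb_emb]
  have hD := hE.bijective_sum _ (bijective_sum_gb hp hp' hen hf)
  have hD₂ := hE₂.bijective_sum _ (bijective_sum_gb hp₀ hp hen₀ hf)
  -- splitting off the last summand of the first induced module
  have hsplit : ∀ ν : Fin d × Bool × Fin (m + 2) → M,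
      ∑ i, ρE (p' (gb F q (m + 1) (i.1 : ℕ) i.2.1 i.2.2)) (ι (ν i)) =
        (∑ i : Fin d × Bool × Fin (m + 1),
          ρE (p' (gb F q (m + 1) (i.1 : ℕ) i.2.1 i.2.2)) (ι (ν (i.1, i.2.1, i.2.2.castSucc)))) +
        topPart p' ρE ι fun i => ν (i.1, i.2, Fin.last (m + 1)) := by
    intro ν
    rw [topPart_apply]
    simp only [Fintype.sum_prod_type, ← Finset.sum_add_distrib]
    refine Finset.sum_congr rfl fun k _ => Finset.sum_congr rfl fun b _ => ?_
    rw [Fin.sum_univ_castSucc]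
    congr 2
    rw [gb, Fin.val_last, Sys.tu_of_le _ le_rfl, one_mul]
  have hΘD : ∀ μ : Fin d × Bool × Fin (m + 1) → M, ∃ τ : Fin d × Bool → M,
      Θ (∑ i, ρE₂ (p (gb F q m (i.1 : ℕ) i.2.1 i.2.2)) (ι₂ (μ i))) =
        (∑ i, ρE (p' (gb F q (m + 1) (i.1 : ℕ) i.2.1 i.2.2)) (ι (μ i))) +
          topPart p' ρE ι τ := by
    intro μ
    suffices Θ (∑ i, ρE₂ (p (gb F q m (i.1 : ℕ) i.2.1 i.2.2)) (ι₂ (μ i))) -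
        (∑ i, ρE (p' (gb F q (m + 1) (i.1 : ℕ) i.2.1 i.2.2)) (ι (μ i))) ∈
          LinearMap.range (topPart (d := d) p' ρE ι) by
      obtain ⟨τ, hτ⟩ := this
      exact ⟨τ, by rw [hτ, add_sub_cancel]⟩
    rw [map_sum, ← Finset.sum_sub_distrib]
    refine Submodule.sum_mem _ fun i _ => ?_
    rw [hΘ, hΘι, AlgHom.comp_apply, hen, LinearMap.comp_apply, ← Module.End.mul_apply, ← map_mul,
      ← map_mul, ← LinearMap.sub_apply, ← map_sub, ← map_sub]
    exact zspan_apply_mem hen hι (emb_gb_mul_t i.1.2 i.2.1 (Nat.lt_succ_iff.1 i.2.2.2)) _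
  let merge : (Fin d → M × M) →ₗ[F] (Fin d × Bool → M) := LinearMap.pi fun i =>
    if i.2 then LinearMap.snd F M M ∘ₗ LinearMap.proj i.1
    else LinearMap.fst F M M ∘ₗ LinearMap.proj i.1
  have hmerge_bij : Function.Bijective merge := by
    refine Function.bijective_iff_has_inverse.2
      ⟨fun ν k => (ν (k, false), ν (k, true)), fun τ => rfl, fun ν => ?_⟩
    ext ⟨k, _ | _⟩ <;> rfl
  let Ψ : (Fin d → M × M) × E₂ →ₗ[F] E := (topPart p' ρE ι ∘ₗ merge).coprod Θ
  have hΨ : ∀ τ e, Ψ (τ, e) = topPart p' ρE ι (merge τ) + Θ e := fun τ e => rfl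
  have hΨ_bij : Function.Bijective Ψ := by
    constructor
    · rw [← LinearMap.ker_eq_bot, LinearMap.ker_eq_bot']
      rintro ⟨τ, e⟩ h0
      obtain ⟨μ, rfl⟩ := hD₂.2 e
      obtain ⟨σ, hσ⟩ := hΘD μ
      simp only at h0 ⊢
      rw [hΨ, hσ] at h0
      let ν : Fin d × Bool × Fin (m + 2) → M := fun i =>
        Fin.lastCases (merge τ (i.1, i.2.1) + σ (i.1, i.2.1)) (fun j => μ (i.1, i.2.1, j)) i.2.2
      have hν : ν = 0 := by
        apply hD.1
        simp only [Pi.zero_apply, map_zero, Finset.sum_const_zero]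
        rw [hsplit, ← h0, add_left_comm, ← map_add]
        congr 1
        · refine Finset.sum_congr rfl fun i _ => ?_
          simp only [ν, Fin.lastCases_castSucc]
        · congr 1
          ext i
          simp only [ν, Fin.lastCases_last, Pi.add_apply]
      have hμ : μ = 0 := by
        ext ⟨k, b, j⟩
        have := congrFun hν (k, b, j.castSucc)
        simpa only [ν, Fin.lastCases_castSucc, Pi.zero_apply] using this
      subst hμ
      simp only [Pi.zero_apply, map_zero, Finset.sum_const_zero, zero_add] at hσ
      have hτ : merge τ = 0 := by
        let ν' : Fin d × Bool × Fin (m + 2) → M := fun i =>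
          Fin.lastCases (merge τ (i.1, i.2.1)) (fun j => 0) i.2.2
        have hν' : ν' = 0 := by
          apply hD.1
          simp only [Pi.zero_apply, map_zero, Finset.sum_const_zero]
          rw [hsplit]
          simp only [ν', Fin.lastCases_castSucc, Fin.lastCases_last, map_zero,
            Finset.sum_const_zero, zero_add]
          rw [← hσ, add_zero] at h0
          simpa using h0
        ext ⟨k, b⟩
        have := congrFun hν' (k, b, Fin.last _)
        simpa only [ν', Fin.lastCases_last, Pi.zero_apply] using this
      have : τ = 0 := hmerge_bij.1 (by rw [hτ, map_zero])
      rw [this]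
      simp
    · intro e
      obtain ⟨ν, rfl⟩ := hD.2 e
      obtain ⟨σ, hσ⟩ := hΘD fun i => ν (i.1, i.2.1, i.2.2.castSucc)
      obtain ⟨τ, hτ⟩ := hmerge_bij.2 ((fun i => ν (i.1, i.2, Fin.last (m + 1))) - σ)
      refine ⟨(τ, ∑ i : Fin d × Bool × Fin (m + 1),
        ρE₂ (p (gb F q m (i.1 : ℕ) i.2.1 i.2.2)) (ι₂ (ν (i.1, i.2.1, i.2.2.castSucc)))), ?_⟩
      simp only
      rw [hΨ, hσ, hsplit, hτ, map_sub]
      abel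
  have hΨ_act : ∀ b τ e, Ψ (fun k => (ρ b (τ k).1, ρ (δ b) (τ k).2), ρE₂ b e) =
      ρE (en b) (Ψ (τ, e)) := by
    intro b τ e
    rw [hΨ, hΨ, map_add, hΘ, topPart_emb hen hδ hι hp.surj, AlgHom.comp_apply]
    congr 2
    ext ⟨k, _ | _⟩ <;> rfl
  refine ⟨(LinearEquiv.ofBijective Ψ hΨ_bij).symm, fun b e => ?_⟩
  obtain ⟨⟨τ, e₂⟩, rfl⟩ := hΨ_bij.2 e
  have hsymm : ∀ x, (LinearEquiv.ofBijective Ψ hΨ_bij).symm (Ψ x) = x :=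
    (LinearEquiv.ofBijective Ψ hΨ_bij).symm_apply_apply
  rw [← hΨ_act, hsymm, hsymm]
  exact ⟨rfl, rfl⟩

end mackey

/-- **Cyclotomic Mackey theorem** (Theorem `cycloMackey` of Brundan–Kleshchev): for
every `H_n^f`-module `M` there is an isomorphism of `H_n^f`-modules
`res^{H_{n+1}^f}_{H_n^f} ind^{H_{n+1}^f}_{H_n^f} M ≅ (M ⊕ ΠM)^{⊕d} ⊕
ind^{H_n^f}_{H_{n-1}^f} res^{H_n^f}_{H_{n-1}^f} M`.  Here `ΠM` is the parity-changed
module, whose action is the original one twisted by the grading automorphism `δ` of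
`H_n^f`. -/
theorem cyclotomic_mackey
    (F : Type) [Field F] [IsAlgClosed F] (h2 : (2 : F) ≠ 0)
    (q : F) (hq : GoodParam F q) (n : ℕ) (hn : 0 < n)
    (d : ℕ) (aa : ℕ → F) (hf : GoodPoly F d aa)
    (en : Hf F q n d aa →ₐ[F] Hf F q (n + 1) d aa)
    (hen : IsCycEmb F q n (n + 1) d aa 0 en)
    (en0 : Hf F q (n - 1) d aa →ₐ[F] Hf F q n d aa)
    (hen0 : IsCycEmb F q (n - 1) n d aa 0 en0)
    (δn : Hf F q n d aa →ₐ[F] Hf F q n d aa) (hδn : IsCycGrading F q n d aa δn)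
    (M : Type) [AddCommGroup M] [Module F M]
    (ρ : Hf F q n d aa →ₐ[F] Module.End F M)
    (E : Type) [AddCommGroup E] [Module F E]
    (ρE : Hf F q (n + 1) d aa →ₐ[F] Module.End F E) (ι : M →ₗ[F] E)
    (hInd : IsInducedAlong F (A := Hf F q (n + 1) d aa) (B := Hf F q n d aa) en ρ ρE ι)
    (E2 : Type) [AddCommGroup E2] [Module F E2]
    (ρE2 : Hf F q n d aa →ₐ[F] Module.End F E2) (ι2 : M →ₗ[F] E2)
    (hInd2 : IsInducedAlong F (A := Hf F q n d aa) (B := Hf F q (n - 1) d aa) en0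
      (ρ.comp en0) ρE2 ι2) :
    ∃ Φ : E ≃ₗ[F] ((Fin d → M × M) × E2),
      ∀ (b : Hf F q n d aa) (e : E),
        (Φ (ρE (en b) e)).1 =
            (fun k => (ρ b ((Φ e).1 k).1, ρ (δn b) ((Φ e).1 k).2)) ∧
          (Φ (ρE (en b) e)).2 = ρE2 b ((Φ e).2) := by
  obtain ⟨m, rfl⟩ := Nat.exists_eq_succ_of_ne_zero hn.ne'
  exact exists_mackey hf isCycQuot_cyc isCycQuot_cyc isCycQuot_cyc hen.apply_cyc
    (IsCycEmb.apply_cyc (n := m) hen0) hδn.apply_cyc hInd hInd2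

end HC
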